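/- Let k ≥ 3 and let G be a 2-connected graph on n vertices with minimum degree at least k that contains a subgraph F isomorphic to a member of the family ℱ. Let (S,T) be the bipartition of F, with s = |S|, t = |T|, and r = min{s,t}. If every vertex of G outside V(F) has at most r−1 neighbors in F, then G contains k admissible cycles, unless G is isomorphic to K_{k+1} or to K_{k,n-k}. -/

import Mathlib

open SimpleGraph

/-- `G` has a cycle of length `n`. -/
def HasCycleLen {V : Type*} (G : SimpleGraph V) (n : ℕ) : Prop :=
  ∃ (v : V) (c : G.Walk v v), c.IsCycle ∧ c.length = n

/-- `G` contains `k` admissible cycles: `k` cycles whose lengths form an arithmetic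
progression with common difference 1 or 2. -/
def HasAdmissibleCycles {V : Type*} (G : SimpleGraph V) (k : ℕ) : Prop :=
  ∃ a d : ℕ, (d = 1 ∨ d = 2) ∧ ∀ i < k, HasCycleLen G (a + i * d)

/-- `G` is `t`-connected: it has at least `t+1` vertices and the deletion of any set
of at most `t-1` vertices leaves a connected graph. -/
def KConnected {V : Type*} [Fintype V] (G : SimpleGraph V) (t : ℕ) : Prop :=
  t + 1 ≤ Fintype.card V ∧
    ∀ S : Finset V, S.card ≤ t - 1 → (G.induce ((↑S : Set V)ᶜ)).Connected

namespace AdmissiblePaths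

set_option linter.unusedSectionVars false

/-- `S` contains an arithmetic progression of `k` terms with difference 1 or 2. -/
def AP (S : ℕ → Prop) (k : ℕ) : Prop :=
  ∃ a d : ℕ, (d = 1 ∨ d = 2) ∧ ∀ i < k, S (a + i * d)

theorem AP.mono {S S' : ℕ → Prop} {k : ℕ} (h : AP S k) (hS : ∀ n, S n → S' n) : AP S' k := by
  obtain ⟨a, d, hd, h⟩ := h
  exact ⟨a, d, hd, fun i hi => hS _ (h i hi)⟩

theorem AP.le {S : ℕ → Prop} {k k' : ℕ} (h : AP S k) (hk : k' ≤ k) : AP S k' := by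
  obtain ⟨a, d, hd, h⟩ := h
  exact ⟨a, d, hd, fun i hi => h i (by omega)⟩

theorem AP.shift {S S' : ℕ → Prop} {k : ℕ} (c : ℕ) (h : AP S k) (hS : ∀ n, S n → S' (n + c)) :
    AP S' k := by
  obtain ⟨a, d, hd, h⟩ := h
  exact ⟨a + c, d, hd, fun i hi => by
    have := hS _ (h i hi); rwa [show a + c + i * d = a + i * d + c by omega]⟩

theorem AP.zero (S : ℕ → Prop) : AP S 0 := ⟨0, 1, Or.inl rfl, fun i hi => by omega⟩

theorem AP.one {S : ℕ → Prop} {n : ℕ} (h : S n) : AP S 1 :=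
  ⟨n, 1, Or.inl rfl, fun i hi => by obtain rfl : i = 0 := by omega
                                    simpa using h⟩

theorem AP.two {S : ℕ → Prop} {n m : ℕ} (h : S n) (h' : S m) (hnm : m = n + 1 ∨ m = n + 2) :
    AP S 2 := by
  refine ⟨n, m - n, by omega, fun i hi => ?_⟩
  obtain rfl | rfl : i = 0 ∨ i = 1 := by omega
  · simpa using h
  · rw [show n + 1 * (m - n) = m by omega]; exact h'

/-- Summing two progressions of lengths `m` and `n` gives one of length `m + n - 1`. -/
theorem AP.add {S T U : ℕ → Prop} {m n : ℕ} (c : ℕ) (hS : AP S m) (hT : AP T n) (hm : 1 ≤ m)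
    (hn : 1 ≤ n) (h : ∀ p q, S p → T q → U (p + q + c)) : AP U (m + n - 1) := by
  obtain ⟨a, d, hd, hS⟩ := hS
  obtain ⟨b, e, he, hT⟩ := hT
  have key : ∀ i j, i < m → j < n → U (a + b + c + (i * d + j * e)) := fun i j hi hj => by
    have := h _ _ (hS i hi) (hT j hj)
    rwa [show a + i * d + (b + j * e) + c = a + b + c + (i * d + j * e) by omega] at this
  by_cases hde : d = e
  · subst hde
    refine ⟨a + b + c, d, hd, fun i hi => ?_⟩
    by_cases him : i < m
    · simpa using key i 0 him (by omega)
    · have := key (m - 1) (i - (m - 1)) (by omega) (by omega)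
      rwa [← Nat.add_mul, show m - 1 + (i - (m - 1)) = i by omega] at this
  by_cases hm1 : m = 1
  · exact ⟨a + b + c, e, he, fun i hi => by simpa using key 0 i hm (by omega)⟩
  by_cases hn1 : n = 1
  · exact ⟨a + b + c, d, hd, fun i hi => by simpa using key i 0 (by omega) hn⟩
  refine ⟨a + b + c, 1, Or.inl rfl, fun i hi => ?_⟩
  obtain ⟨rfl, rfl⟩ | ⟨rfl, rfl⟩ : (d = 1 ∧ e = 2) ∨ (d = 2 ∧ e = 1) := by omega
  · obtain ⟨x, y, hx, hy, hxy⟩ : ∃ x y, x < m ∧ y < n ∧ i = x * 1 + y * 2 := by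
      by_cases hin : i / 2 < n
      · exact ⟨i % 2, i / 2, by omega, hin, by omega⟩
      · exact ⟨i - 2 * (n - 1), n - 1, by omega, by omega, by omega⟩
    rw [mul_one, hxy]; exact key x y hx hy
  · obtain ⟨x, y, hx, hy, hxy⟩ : ∃ x y, x < m ∧ y < n ∧ i = x * 2 + y * 1 := by
      by_cases hin : i / 2 < m
      · exact ⟨i / 2, i % 2, hin, by omega, by omega⟩
      · exact ⟨m - 1, i - 2 * (m - 1), by omega, by omega, by omega⟩
    rw [mul_one, hxy]; exact key x y hx hy

variable {V : Type*} [DecidableEq V] {G : SimpleGraph V}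

/-- There is a path of length `n` from `u` to `v` all of whose vertices are in `A`. -/
inductive Pth (G : SimpleGraph V) : Finset V → V → V → ℕ → Prop
  | nil {A : Finset V} {v : V} : v ∈ A → Pth G A v v 0
  | cons {A : Finset V} {u u' v : V} {n : ℕ} :
      u ∈ A → G.Adj u u' → Pth G (A.erase u) u' v n → Pth G A u v (n + 1)

namespace Pth

variable {A B : Finset V} {u v w z : V} {m n : ℕ}

theorem start_mem (h : Pth G A u v n) : u ∈ A := by cases h <;> assumption

theorem end_mem (h : Pth G A u v n) : v ∈ A := by
  induction h with
  | nil h => exact h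
  | cons _ _ _ ih => exact Finset.mem_of_mem_erase ih

theorem mono (h : Pth G A u v n) (hAB : A ⊆ B) : Pth G B u v n := by
  induction h generalizing B with
  | nil h => exact .nil (hAB h)
  | cons h1 h2 _ ih => exact .cons (hAB h1) h2 (ih (Finset.erase_subset_erase _ hAB))

theorem adj (h : G.Adj u v) (hu : u ∈ A) (hv : v ∈ A) : Pth G A u v 1 :=
  .cons hu h (.nil (Finset.mem_erase.2 ⟨h.ne', hv⟩))

theorem cons' (h : Pth G A u v n) (hw : w ∉ A) (hwu : G.Adj w u) :
    Pth G (insert w A) w v (n + 1) :=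
  .cons (Finset.mem_insert_self _ _) hwu (by rwa [Finset.erase_insert hw])

/-- Paths in disjoint sets joined by an edge. -/
theorem concat (h : Pth G A u v n) (h' : Pth G B w z m) (hAB : Disjoint A B) (hvw : G.Adj v w) :
    Pth G (A ∪ B) u z (n + m + 1) := by
  induction h generalizing B with
  | @nil A v h =>
    rw [zero_add]
    refine .cons (Finset.mem_union_left _ h) hvw (h'.mono fun x hx => ?_)
    simp only [Finset.mem_erase, Finset.mem_union]
    exact ⟨fun hxv => Finset.disjoint_left.1 hAB h (hxv ▸ hx), .inr hx⟩
  | @cons A u u' v n h1 h2 h3 ih =>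
    rw [show n + 1 + m + 1 = (n + m + 1) + 1 by omega]
    refine .cons (Finset.mem_union_left _ h1) h2
      ((ih h' (hAB.mono_left (Finset.erase_subset _ _)) hvw).mono fun x hx => ?_)
    simp only [Finset.mem_erase, Finset.mem_union] at hx ⊢
    rcases hx with hx | hx
    · exact ⟨hx.1, .inl hx.2⟩
    · exact ⟨fun hxv => Finset.disjoint_left.1 hAB h1 (hxv ▸ hx), .inr hx⟩

theorem snoc (h : Pth G A u v n) (hw : w ∉ A) (hvw : G.Adj v w) :
    Pth G (insert w A) u w (n + 1) := by
  have := h.concat (.nil (Finset.mem_singleton_self w)) (Finset.disjoint_singleton_right.2 hw) hvw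
  exact this.mono (by intro x; simp)

theorem symm (h : Pth G A u v n) : Pth G A v u n := by
  induction h with
  | nil h => exact .nil h
  | cons h1 h2 _ ih =>
    have := ih.snoc (Finset.notMem_erase _ _) h2.symm
    rwa [Finset.insert_erase h1] at this

/-- Paths sharing only one end. -/
theorem glue (h : Pth G A u v n) (h' : Pth G B v z m) (hAB : Disjoint A (B.erase v)) :
    Pth G (A ∪ B) u z (n + m) := by
  induction h generalizing B with
  | nil h => rw [zero_add]; exact h'.mono Finset.subset_union_right
  | @cons A u u' v n h1 h2 h3 ih =>
    rw [show n + 1 + m = (n + m) + 1 by omega]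
    have huv : v ≠ u := fun e => by simpa [e] using h3.end_mem
    have huB : u ∉ B := fun hu =>
      Finset.disjoint_left.1 hAB h1 (Finset.mem_erase.2 ⟨huv.symm, hu⟩)
    refine .cons (Finset.mem_union_left _ h1) h2
      ((ih h' (hAB.mono_left (Finset.erase_subset _ _))).mono fun x hx => ?_)
    simp only [Finset.mem_erase, Finset.mem_union] at hx ⊢
    rcases hx with hx | hx
    · exact ⟨hx.1, .inl hx.2⟩
    · exact ⟨fun hxv => huB (hxv ▸ hx), .inr hx⟩

theorem exists_extend (h : Pth G A u v n) (hvw : G.Adj v w) (hw : w ∈ A) :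
    ∃ m, Pth G A u w m := by
  induction h with
  | @nil A v h => exact ⟨1, adj hvw h hw⟩
  | @cons A u u' v n h1 h2 _ ih =>
    by_cases hwu : w = u
    · exact ⟨0, hwu ▸ .nil (hwu ▸ hw)⟩
    · obtain ⟨m, hm⟩ := ih hvw (Finset.mem_erase.2 ⟨hwu, hw⟩)
      exact ⟨m + 1, .cons h1 h2 hm⟩

theorem exists_walk (h : Pth G A u v n) :
    ∃ p : G.Walk u v, p.IsPath ∧ p.length = n ∧ ∀ x ∈ p.support, x ∈ A := by
  induction h with
  | nil h => exact ⟨.nil, by simp, rfl, by simpa using h⟩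
  | @cons A u u' v n h1 h2 _ ih =>
    obtain ⟨p, hp, hn, hs⟩ := ih
    refine ⟨.cons h2 p, ?_, by simp [hn], ?_⟩
    · rw [Walk.cons_isPath_iff]
      exact ⟨hp, fun hu => by simpa using hs u hu⟩
    · simp only [Walk.support_cons, List.mem_cons, forall_eq_or_imp]
      exact ⟨h1, fun x hx => Finset.mem_of_mem_erase (hs x hx)⟩

/-- A path of length at least 2 whose ends are adjacent closes up to a cycle. -/
theorem cycle (h : Pth G A u v n) (hn : 2 ≤ n) (huv : G.Adj v u) : HasCycleLen G (n + 1) := by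
  cases h with
  | nil => omega
  | @cons _ _ u' _ n h1 h2 h3 =>
    obtain ⟨p, hp, hl, hs⟩ := h3.exists_walk
    have hu : u ∉ p.support := fun hu => by simpa using hs u hu
    refine ⟨u, .cons h2 (p.concat huv), ?_, by simp [hl]⟩
    rw [Walk.cons_isCycle_iff]
    refine ⟨hp.concat hu huv, fun he => ?_⟩
    rw [Walk.edges_concat, List.concat_eq_append, List.mem_append, List.mem_singleton] at he
    rcases he with he | he
    · exact hu (Walk.fst_mem_support_of_mem_edges _ he)
    · have : u' = v := by
        simp only [Sym2.eq_iff] at he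
        rcases he with he | he
        · exact absurd he.1 huv.ne'
        · exact he.2
      subst this
      have := Walk.length_eq_zero_iff.2 (Walk.isPath_iff_nil.1 hp)
      omega

/-- Two paths in disjoint sets joined by two edges form a cycle. -/
theorem cycle_concat (h : Pth G A u v n) (h' : Pth G B w z m) (hAB : Disjoint A B)
    (hvw : G.Adj v w) (hzu : G.Adj z u) (hnm : 1 ≤ n + m) : HasCycleLen G (n + m + 2) :=
  (h.concat h' hAB hvw).cycle (by omega) hzu

end Pth

open Classical in
/-- The indicator of a proposition. -/
noncomputable def ind (p : Prop) : ℕ := if p then 1 else 0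

theorem ind_pos {p : Prop} (h : p) : ind p = 1 := by simp [ind, h]

theorem ind_neg {p : Prop} (h : ¬p) : ind p = 0 := by simp [ind, h]

theorem ind_le_one (p : Prop) : ind p ≤ 1 := by unfold ind; split <;> simp

theorem ind_mono {p q : Prop} (h : p → q) : ind p ≤ ind q := by
  by_cases hp : p
  · rw [ind_pos hp, ind_pos (h hp)]
  · rw [ind_neg hp]; exact Nat.zero_le _

open Classical in
/-- The vertices of `D` with a neighbour in `W`. -/
noncomputable def nbS (G : SimpleGraph V) (D W : Finset V) : Finset V :=
  D.filter fun v => ∃ w ∈ W, G.Adj w v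

@[simp] theorem mem_nbS {D W : Finset V} {v : V} :
    v ∈ nbS G D W ↔ v ∈ D ∧ ∃ w ∈ W, G.Adj w v := by simp [nbS]

theorem nbS_subset (G : SimpleGraph V) (D W : Finset V) : nbS G D W ⊆ D :=
  fun _ hv => (mem_nbS.1 hv).1

open Classical in
/-- The neighbours of `v` in `A`. -/
noncomputable def nbs (G : SimpleGraph V) (A : Finset V) (v : V) : Finset V :=
  A.filter (G.Adj v)

@[simp] theorem mem_nbs {A : Finset V} {u v : V} : u ∈ nbs G A v ↔ u ∈ A ∧ G.Adj v u := by
  simp [nbs]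

theorem nbs_subset (G : SimpleGraph V) (A : Finset V) (v : V) : nbs G A v ⊆ A :=
  fun _ hv => (mem_nbs.1 hv).1

/-- The number of neighbours of `v` in `A`. -/
noncomputable def nb (G : SimpleGraph V) (A : Finset V) (v : V) : ℕ := (nbs G A v).card

theorem nb_mono {A B : Finset V} (h : A ⊆ B) (v : V) : nb G A v ≤ nb G B v :=
  Finset.card_le_card fun x hx => by simp at hx ⊢; exact ⟨h hx.1, hx.2⟩

theorem nb_le_card (A : Finset V) (v : V) : nb G A v ≤ A.card :=
  Finset.card_le_card (nbs_subset G A v)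

theorem nb_union_le (A B : Finset V) (v : V) : nb G (A ∪ B) v ≤ nb G A v + nb G B v := by
  refine le_trans (Finset.card_le_card fun x hx => ?_) (Finset.card_union_le _ _)
  simp at hx ⊢; tauto

theorem nb_union {A B : Finset V} (h : Disjoint A B) (v : V) :
    nb G (A ∪ B) v = nb G A v + nb G B v := by
  rw [nb, nb, nb, ← Finset.card_union_of_disjoint]
  · congr 1; ext; simp; tauto
  · exact h.mono (nbs_subset _ _ _) (nbs_subset _ _ _)

theorem nb_pos {A : Finset V} {v : V} : 0 < nb G A v ↔ ∃ u ∈ A, G.Adj v u := by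
  simp [nb, Finset.card_pos, Finset.Nonempty]

theorem nb_eq_zero {A : Finset V} {v : V} : nb G A v = 0 ↔ ∀ u ∈ A, ¬G.Adj v u := by
  rw [← not_iff_not, ← ne_eq, ← Nat.pos_iff_ne_zero, nb_pos]; push Not; rfl

theorem adj_of_nb_ge {A : Finset V} {v : V} (h : A.card ≤ nb G A v) : ∀ u ∈ A, G.Adj v u := by
  have := Finset.eq_of_subset_of_card_le (nbs_subset G A v) h
  intro u hu; rw [← this] at hu; exact (mem_nbs.1 hu).2

theorem nb_le_ind {A : Finset V} {v : V} (h : nb G A v ≤ 1) :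
    nb G A v ≤ ind (∃ u ∈ A, G.Adj u v) := by
  by_cases h0 : 0 < nb G A v
  · obtain ⟨u, hu, hu'⟩ := nb_pos.1 h0
    rw [ind_pos ⟨u, hu, hu'.symm⟩]; exact h
  · omega

/-- The boundary in `E` of a subset `D`. -/
noncomputable def bd (G : SimpleGraph V) (E D : Finset V) : Finset V := nbS G (E \ D) D

@[simp] theorem mem_bd {E D : Finset V} {v : V} :
    v ∈ bd G E D ↔ (v ∈ E ∧ v ∉ D) ∧ ∃ d ∈ D, G.Adj d v := by simp [bd]

/-- `D` is closed under adjacency in `A`. -/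
def Closed (G : SimpleGraph V) (A D : Finset V) : Prop :=
  ∀ d ∈ D, ∀ c ∈ A, G.Adj d c → c ∈ D

theorem Closed.mem_of_pth {A D : Finset V} (h : Closed G A D) {u v : V} {n : ℕ}
    (hp : Pth G A u v n) (hu : u ∈ D) : v ∈ D := by
  induction hp with
  | nil _ => exact hu
  | @cons A u u' v n h1 h2 h3 ih =>
    exact ih (fun d hd c hc => h d hd c (Finset.mem_of_mem_erase hc))
      (h u hu u' (Finset.mem_of_mem_erase h3.start_mem) h2)

theorem closed_iff_bd {A D : Finset V} : Closed G A D ↔ bd G A D = ∅ := by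
  rw [Finset.eq_empty_iff_forall_notMem]
  simp only [mem_bd, Closed]
  constructor
  · rintro h x ⟨⟨h1, h2⟩, d, hd, hdx⟩; exact h2 (h d hd x h1 hdx)
  · intro h d hd c hc hdc; by_contra hcD; exact h c ⟨⟨hc, hcD⟩, d, hd, hdc⟩

open Classical in
/-- The vertices reachable from `v` in `A`. -/
noncomputable def comp (G : SimpleGraph V) (A : Finset V) (v : V) : Finset V :=
  A.filter fun u => ∃ n, Pth G A v u n

open Classical in
theorem mem_comp {A : Finset V} {u v : V} : u ∈ comp G A v ↔ ∃ n, Pth G A v u n := by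
  rw [comp, Finset.mem_filter, and_iff_right_iff_imp]
  rintro ⟨n, hn⟩; exact hn.end_mem

open Classical in
theorem comp_subset (G : SimpleGraph V) (A : Finset V) (v : V) : comp G A v ⊆ A := by
  unfold comp; exact Finset.filter_subset _ _

theorem self_mem_comp {A : Finset V} {v : V} (hv : v ∈ A) : v ∈ comp G A v :=
  mem_comp.2 ⟨0, .nil hv⟩

theorem comp_closed (A : Finset V) (v : V) : Closed G A (comp G A v) := by
  intro d hd c hc hdc
  obtain ⟨n, hn⟩ := mem_comp.1 hd
  exact mem_comp.2 (hn.exists_extend hdc hc)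

theorem comp_connected {A D : Finset V} {v : V} (hD : D ⊆ comp G A v) (hne : D.Nonempty)
    (hc : Closed G (comp G A v) D) : D = comp G A v := by
  have hcA : Closed G A D := fun d hd c hcA hdc =>
    hc d hd c (comp_closed A v d (hD hd) c hcA hdc) hdc
  obtain ⟨d, hd⟩ := hne
  obtain ⟨n, hn⟩ := mem_comp.1 (hD hd)
  have hv := hcA.mem_of_pth hn.symm hd
  refine hD.antisymm fun u hu => ?_
  obtain ⟨m, hm⟩ := mem_comp.1 hu
  exact hcA.mem_of_pth hm hv

theorem two_start {A Y : Finset V} {b b' : V} (hb : b ∈ A) (hb' : b' ∈ A) (hbb : b ≠ b') :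
    (∃ y ∈ Y, ∃ n, Pth G (A.erase b') b y n) ∨ (∃ y ∈ Y, ∃ n, Pth G (A.erase b) b' y n) ∨
    ∃ D ⊆ A, b ∈ D ∧ b' ∈ D ∧ (¬∃ v ∈ D, v ∈ Y) ∧ Closed G A D := by
  by_cases h1 : ∃ y ∈ Y, ∃ n, Pth G (A.erase b') b y n
  · exact .inl h1
  by_cases h2 : ∃ y ∈ Y, ∃ n, Pth G (A.erase b) b' y n
  · exact .inr (.inl h2)
  refine .inr (.inr ⟨comp G (A.erase b') b ∪ comp G (A.erase b) b', ?_, ?_, ?_, ?_, ?_⟩)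
  · exact Finset.union_subset ((comp_subset _ _ _).trans (Finset.erase_subset _ _))
      ((comp_subset _ _ _).trans (Finset.erase_subset _ _))
  · exact Finset.mem_union_left _ (self_mem_comp (Finset.mem_erase.2 ⟨hbb, hb⟩))
  · exact Finset.mem_union_right _ (self_mem_comp (Finset.mem_erase.2 ⟨hbb.symm, hb'⟩))
  · rintro ⟨v, hv, hvY⟩
    rcases Finset.mem_union.1 hv with hv | hv
    · exact h1 ⟨v, hvY, mem_comp.1 hv⟩
    · exact h2 ⟨v, hvY, mem_comp.1 hv⟩
  · have e1 : b ∈ comp G (A.erase b') b := self_mem_comp (Finset.mem_erase.2 ⟨hbb, hb⟩)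
    have e2 : b' ∈ comp G (A.erase b) b' := self_mem_comp (Finset.mem_erase.2 ⟨hbb.symm, hb'⟩)
    intro d hd c hc hdc
    rw [Finset.mem_union] at hd ⊢
    rcases hd with hd | hd
    · by_cases hcb : c = b'
      · exact .inr (hcb ▸ e2)
      · exact .inl (comp_closed _ _ d hd c (Finset.mem_erase.2 ⟨hcb, hc⟩) hdc)
    · by_cases hcb : c = b
      · exact .inl (hcb ▸ e1)
      · exact .inr (comp_closed _ _ d hd c (Finset.mem_erase.2 ⟨hcb, hc⟩) hdc)

/-- Adding to `G[E]` a root adjacent to `X` and a root adjacent to `Y`, and an edge between the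
roots, gives a 2-connected graph. -/
def Conn (G : SimpleGraph V) (E X Y : Finset V) : Prop :=
  ∀ D ⊆ E, D.Nonempty → 2 ≤ (bd G E D).card + ind (∃ v ∈ D, v ∈ X) + ind (∃ v ∈ D, v ∈ Y)

theorem Conn.symm {E X Y : Finset V} (h : Conn G E X Y) : Conn G E Y X := fun D hD hne => by
  have := h D hD hne; omega

/-- There is a path of length `n` in `E` from `X` to `Y`. -/
def HasLen (G : SimpleGraph V) (E X Y : Finset V) (n : ℕ) : Prop :=
  ∃ u ∈ X, ∃ v ∈ Y, Pth G E u v n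

theorem HasLen.symm {E X Y : Finset V} {n : ℕ} (h : HasLen G E X Y n) : HasLen G E Y X n := by
  obtain ⟨u, hu, v, hv, h⟩ := h
  exact ⟨v, hv, u, hu, h.symm⟩

theorem Conn.not_closed {E X Y D : Finset V} (h : Conn G E X Y) (hD : D ⊆ E) (hne : D.Nonempty)
    (hc : Closed G E D) : (∃ v ∈ D, v ∈ X) ∧ (∃ v ∈ D, v ∈ Y) := by
  have := h D hD hne
  rw [closed_iff_bd.1 hc] at this
  have h1 := ind_le_one (∃ v ∈ D, v ∈ X)
  have h2 := ind_le_one (∃ v ∈ D, v ∈ Y)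
  constructor <;> by_contra hcon <;> rw [ind_neg hcon] at this <;> simp at this <;> omega

theorem Conn.exists_pth {E X Y : Finset V} (h : Conn G E X Y) {v : V} (hv : v ∈ E) :
    (∃ y ∈ Y, ∃ n, Pth G E v y n) := by
  obtain ⟨-, y, hy, hyY⟩ := h.not_closed (comp_subset _ _ _) ⟨v, self_mem_comp hv⟩ (comp_closed E v)
  exact ⟨y, hyY, mem_comp.1 hy⟩

theorem Conn.hasLen {E X Y : Finset V} (h : Conn G E X Y) (hE : E.Nonempty) :
    ∃ n, HasLen G E X Y n := by
  obtain ⟨⟨x, hx, hxX⟩, -⟩ := h.not_closed subset_rfl hE (fun _ _ c hc _ => hc)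
  obtain ⟨y, hy, n, hn⟩ := h.exists_pth hx
  exact ⟨n, x, hxX, y, hy, hn⟩

theorem Pth.last_exit {A D : Finset V} {u y : V} {n : ℕ} (h : Pth G A u y n) (hy : y ∉ D) :
    Pth G (A \ D) u y n ∨ ∃ e ∈ D, ∃ p, G.Adj e p ∧ ∃ m, Pth G (A \ D) p y m := by
  induction h with
  | nil h => exact .inl (.nil (Finset.mem_sdiff.2 ⟨h, hy⟩))
  | @cons A u u' v n h1 h2 h3 ih =>
    rcases ih hy with ih | ⟨e, he, p, hep, m, hm⟩
    · by_cases hu : u ∈ D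
      · exact .inr ⟨u, hu, u', h2, n, ih.mono (Finset.sdiff_subset_sdiff (Finset.erase_subset _ _)
          subset_rfl)⟩
      · refine .inl (.cons (Finset.mem_sdiff.2 ⟨h1, hu⟩) h2 (ih.mono ?_))
        intro x; simp; tauto
    · exact .inr ⟨e, he, p, hep, m, hm.mono (Finset.sdiff_subset_sdiff (Finset.erase_subset _ _)
          subset_rfl)⟩

/-- A set `D` outside `F` with at most one exit outside `F`, together with a way of extending paths
from its exit target `Yd` to `Y`. -/
structure Pocket (G : SimpleGraph V) (E Y F D Yd : Finset V) (c : ℕ) : Prop where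
  sub : D ⊆ E \ F
  ne : D.Nonempty
  tgt : Yd ⊆ D
  tgt_ne : Yd.Nonempty
  suf : ∀ u e n, e ∈ Yd → Pth G (F ∪ D) u e n → ∃ y ∈ Y, Pth G E u y (n + c)
  deg : ∀ v ∈ D, nb G E v + ind (v ∈ Y) ≤ nb G D v + nb G F v + ind (v ∈ Yd)
  cmp : ∀ D' ⊆ D, (bd G E D' \ F).card + ind (∃ v ∈ D', v ∈ Y) ≤
    (bd G D D').card + ind (∃ v ∈ D', v ∈ Yd)

theorem Pocket.disj {E Y F D Yd : Finset V} {c : ℕ} (h : Pocket G E Y F D Yd c) : Disjoint F D :=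
  Finset.disjoint_left.2 fun _ hx hx' => (Finset.mem_sdiff.1 (h.sub hx')).2 hx

theorem nb_le_add {A B C : Finset V} (v : V) (h : ∀ u ∈ A, G.Adj v u → u ∈ B ∨ u ∈ C) :
    nb G A v ≤ nb G B v + nb G C v :=
  le_trans (Finset.card_le_card fun x hx => by
    simp at hx ⊢; have := h x hx.1 hx.2; tauto) (Finset.card_union_le _ _)

theorem exists_pocket {E Y F D : Finset V} (hF : F ⊆ E) (hD : D ⊆ E \ F)
    (hne : D.Nonempty) (hout : (bd G E D \ F).card + ind (∃ v ∈ D, v ∈ Y) ≤ 1)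
    (hlive : ∃ d ∈ D, ∃ y ∈ Y, ∃ n, Pth G (E \ F) d y n) : ∃ Yd c, Pocket G E Y F D Yd c := by
  have hDE : D ⊆ E := fun x hx => (Finset.mem_sdiff.1 (hD hx)).1
  have hbd : ∀ D' ⊆ D, ∀ x ∈ bd G E D', x ∈ bd G D D' ∨ x ∈ F ∨ x ∈ bd G E D \ F := by
    intro D' hD' x hx
    simp only [mem_bd, Finset.mem_sdiff] at hx ⊢
    obtain ⟨⟨h1, h2⟩, d, hd, hdx⟩ := hx
    by_cases hxD : x ∈ D
    · exact .inl ⟨⟨hxD, h2⟩, d, hd, hdx⟩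
    by_cases hxF : x ∈ F
    · exact .inr (.inl hxF)
    · exact .inr (.inr ⟨⟨⟨h1, hxD⟩, d, hD' hd, hdx⟩, hxF⟩)
  have hnb : ∀ v ∈ D, ∀ u ∈ E, G.Adj v u → u ∈ D ∨ u ∈ F ∨ u ∈ bd G E D \ F := by
    intro v hv u hu huv
    simp only [mem_bd, Finset.mem_sdiff]
    by_cases h1 : u ∈ D
    · exact .inl h1
    by_cases h2 : u ∈ F
    · exact .inr (.inl h2)
    · exact .inr (.inr ⟨⟨⟨hu, h1⟩, v, hv, huv⟩, h2⟩)
  by_cases hY : ∃ v ∈ D, v ∈ Y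
  · rw [ind_pos hY] at hout
    have h0 : bd G E D \ F = ∅ := Finset.card_eq_zero.1 (by omega)
    refine ⟨D ∩ Y, 0, hD, hne, Finset.inter_subset_left, ?_, ?_, ?_, ?_⟩
    · obtain ⟨v, h1, h2⟩ := hY
      exact ⟨v, Finset.mem_inter.2 ⟨h1, h2⟩⟩
    · intro u e n he hp
      exact ⟨e, (Finset.mem_inter.1 he).2, hp.mono (Finset.union_subset hF hDE)⟩
    · intro v hv
      have := nb_le_add v (A := E) (B := D) (C := F) fun u hu huv => by
        have := hnb v hv u hu huv
        rw [h0] at this; simpa using this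
      have h2 := ind_mono (p := v ∈ Y) (q := v ∈ D ∩ Y) fun h => Finset.mem_inter.2 ⟨hv, h⟩
      omega
    · intro D' hD'
      refine Nat.add_le_add (Finset.card_le_card fun x hx => ?_) (ind_mono ?_)
      · have := hbd D' hD' x (Finset.mem_sdiff.1 hx).1
        rw [h0] at this
        have := (Finset.mem_sdiff.1 hx).2
        simp_all
      · rintro ⟨v, h1, h2⟩
        exact ⟨v, h1, Finset.mem_inter.2 ⟨hD' h1, h2⟩⟩
  · obtain ⟨d, hd, y, hy, n, hn⟩ := hlive
    have hyD : y ∉ D := fun h => hY ⟨y, h, hy⟩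
    obtain ⟨e, he, p, hep, m, hm⟩ : ∃ e ∈ D, ∃ p, G.Adj e p ∧ ∃ m, Pth G ((E \ F) \ D) p y m := by
      rcases hn.last_exit hyD with h | h
      · exact absurd h.start_mem (by simp [hd])
      · exact h
    have hp := hm.start_mem
    simp only [Finset.mem_sdiff] at hp
    have hpb : p ∈ bd G E D \ F := by
      simp only [mem_bd, Finset.mem_sdiff]; exact ⟨⟨⟨hp.1.1, hp.2⟩, e, he, hep⟩, hp.1.2⟩
    have h1 : bd G E D \ F = {p} := by
      symm
      apply Finset.eq_of_subset_of_card_le (by simpa using hpb)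
      simp; omega
    refine ⟨nbS G D {p}, m + 1, hD, hne, nbS_subset _ _ _, ?_, ?_, ?_, ?_⟩
    · exact ⟨e, by simp [he, hep.symm]⟩
    · intro u e n he hpth
      refine ⟨y, hy, ?_⟩
      have := hpth.concat hm ?_ ?_
      · refine (this.mono ?_)
        intro x; simp only [Finset.mem_union, Finset.mem_sdiff]
        rintro ((h | h) | h)
        exacts [hF h, hDE h, h.1.1]
      · rw [Finset.disjoint_left]; intro x; simp only [Finset.mem_union, Finset.mem_sdiff]; tauto
      · simp at he; exact he.2.symm
    · intro v hv
      rw [ind_neg (fun h => hY ⟨v, hv, h⟩)]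
      have h3 := nb_le_add v (A := E) (B := D) (C := F ∪ {p}) fun u hu huv => by
        have := hnb v hv u hu huv
        rw [h1, Finset.mem_singleton] at this; simp; tauto
      have h4 := nb_union_le (G := G) F {p} v
      have h5 : nb G {p} v ≤ ind (v ∈ nbS G D {p}) := by
        refine (nb_le_ind ((nb_le_card _ _).trans (by simp))).trans (ind_mono ?_)
        intro h; simpa [hv] using h
      omega
    · intro D' hD'
      rw [ind_neg (fun h => hY (by obtain ⟨v, h1, h2⟩ := h; exact ⟨v, hD' h1, h2⟩))]
      by_cases hpD : p ∈ bd G E D'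
      · rw [ind_pos]
        · refine le_trans (Finset.card_le_card (t := insert p (bd G D D')) fun x hx => ?_)
            (Finset.card_insert_le _ _)
          have h3 := hbd D' hD' x (Finset.mem_sdiff.1 hx).1
          rw [h1] at h3
          have := (Finset.mem_sdiff.1 hx).2
          rw [Finset.mem_insert]
          rcases h3 with h3 | h3 | h3
          · exact .inr h3
          · exact absurd h3 this
          · exact .inl (by simpa using h3)
        · simp only [mem_bd] at hpD
          obtain ⟨-, d, hd, hdp⟩ := hpD
          exact ⟨d, hd, by simp [hD' hd, hdp.symm]⟩
      · refine le_trans (Finset.card_le_card fun x hx => ?_) (Nat.le_add_right _ _)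
        have h3 := hbd D' hD' x (Finset.mem_sdiff.1 hx).1
        rw [h1] at h3
        have h4 := Finset.mem_sdiff.1 hx
        rcases h3 with h3 | h3 | h3
        · exact h3
        · exact absurd h3 h4.2
        · rw [Finset.mem_singleton] at h3
          exact absurd (h3 ▸ h4.1) hpD

/-- Restriction to a set with at most one exit. -/
theorem Conn.restrict {E X Y D : Finset V} (h : Conn G E X Y) (hD : D ⊆ E)
    (hne : D.Nonempty) (hout : (bd G E D).card + ind (∃ v ∈ D, v ∈ Y) ≤ 1) :
    ∃ Yd ⊆ D, ∃ c, Conn G D (X ∩ D) Yd ∧ (∀ n, HasLen G D (X ∩ D) Yd n → HasLen G E X Y (n + c)) ∧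
      ∀ v ∈ D, nb G E v + ind (v ∈ X) + ind (v ∈ Y) ≤
        nb G D v + ind (v ∈ X ∩ D) + ind (v ∈ Yd) := by
  obtain ⟨d, hd⟩ := hne
  obtain ⟨y, hy, n, hn⟩ := h.exists_pth (hD hd)
  obtain ⟨Yd, c, P⟩ := exists_pocket (G := G) (E := E) (Y := Y) (F := ∅) (D := D) (by simp)
    (by simpa using hD) ⟨d, hd⟩ (by simpa using hout) ⟨d, hd, y, hy, n, by simpa using hn⟩
  refine ⟨Yd, P.tgt, c, ?_, ?_, ?_⟩
  · intro D' hD' hne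
    have h1 := P.cmp D' hD'
    have h2 := h D' (hD'.trans hD) hne
    have h3 := ind_mono (p := ∃ v ∈ D', v ∈ X) (q := ∃ v ∈ D', v ∈ X ∩ D) (by
      rintro ⟨v, h1, h2⟩; exact ⟨v, h1, Finset.mem_inter.2 ⟨h2, hD' h1⟩⟩)
    simp at h1; omega
  · rintro n ⟨u, hu, e, he, hp⟩
    obtain ⟨y, hy, hp⟩ := P.suf u e n he (by simpa using hp)
    exact ⟨u, (Finset.mem_inter.1 hu).1, y, hy, hp⟩
  · intro v hv
    have h1 := P.deg v hv
    have h3 := ind_mono (p := v ∈ X) (q := v ∈ X ∩ D) fun h => Finset.mem_inter.2 ⟨h, hv⟩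
    have : nb G ∅ v = 0 := by simp [nb_eq_zero]
    omega

/-- The degree condition: every vertex of `E` other than `z` has degree at least `k`, counting
the roots attached to `X` and `Y`. -/
def DegGe (G : SimpleGraph V) (E X Y : Finset V) (z : V) (k : ℕ) : Prop :=
  ∀ v ∈ E, v ≠ z → k ≤ nb G E v + ind (v ∈ X) + ind (v ∈ Y)

theorem card_lt_of_ssubset {D E : Finset V} (h : D ⊆ E) {x : V} (hx : x ∈ E) (hxD : x ∉ D) :
    D.card < E.card :=
  Finset.card_lt_card ⟨h, fun h' => hxD (h' hx)⟩

theorem Conn.singleton {E X Y : Finset V} (h : Conn G E X Y) {v : V} (hv : v ∈ E) :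
    2 ≤ nb G E v + ind (v ∈ X) + ind (v ∈ Y) := by
  have := h {v} (by simpa using hv) ⟨v, by simp⟩
  simp only [Finset.mem_singleton, exists_eq_left] at this
  have h2 : (bd G E {v}).card ≤ nb G E v := Finset.card_le_card fun x hx => by
    simp at hx ⊢; exact ⟨hx.1.1, hx.2⟩
  omega

section two

variable {E X Y : Finset V} {z : V}

theorem two_of_restrict (hC : Conn G E X Y) (hdeg : DegGe G E X Y z 3)
    (IH : ∀ E' X' Y', E'.card < E.card → X' ⊆ E' → Y' ⊆ E' → Conn G E' X' Y' →
      DegGe G E' X' Y' z 3 → (∃ v ∈ E', v ≠ z) → AP (HasLen G E' X' Y') 2)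
    {D : Finset V} (hD : D ⊆ E) (hlt : D.card < E.card)
    (hne : ∃ v ∈ D, v ≠ z) (hout : (bd G E D).card + ind (∃ v ∈ D, v ∈ Y) ≤ 1) :
    AP (HasLen G E X Y) 2 := by
  obtain ⟨d, hd, hdz⟩ := hne
  obtain ⟨Yd, hYd, c, hC', hL, hdg⟩ := hC.restrict hD ⟨d, hd⟩ hout
  refine (IH D (X ∩ D) Yd hlt Finset.inter_subset_right hYd hC' ?_ ⟨d, hd, hdz⟩).shift c hL
  intro v hv hvz
  exact (hdeg v (hD hv) hvz).trans (hdg v hv)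

theorem card_bd_split {E D' D X : Finset V}
    (h : ∀ d ∈ D', ∀ c ∈ E, G.Adj d c → c ∈ D ∨ c ∈ X) :
    (bd G E D').card ≤ (bd G D D').card + (bd G E D' ∩ X).card := by
  refine le_trans (Finset.card_le_card fun x hx => ?_) (Finset.card_union_le _ _)
  simp only [mem_bd, Finset.mem_union, Finset.mem_inter] at hx ⊢
  obtain ⟨⟨h1, h2⟩, d, hd, hdx⟩ := hx
  rcases h d hd x h1 hdx with h3 | h3
  · exact .inl ⟨⟨h3, h2⟩, d, hd, hdx⟩
  · exact .inr ⟨⟨⟨h1, h2⟩, d, hd, hdx⟩, h3⟩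

theorem two_side (hX : X ⊆ E) (hC : Conn G E X Y) (hdeg : DegGe G E X Y z 3)
    (IH : ∀ E' X' Y', E'.card < E.card → X' ⊆ E' → Y' ⊆ E' → Conn G E' X' Y' →
      DegGe G E' X' Y' z 3 → (∃ v ∈ E', v ≠ z) → AP (HasLen G E' X' Y') 2) :
    AP (HasLen G E X Y) 2 ∨ ((∀ a ∈ X, ∀ b ∈ X, ¬G.Adj a b) ∧
      (∀ u ∈ E, u ∉ X → nb G X u ≤ 1) ∧ ∀ v, (∃ y ∈ Y, ∃ n, Pth G (E \ X) v y n) → v = z) := by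
  by_contra hcon
  push Not at hcon
  obtain ⟨hAP, hcon⟩ := hcon
  have X2 : ∀ D ⊆ E, D.card < E.card → (∃ v ∈ D, v ≠ z) →
      2 ≤ (bd G E D).card + ind (∃ v ∈ D, v ∈ Y) := by
    intro D hD hlt hne
    by_contra h
    exact hAP (two_of_restrict hC hdeg IH hD hlt hne (by omega))
  have tri : ∀ a ∈ X, ∀ b ∈ X, ¬G.Adj a b := by
    have aux : ∀ a ∈ X, ∀ b ∈ X, G.Adj a b → ∀ y ∈ Y, ∀ n, ¬Pth G (E.erase b) a y n := by
      intro a ha b hb hab y hy n hp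
      exact hAP (AP.two (n := n) (m := n + 1) ⟨a, ha, y, hy, hp.mono (Finset.erase_subset _ _)⟩
        ⟨b, hb, y, hy, .cons (hX hb) hab.symm hp⟩ (.inl rfl))
    intro a ha b hb hab
    rcases two_start (G := G) (Y := Y) (hX ha) (hX hb) hab.ne with h | h | h
    · obtain ⟨y, hy, n, hn⟩ := h
      exact aux a ha b hb hab y hy n hn
    · obtain ⟨y, hy, n, hn⟩ := h
      exact aux b hb a ha hab.symm y hy n hn
    · obtain ⟨D, hD, haD, -, hDY, hcl⟩ := h
      exact hDY (hC.not_closed hD ⟨a, haD⟩ hcl).2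
  have cyc : ∀ u ∈ E, u ∉ X → nb G X u ≤ 1 := by
    intro u hu huX
    by_contra hlt
    rw [nb, not_le, Finset.one_lt_card] at hlt
    obtain ⟨b, hb, b', hb', hbb⟩ := hlt
    simp only [mem_nbs] at hb hb'
    have hbu : b ≠ u := fun h => huX (h ▸ hb.1)
    have hbu' : b' ≠ u := fun h => huX (h ▸ hb'.1)
    have aux : ∀ b b', b ∈ X → b' ∈ X → G.Adj u b → G.Adj u b' → b ≠ b' →
        ∀ y ∈ Y, ∀ n, ¬Pth G ((E.erase u).erase b') b y n := by
      intro b b' hb hb' hub hub' hbb y hy n hp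
      refine hAP (AP.two (n := n) (m := n + 1 + 1) ⟨b, hb, y, hy, hp.mono
        ((Finset.erase_subset _ _).trans (Finset.erase_subset _ _))⟩
        ⟨b', hb', y, hy, .cons (hX hb') hub'.symm (.cons ?_ hub ?_)⟩ (.inr rfl))
      · simp only [Finset.mem_erase]; exact ⟨hub'.ne, hu⟩
      · rwa [Finset.erase_right_comm]
    rcases two_start (G := G) (Y := Y) (A := E.erase u) (Finset.mem_erase.2 ⟨hbu, hX hb.1⟩)
      (Finset.mem_erase.2 ⟨hbu', hX hb'.1⟩) hbb with h | h | h
    · obtain ⟨y, hy, n, hn⟩ := h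
      exact aux b b' hb.1 hb'.1 hb.2 hb'.2 hbb y hy n hn
    · obtain ⟨y, hy, n, hn⟩ := h
      exact aux b' b hb'.1 hb.1 hb'.2 hb.2 hbb.symm y hy n hn
    · obtain ⟨D, hD, hbD, hbD', hDY, hcl⟩ := h
      have hDE : D ⊆ E := hD.trans (Finset.erase_subset _ _)
      have huD : u ∉ D := fun h => by simpa using hD h
      have := X2 D hDE (card_lt_of_ssubset hDE hu huD) (by
        by_cases hbz : b = z
        · exact ⟨b', hbD', fun h => hbb (hbz.trans h.symm)⟩
        · exact ⟨b, hbD, hbz⟩)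
      rw [ind_neg hDY] at this
      have h2 : bd G E D ⊆ {u} := by
        intro x hx
        simp only [mem_bd] at hx
        obtain ⟨⟨h1, h2⟩, d, hd, hdx⟩ := hx
        by_contra hxu
        exact h2 (hcl d hd x (Finset.mem_erase.2 ⟨by simpa using hxu, h1⟩) hdx)
      have := Finset.card_le_card h2
      simp at this; omega
  obtain ⟨v, ⟨y, hy, n, hp⟩, hvz⟩ := hcon tri cyc
  classical
  set D := (E \ X).filter fun v => ∃ y ∈ Y, ∃ n, Pth G (E \ X) v y n with hDdef
  have hmem : ∀ {u}, u ∈ D ↔ ∃ y ∈ Y, ∃ n, Pth G (E \ X) u y n := fun {u} => by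
    simp only [hDdef, Finset.mem_filter, and_iff_right_iff_imp]
    rintro ⟨y, hy, n, hn⟩; exact hn.start_mem
  have hDX : D ⊆ E \ X := Finset.filter_subset _ _
  have hDE : D ⊆ E := hDX.trans Finset.sdiff_subset
  have hcl : Closed G (E \ X) D := by
    intro d hd c hc hdc
    obtain ⟨y, hy, n, hn⟩ := hmem.1 hd
    obtain ⟨m, hm⟩ := hn.symm.exists_extend hdc hc
    exact hmem.2 ⟨y, hy, m, hm.symm⟩
  have hsplit : ∀ d ∈ D, ∀ c ∈ E, G.Adj d c → c ∈ D ∨ c ∈ X := by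
    intro d hd c hc hdc
    by_cases hcX : c ∈ X
    · exact .inr hcX
    · exact .inl (hcl d hd c (Finset.mem_sdiff.2 ⟨hc, hcX⟩) hdc)
  have hvD : v ∈ D := hmem.2 ⟨y, hy, n, hp⟩
  obtain ⟨⟨x, hx, hxX⟩, -⟩ := hC.not_closed subset_rfl ⟨v, hDE hvD⟩ (fun _ _ c hc _ => hc)
  have hxD : x ∉ D := fun h => (Finset.mem_sdiff.1 (hDX h)).2 hxX
  refine hAP ((IH D (nbS G D X) (Y ∩ D) (card_lt_of_ssubset hDE hx hxD) (nbS_subset _ _ _)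
    Finset.inter_subset_right ?_ ?_ ⟨v, hvD, hvz⟩).shift 1 ?_)
  · intro D' hD' hne'
    have hDE' := hD'.trans hDE
    have hDX' : ¬∃ v ∈ D', v ∈ X := by
      rintro ⟨v, h1, h2⟩; exact (Finset.mem_sdiff.1 (hDX (hD' h1))).2 h2
    have h1 : 2 ≤ (bd G E D').card + ind (∃ v ∈ D', v ∈ Y) := by
      by_cases hz : ∃ v ∈ D', v ≠ z
      · exact X2 D' hDE' (card_lt_of_ssubset hDE' hx fun h => hxD (hD' h)) hz
      · have := hC D' hDE' hne'
        rwa [ind_neg hDX'] at this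
    have h2 := card_bd_split (G := G) (D' := D') fun d hd => hsplit d (hD' hd)
    have h3 : ind (∃ v ∈ D', v ∈ Y) ≤ ind (∃ v ∈ D', v ∈ Y ∩ D) := ind_mono (by
      rintro ⟨v, h1, h2⟩; exact ⟨v, h1, Finset.mem_inter.2 ⟨h2, hD' h1⟩⟩)
    have h5 : 1 ≤ (bd G D D').card + ind (∃ v ∈ D', v ∈ Y) := by
      by_contra hlt
      have hb : (bd G D D').card = 0 := by omega
      have hi : ind (∃ v ∈ D', v ∈ Y) = 0 := by omega
      have hb := closed_iff_bd.2 (Finset.card_eq_zero.1 hb)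
      obtain ⟨d, hd⟩ := hne'
      obtain ⟨y, hy, n, hn⟩ := hmem.1 (hD' hd)
      have hb' : Closed G (E \ X) D' := fun d hd c hc hdc =>
        hb d hd c (hcl d (hD' hd) c hc hdc) hdc
      rw [ind_pos ⟨y, hb'.mem_of_pth hn hd, hy⟩] at hi
      omega
    by_cases hq : (bd G E D' ∩ X).Nonempty
    · rw [ind_pos (p := ∃ v ∈ D', v ∈ nbS G D X)]
      · omega
      · obtain ⟨q, hq⟩ := hq
        simp only [Finset.mem_inter, mem_bd] at hq
        obtain ⟨⟨-, d, hd, hdq⟩, hqX⟩ := hq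
        exact ⟨d, hd, by simp only [mem_nbS]; exact ⟨hD' hd, q, hqX, hdq.symm⟩⟩
    · rw [Finset.not_nonempty_iff_eq_empty.1 hq] at h2
      simp at h2; omega
  · intro u hu huz
    have h1 := hdeg u (hDE hu) huz
    have huX := (Finset.mem_sdiff.1 (hDX hu)).2
    rw [ind_neg huX] at h1
    have h2 := nb_le_add u (B := D) (C := X) fun c hc huc => hsplit u hu c hc huc
    have h3 := nb_le_ind (cyc u (hDE hu) huX)
    have h4 := ind_mono (p := ∃ w ∈ X, G.Adj w u) (q := u ∈ nbS G D X) fun h => by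
      simp only [mem_nbS]; exact ⟨hu, h⟩
    have h5 := ind_mono (p := u ∈ Y) (q := u ∈ Y ∩ D) fun h => Finset.mem_inter.2 ⟨h, hu⟩
    omega
  · rintro n ⟨u, hu, y, hy, hp⟩
    simp only [mem_nbS] at hu
    obtain ⟨huD, w, hw, hwu⟩ := hu
    refine ⟨w, hw, y, (Finset.mem_inter.1 hy).1, .cons (hX hw) hwu (hp.mono fun a ha => ?_)⟩
    exact Finset.mem_erase.2 ⟨fun h => (Finset.mem_sdiff.1 (hDX ha)).2 (h ▸ hw), hDE ha⟩

end two

/-- Two admissible paths between two roots, when all vertices but one have degree at least 3. -/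
theorem two_paths (E X Y : Finset V) (z : V) (hX : X ⊆ E) (hY : Y ⊆ E) (hC : Conn G E X Y)
    (hdeg : DegGe G E X Y z 3) (hne : ∃ v ∈ E, v ≠ z) : AP (HasLen G E X Y) 2 := by
  induction hN : E.card using Nat.strong_induction_on generalizing E X Y with
  | _ N IH =>
  subst hN
  have IH' : ∀ E' X' Y', E'.card < E.card → X' ⊆ E' → Y' ⊆ E' → Conn G E' X' Y' →
      DegGe G E' X' Y' z 3 → (∃ v ∈ E', v ≠ z) → AP (HasLen G E' X' Y') 2 :=
    fun E' X' Y' h1 h2 h3 h4 h5 h6 => IH E'.card h1 E' X' Y' h2 h3 h4 h5 h6 rfl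
  by_contra hAP
  rcases two_side hX hC hdeg IH' with h | ⟨hind, hnb, hD0⟩
  · exact hAP h
  have hdeg' : DegGe G E Y X z 3 := fun v hv hvz => by have := hdeg v hv hvz; omega
  rcases two_side hY hC.symm hdeg' IH' with h | ⟨hind', hnb', hD0'⟩
  · exact hAP (h.mono fun n hn => hn.symm)
  have key : ∀ X Y : Finset V, X ⊆ E → Y ⊆ E → Conn G E X Y →
      (∀ v, (∃ y ∈ Y, ∃ n, Pth G (E \ X) v y n) → v = z) → (∀ v ∈ X, v ∈ Y ∨ v = z) →
      ¬AP (HasLen G E X Y) 2 → Y ⊆ X := by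
    intro X Y hX hY hC hD hXY hAP y hy
    by_contra hyX
    have hyE : y ∈ E \ X := Finset.mem_sdiff.2 ⟨hY hy, hyX⟩
    obtain rfl := hD y ⟨y, hy, 0, .nil hyE⟩
    have h1 := hC.singleton (hY hy)
    rw [ind_neg hyX] at h1
    have h2 := ind_le_one (y ∈ Y)
    obtain ⟨b, hbE, hyb⟩ := nb_pos.1 (show 0 < nb G E y by omega)
    have hbX : b ∈ X := by
      by_contra hbX
      exact hyb.ne' (hD b ⟨y, hy, 1, .adj hyb.symm (Finset.mem_sdiff.2 ⟨hbE, hbX⟩) hyE⟩)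
    have hbY : b ∈ Y := (hXY b hbX).resolve_right hyb.ne'
    exact hAP (AP.two (n := 0) (m := 1) ⟨b, hbX, b, hbY, .nil hbE⟩
      ⟨b, hbX, y, hy, .adj hyb.symm hbE (hY hy)⟩ (.inl rfl))
  have hYX : Y ⊆ X := key X Y hX hY hC hD0 (fun v hv => by
    by_cases hvY : v ∈ Y
    · exact .inl hvY
    · exact .inr (hD0' v ⟨v, hv, 0, .nil (Finset.mem_sdiff.2 ⟨hX hv, hvY⟩)⟩)) hAP
  have hXY : X ⊆ Y := key Y X hY hX hC.symm hD0' (fun v hv => .inl (hYX hv))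
    fun h => hAP (h.mono fun n hn => hn.symm)
  obtain rfl := hXY.antisymm hYX
  obtain ⟨v, hv, hvX, hvz⟩ : ∃ v ∈ E, v ∉ X ∧ v ≠ z := by
    by_contra hcon
    push Not at hcon
    obtain ⟨v, hv, hvz⟩ := hne
    have hvX : v ∈ X := by by_contra h; exact hvz (hcon v hv h)
    have h1 := hdeg v hv hvz
    rw [ind_pos hvX] at h1
    obtain ⟨u, hu, hvu⟩ := nb_pos.1 (show 0 < nb G E v by omega)
    have huX : u ∉ X := fun h => hind v hvX u h hvu
    obtain rfl := hcon u hu huX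
    have h2 := hC.singleton hu
    rw [ind_neg huX] at h2
    have h3 : nbs G E u ⊆ nbs G X u := by
      intro x hx
      simp at hx ⊢
      refine ⟨?_, hx.2⟩
      by_contra hxX
      exact hx.2.ne' (hcon x hx.1 hxX)
    have h4 := Finset.card_le_card h3
    have h5 := hnb u hu huX
    rw [nb] at h5 h2; omega
  set D := comp G (E \ X) v with hD
  have hDX : D ⊆ E \ X := comp_subset _ _ _
  have hDE : D ⊆ E := hDX.trans Finset.sdiff_subset
  have hvD : v ∈ D := self_mem_comp (Finset.mem_sdiff.2 ⟨hv, hvX⟩)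
  have hsplit : ∀ d ∈ D, ∀ c ∈ E, G.Adj d c → c ∈ D ∨ c ∈ X := by
    intro d hd c hc hdc
    by_cases hcX : c ∈ X
    · exact .inr hcX
    · exact .inl (comp_closed _ _ d hd c (Finset.mem_sdiff.2 ⟨hc, hcX⟩) hdc)
  have hDnX : ∀ v ∈ D, v ∉ X := fun v hv => (Finset.mem_sdiff.1 (hDX hv)).2
  have hbdD : ∀ D' ⊆ D, D'.Nonempty → 2 ≤ (bd G E D').card := by
    intro D' hD' hne
    have := hC D' (hD'.trans hDE) hne
    rwa [ind_neg (by rintro ⟨v, h1, h2⟩; exact hDnX v (hD' h1) h2)] at this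
  obtain ⟨b, hb⟩ : (bd G E D).Nonempty := Finset.card_pos.1 (by
    have := hbdD D subset_rfl ⟨v, hvD⟩; omega)
  simp only [mem_bd] at hb
  obtain ⟨⟨hbE, hbD⟩, d, hd, hdb⟩ := hb
  have hbX : b ∈ X := (hsplit d hd b hbE hdb).resolve_left hbD
  refine hAP ((IH' D (nbS G D {b}) (nbS G D (X.erase b)) (card_lt_of_ssubset hDE hbE hbD)
    (nbS_subset _ _ _) (nbS_subset _ _ _) ?_ ?_ ⟨v, hvD, hvz⟩).shift 2 ?_)
  · intro D' hD' hne'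
    have h1 := hbdD D' hD' hne'
    have h2 := card_bd_split (G := G) (D' := D') fun d hd => hsplit d (hD' hd)
    have h3 : (bd G E D' ∩ X.erase b).card + 1 ≥ (bd G E D' ∩ X).card := by
      have := Finset.card_erase_add_one (s := bd G E D' ∩ X) (a := b)
      by_cases hbm : b ∈ bd G E D' ∩ X
      · rw [← this hbm, Finset.inter_erase]
      · rw [Finset.inter_erase, Finset.erase_eq_of_notMem hbm]; omega
    have h4 : ∀ q ∈ bd G E D', ∀ Z : Finset V, q ∈ Z → ∃ v ∈ D', v ∈ nbS G D Z := by
      intro q hq Z hqZ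
      simp only [mem_bd] at hq
      obtain ⟨-, d, hd, hdq⟩ := hq
      exact ⟨d, hd, by simp only [mem_nbS]; exact ⟨hD' hd, q, hqZ, hdq.symm⟩⟩
    have h6 : 1 ≤ (bd G D D').card + ind (∃ v ∈ D', v ∈ nbS G D {b}) := by
      by_cases h0 : bd G D D' = ∅
      · have := comp_connected hD' hne' (closed_iff_bd.2 h0)
        rw [ind_pos]
        · omega
        · exact ⟨d, this ▸ hd, by simp [hd, hdb.symm]⟩
      · have := Finset.card_pos.2 (Finset.nonempty_iff_ne_empty.2 h0); omega
    by_cases hq : (bd G E D' ∩ X.erase b).Nonempty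
    · obtain ⟨q, hq⟩ := hq
      rw [Finset.mem_inter] at hq
      rw [ind_pos (h4 q hq.1 _ hq.2)]; omega
    · have hq0 := Finset.not_nonempty_iff_eq_empty.1 hq
      rw [hq0] at h3
      by_cases hbm : b ∈ bd G E D'
      · rw [ind_pos (h4 b hbm {b} (by simp))]
        simp at h3; omega
      · have : bd G E D' ∩ X = ∅ := by
          rw [← Finset.not_nonempty_iff_eq_empty]
          rintro ⟨q, hq⟩
          rw [Finset.mem_inter] at hq
          have : q ∈ bd G E D' ∩ X.erase b :=
            Finset.mem_inter.2 ⟨hq.1, Finset.mem_erase.2 ⟨fun h => hbm (h ▸ hq.1), hq.2⟩⟩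
          simp [hq0] at this
        rw [this] at h2; simp at h2; omega
  · intro u hu huz
    have h1 := hdeg u (hDE hu) huz
    rw [ind_neg (hDnX u hu)] at h1
    have h2 := nb_le_add u (B := D) (C := X) fun c hc huc => hsplit u hu c hc huc
    have h3 := nb_le_ind (hnb u (hDE hu) (hDnX u hu))
    have h4 : ind (∃ w ∈ X, G.Adj w u) ≤ ind (u ∈ nbS G D {b}) + ind (u ∈ nbS G D (X.erase b)) := by
      by_cases h : ∃ w ∈ X, G.Adj w u
      · obtain ⟨w, hw, hwu⟩ := h
        have := ind_le_one (∃ w ∈ X, G.Adj w u)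
        by_cases hwb : w = b
        · rw [ind_pos (p := u ∈ nbS G D {b})]
          · omega
          · simp only [mem_nbS]; exact ⟨hu, w, by simp [hwb], hwu⟩
        · rw [ind_pos (p := u ∈ nbS G D (X.erase b))]
          · omega
          · simp only [mem_nbS]; exact ⟨hu, w, Finset.mem_erase.2 ⟨hwb, hw⟩, hwu⟩
      · rw [ind_neg h]; omega
    omega
  · rintro n ⟨u, hu, y, hy, hp⟩
    simp only [mem_nbS] at hu hy
    obtain ⟨huD, w, hw, hwu⟩ := hu
    obtain ⟨hyD, w', hw', hwy⟩ := hy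
    obtain rfl := Finset.mem_singleton.1 hw
    rw [Finset.mem_erase] at hw'
    have h1 := hp.snoc (fun h => hDnX _ h hw'.2) hwy.symm
    refine ⟨w, hbX, w', hw'.2, .cons hbE hwu (h1.mono fun a ha => ?_)⟩
    rw [Finset.mem_insert] at ha
    rw [Finset.mem_erase]
    rcases ha with rfl | ha
    · exact ⟨hw'.1, hX hw'.2⟩
    · exact ⟨fun h => hDnX a ha (h ▸ hbX), hDE ha⟩

/-- All vertices of `T` are adjacent to all vertices of `W`. -/
def Cmpl (G : SimpleGraph V) (T W : Finset V) : Prop := ∀ a ∈ T, ∀ b ∈ W, G.Adj a b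

theorem Cmpl.symm {T W : Finset V} (h : Cmpl G T W) : Cmpl G W T := fun a ha b hb => (h b hb a ha).symm

theorem Cmpl.mono {T W T' W' : Finset V} (h : Cmpl G T W) (hT : T' ⊆ T) (hW : W' ⊆ W) :
    Cmpl G T' W' := fun a ha b hb => h a (hT ha) b (hW hb)

theorem Cmpl.disj {T W : Finset V} (h : Cmpl G T W) : Disjoint T W :=
  Finset.disjoint_left.2 fun _ hx hx' => G.irrefl (h _ hx _ hx')

/-- `C` is a clique. -/
def Clq (G : SimpleGraph V) (C : Finset V) : Prop := ∀ a ∈ C, ∀ b ∈ C, a ≠ b → G.Adj a b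

/-- `C` is independent. -/
def Ind (G : SimpleGraph V) (C : Finset V) : Prop := ∀ a ∈ C, ∀ b ∈ C, ¬G.Adj a b

/-- `C` spans an edge. -/
def HasEdge (G : SimpleGraph V) (C : Finset V) : Prop := ∃ a ∈ C, ∃ b ∈ C, G.Adj a b

/-- Odd paths in complete bipartite graphs. -/
theorem pth_odd {T W : Finset V} (h : Cmpl G T W) {u w : V} (hu : u ∈ T) (hw : w ∈ W) {i : ℕ}
    (hi : i < T.card) (hi' : i < W.card) : Pth G (T ∪ W) u w (2 * i + 1) := by
  induction i generalizing T W u with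
  | zero => exact .adj (h u hu w hw) (by simp [hu]) (by simp [hw])
  | succ i ih =>
    obtain ⟨u2, hu2, hne⟩ := Finset.exists_mem_ne (show 1 < T.card by omega) u
    obtain ⟨w2, hw2, hne2⟩ := Finset.exists_mem_ne (show 1 < W.card by omega) w
    have hd := h.disj
    have huW : u ∉ W := Finset.disjoint_left.1 hd hu
    have hwT : w2 ∉ T := Finset.disjoint_right.1 hd hw2
    have := ih (T := T.erase u) (W := W.erase w2) (u := u2)
      (h.mono (Finset.erase_subset _ _) (Finset.erase_subset _ _))
      (Finset.mem_erase.2 ⟨hne, hu2⟩) (Finset.mem_erase.2 ⟨hne2.symm, hw⟩)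
      (by rw [Finset.card_erase_of_mem hu]; omega) (by rw [Finset.card_erase_of_mem hw2]; omega)
    have h2 := this.cons' (w := w2) (by simp [hwT]) (h u2 hu2 w2 hw2).symm
    have h3 := h2.cons' (w := u) (by
      simp only [Finset.mem_insert, Finset.mem_union, Finset.mem_erase, not_or]
      exact ⟨(h u hu w2 hw2).ne, by simp, fun h => huW h.2⟩) (h u hu w2 hw2)
    refine h3.mono fun x hx => ?_
    simp only [Finset.mem_insert, Finset.mem_union, Finset.mem_erase] at hx ⊢
    rcases hx with rfl | rfl | hx | hx
    exacts [.inl hu, .inr hw2, .inl hx.2, .inr hx.2]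

/-- Even paths in complete bipartite graphs. -/
theorem pth_even {T W : Finset V} (h : Cmpl G T W) {u v : V} (hu : u ∈ T) (hv : v ∈ T)
    (huv : u ≠ v) {i : ℕ} (hi1 : 1 ≤ i) (hi : i < T.card) (hi' : i ≤ W.card) :
    Pth G (T ∪ W) u v (2 * i) := by
  obtain ⟨w, hw⟩ := Finset.card_pos.1 (show 0 < W.card by omega)
  have huW : u ∉ W := Finset.disjoint_left.1 h.disj hu
  have := (pth_odd (h.mono (Finset.erase_subset u T) subset_rfl) (i := i - 1) (u := v) (w := w)
    (Finset.mem_erase.2 ⟨huv.symm, hv⟩) hw (by rw [Finset.card_erase_of_mem hu]; omega)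
    (by omega)).symm
  have h2 := this.cons' (w := u) (by simp [huW]) (h u hu w hw)
  rw [show 2 * i = 2 * (i - 1) + 1 + 1 by omega]
  refine h2.mono fun x hx => ?_
  simp only [Finset.mem_insert, Finset.mem_union, Finset.mem_erase] at hx ⊢
  rcases hx with rfl | hx | hx
  exacts [.inl hu, .inl hx.2, .inr hx]

theorem Pth.insert_second {A : Finset V} {a b u : V} {n : ℕ} (h : Pth G A a b (n + 1))
    (hu : u ∉ A) (hA : ∀ x ∈ A, G.Adj u x) : Pth G (insert u A) a b (n + 2) := by
  cases h with
  | @cons _ _ a' _ _ h1 h2 h3 =>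
    have h4 := h3.cons' (w := u) (fun h => hu (Finset.mem_of_mem_erase h))
      (hA _ (Finset.mem_of_mem_erase h3.start_mem))
    refine .cons (Finset.mem_insert_of_mem h1) (hA a h1).symm (h4.mono ?_)
    intro x hx
    simp only [Finset.mem_insert, Finset.mem_erase] at hx ⊢
    rcases hx with rfl | hx
    · exact ⟨fun h => hu (h ▸ h1), .inl rfl⟩
    · exact ⟨hx.1, .inr hx.2⟩

/-- Even paths ending in the larger side, using one edge inside that side. -/
theorem pth_via_edge {T W : Finset V} (h : Cmpl G T W) {u s w : V} (hu : u ∈ T) (hs : s ∈ W)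
    (hw : w ∈ W) (hsw : G.Adj s w) {i : ℕ} (hi : i < T.card) (hi' : i + 1 < W.card) :
    Pth G (T ∪ W) u w (2 * i + 2) := by
  have hwT : w ∉ T := Finset.disjoint_right.1 h.disj hw
  have := (pth_odd (h.mono subset_rfl (Finset.erase_subset w W)) (i := i) hu
    (Finset.mem_erase.2 ⟨hsw.ne, hs⟩) hi (by rw [Finset.card_erase_of_mem hw]; omega)).snoc
    (w := w) (by simp [hwT]) hsw
  refine this.mono fun x hx => ?_
  simp only [Finset.mem_insert, Finset.mem_union, Finset.mem_erase] at hx ⊢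
  rcases hx with rfl | hx | hx
  exacts [.inr hw, .inl hx, .inr hx.2]

/-- Path lengths in a complete bipartite graph augmented by a clique `C` complete to everything. -/
theorem pth_clique (n : ℕ) {T A C : Finset V} (hTA : Cmpl G T A) (hTC : Cmpl G T C)
    (hAC : Cmpl G A C) (hC : Clq G C) (hne : C.Nonempty) (hT : T.Nonempty)
    (hcond : A.card ≤ T.card ∨ (A.card ≤ T.card + 1 ∧ HasEdge G A))
    (hle : T.card ≤ A.card + C.card) {w : V} (hw : w ∈ A ∪ C) (hn : 1 ≤ n)
    (hn' : n + 1 ≤ A.card + C.card + T.card) : ∃ u ∈ T, Pth G (T ∪ (A ∪ C)) u w n := by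
  induction hN : C.card generalizing C w n with
  | zero => exact absurd (Finset.card_pos.2 hne) (by omega)
  | succ e ih =>
  have hTW : Cmpl G T (A ∪ C) := fun a ha b hb => by
    rcases Finset.mem_union.1 hb with hb | hb
    exacts [hTA a ha b hb, hTC a ha b hb]
  have hWcard : (A ∪ C).card = A.card + C.card := Finset.card_union_of_disjoint hAC.disj
  obtain ⟨b, hb⟩ := hT
  obtain ⟨u, hu⟩ := hne
  have hTpos : 0 < T.card := Finset.card_pos.2 ⟨b, hb⟩
  have huT : u ∉ T := Finset.disjoint_right.1 hTC.disj hu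
  have huA : u ∉ A := Finset.disjoint_right.1 hAC.disj hu
  -- short paths
  have hshort : n ≤ 2 * T.card → n + 1 ≤ 2 * (A ∪ C).card → ∃ u ∈ T, Pth G (T ∪ (A ∪ C)) u w n := by
    intro h1 h2
    rcases Nat.even_or_odd' n with ⟨i, rfl | rfl⟩
    · obtain ⟨s, hs, hsw⟩ : ∃ s ∈ A ∪ C, G.Adj s w := by
        rcases Finset.mem_union.1 hw with hwA | hwC
        · exact ⟨u, Finset.mem_union_right _ hu, (hAC w hwA u hu).symm⟩
        · obtain ⟨s, hs, hne⟩ := Finset.exists_mem_ne (show 1 < (A ∪ C).card by omega) w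
          refine ⟨s, hs, ?_⟩
          rcases Finset.mem_union.1 hs with hs | hs
          exacts [hAC s hs w hwC, hC s hs w hwC hne]
      have := pth_via_edge hTW hb hs hw hsw (i := i - 1) (by omega) (by omega)
      rw [show 2 * (i - 1) + 2 = 2 * i by omega] at this
      exact ⟨b, hb, this⟩
    · exact ⟨b, hb, pth_odd hTW hb hw (by omega) (by omega)⟩
  rw [hWcard] at hshort
  by_cases hTe : A.card + C.card ≤ T.card
  · exact hshort (by omega) (by omega)
  by_cases he : e = 0
  · subst he
    rw [Finset.card_eq_one] at hN
    obtain ⟨u', rfl⟩ := hN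
    obtain rfl := Finset.mem_singleton.1 hu
    rw [Finset.card_singleton] at *
    by_cases hn2 : n ≤ 2 * T.card
    · exact hshort hn2 (by omega)
    obtain ⟨hA1, s, hs, s', hs', hss⟩ := hcond.resolve_left (by omega)
    have hn : n = 2 * T.card - 2 + 1 + 1 + 1 := by omega
    have aux : ∀ s ∈ A, ∀ s' ∈ A, s ≠ s' →
        Pth G (T ∪ A.erase s') b s (2 * (T.card - 1) + 1) := by
      intro s hs s' hs' hss
      refine pth_odd (hTA.mono subset_rfl (Finset.erase_subset _ _)) hb
        (Finset.mem_erase.2 ⟨hss, hs⟩) (by omega) (by rw [Finset.card_erase_of_mem hs']; omega)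
    rcases Finset.mem_union.1 hw with hwA | hwC
    · obtain ⟨s, hs, hsne⟩ := Finset.exists_mem_ne (show 1 < A.card by omega) w
      have hwT : w ∉ T := Finset.disjoint_right.1 hTA.disj hwA
      have := ((aux s hs w hwA hsne).snoc (w := u) (by simp [huT, huA]) (hAC s hs u hu)).snoc
        (w := w) (by
          have : w ≠ u := fun h => huA (h ▸ hwA)
          simp [hwT, this]) (hAC w hwA u hu).symm
      rw [show 2 * (T.card - 1) + 1 + 1 + 1 = n by omega] at this
      refine ⟨b, hb, this.mono fun x hx => ?_⟩
      simp only [Finset.mem_insert, Finset.mem_union, Finset.mem_erase, Finset.mem_singleton] at hx ⊢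
      rcases hx with rfl | rfl | hx | hx
      · exact .inr (.inl hwA)
      · exact .inr (.inr rfl)
      · exact .inl hx
      · exact .inr (.inl hx.2)
    · obtain rfl := Finset.mem_singleton.1 hwC
      have hs'T : s' ∉ T := Finset.disjoint_right.1 hTA.disj hs'
      have := ((aux s hs s' hs' hss.ne).snoc (w := s') (by simp [hs'T]) hss).snoc
        (w := w) (by
          have : w ≠ s' := fun h => huA (h ▸ hs')
          simp [huT, huA, this]) (hAC s' hs' w hu)
      rw [show 2 * (T.card - 1) + 1 + 1 + 1 = n by omega] at this
      refine ⟨b, hb, this.mono fun x hx => ?_⟩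
      simp only [Finset.mem_insert, Finset.mem_union, Finset.mem_erase, Finset.mem_singleton] at hx ⊢
      rcases hx with rfl | rfl | hx | hx
      · exact .inr (.inr rfl)
      · exact .inr (.inl hs')
      · exact .inl hx
      · exact .inr (.inl hx.2)
  have hce : (C.erase u).card = e := by rw [Finset.card_erase_of_mem hu]; omega
  have hsub : C.erase u ⊆ C := Finset.erase_subset _ _
  have hne' : (C.erase u).Nonempty := Finset.card_pos.1 (by omega)
  have IH : ∀ m, ∀ w ∈ A ∪ C.erase u, 1 ≤ m → m + 1 ≤ A.card + e + T.card →
      ∃ v ∈ T, Pth G (T ∪ (A ∪ C.erase u)) v w m := by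
    intro m w hw h1 h2
    exact ih m (hTC.mono subset_rfl hsub) (hAC.mono subset_rfl hsub)
      (fun a ha b hb => hC a (hsub ha) b (hsub hb)) hne' (by omega) hw h1 (by omega) hce
  have huU : u ∉ T ∪ (A ∪ C.erase u) := by simp [huT, huA]
  have hadj : ∀ x ∈ T ∪ (A ∪ C.erase u), G.Adj u x := by
    intro x hx
    simp only [Finset.mem_union, Finset.mem_erase] at hx
    rcases hx with hx | hx | hx
    · exact (hTC x hx u hu).symm
    · exact (hAC x hx u hu).symm
    · exact hC u hu x hx.2 hx.1.symm
  have heq : insert u (T ∪ (A ∪ C.erase u)) = T ∪ (A ∪ C) := by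
    ext x; simp only [Finset.mem_insert, Finset.mem_union, Finset.mem_erase]
    by_cases hx : x = u
    · simp [hx, hu]
    · simp [hx]
  by_cases hwu : w = u
  · subst hwu
    by_cases hn1 : n = 1
    · subst hn1
      exact ⟨b, hb, .adj (hTC b hb w hu) (by simp [hb]) (by simp [hu])⟩
    obtain ⟨w', hw'⟩ := hne'
    have hw' : w' ∈ A ∪ C.erase w := Finset.mem_union_right _ hw'
    obtain ⟨v, hv, hp⟩ := IH (n - 1) w' hw' (by omega) (by omega)
    have := hp.snoc huU (hadj w' (Finset.mem_union_right _ hw')).symm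
    rw [heq, Nat.sub_add_cancel hn] at this
    exact ⟨v, hv, this⟩
  · have hw' : w ∈ A ∪ C.erase u := by
      simp only [Finset.mem_union, Finset.mem_erase] at hw ⊢; tauto
    by_cases hnN : n + 1 ≤ A.card + e + T.card
    · obtain ⟨v, hv, hp⟩ := IH n w hw' hn hnN
      refine ⟨v, hv, hp.mono ?_⟩
      rw [← heq]; exact Finset.subset_insert _ _
    · obtain ⟨v, hv, hp⟩ := IH (n - 1) w hw' (by omega) (by omega)
      rw [show n - 1 = n - 2 + 1 by omega] at hp
      have := hp.insert_second huU hadj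
      rw [heq, show n - 2 + 2 = n by omega] at this
      exact ⟨v, hv, this⟩

/-- Path lengths ending in the `T` side of a complete bipartite graph plus an edge in `S`. -/
theorem pth_edge_back {T S : Finset V} (h : Cmpl G T S) (hcard : S.card ≤ T.card)
    (hedge : HasEdge G S) {b : V} (hb : b ∈ T) {n : ℕ} (hn : 2 ≤ n) (hn' : n + 1 ≤ 2 * S.card) :
    ∃ u ∈ T, Pth G (T ∪ S) u b n := by
  obtain ⟨s, hs, s', hs', hss⟩ := hedge
  rcases Nat.even_or_odd' n with ⟨i, rfl | rfl⟩
  · obtain ⟨u, hu, hne⟩ := Finset.exists_mem_ne (show 1 < T.card by omega) b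
    exact ⟨u, hu, pth_even h hu hb hne (by omega) (by omega) (by omega)⟩
  · obtain ⟨u, hu, hne⟩ := Finset.exists_mem_ne (show 1 < T.card by omega) b
    have hsT : s ∉ T := Finset.disjoint_right.1 h.disj hs
    have hbS : b ∉ S := Finset.disjoint_left.1 h.disj hb
    have h1 := pth_odd (h.mono (Finset.erase_subset b T) (Finset.erase_subset s S)) (i := i - 1)
      (Finset.mem_erase.2 ⟨hne, hu⟩) (Finset.mem_erase.2 ⟨hss.ne', hs'⟩)
      (by rw [Finset.card_erase_of_mem hb]; omega) (by rw [Finset.card_erase_of_mem hs]; omega)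
    have h2 := (h1.snoc (w := s) (by simp [hsT]) hss.symm).snoc (w := b) (by
      have : b ≠ s := fun e => hbS (e ▸ hs)
      simp [hbS, this]) (h b hb s hs).symm
    rw [show 2 * (i - 1) + 1 + 1 + 1 = 2 * i + 1 by omega] at h2
    refine ⟨u, hu, h2.mono fun x hx => ?_⟩
    simp only [Finset.mem_insert, Finset.mem_union, Finset.mem_erase] at hx ⊢
    rcases hx with rfl | rfl | hx | hx
    exacts [.inl hb, .inr hs, .inl hx.2, .inr hx.2]

/-- Path lengths ending at any given vertex of a clique. -/
theorem pth_in_clique {F : Finset V} (hF : Clq G F) {w : V} (hw : w ∈ F) {n : ℕ}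
    (hn : n < F.card) : ∃ u ∈ F, Pth G F w u n := by
  induction n generalizing F w with
  | zero => exact ⟨w, hw, .nil hw⟩
  | succ n ih =>
    obtain ⟨w', hw', hne⟩ := Finset.exists_mem_ne (show 1 < F.card by omega) w
    obtain ⟨u, hu, hp⟩ := ih (F := F.erase w) (w := w')
      (fun a ha b hb => hF a (Finset.mem_of_mem_erase ha) b (Finset.mem_of_mem_erase hb))
      (Finset.mem_erase.2 ⟨hne, hw'⟩) (by rw [Finset.card_erase_of_mem hw]; omega)
    exact ⟨u, Finset.mem_of_mem_erase hu, .cons hw (hF w hw w' hw' hne.symm) hp⟩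

/-- The path theorem for vertex sets of size less than `N`. -/
def Hyp (G : SimpleGraph V) (N : ℕ) : Prop :=
  ∀ (k : ℕ) (E X Y : Finset V), E.card < N → X ⊆ E → Y ⊆ E → Conn G E X Y → E.Nonempty →
    (∀ v ∈ E, k + 1 ≤ nb G E v + ind (v ∈ X) + ind (v ∈ Y)) → AP (HasLen G E X Y) k

/-- An instance of the path problem whose hypotheses are only required outside the core `F`. -/
structure Inst (G : SimpleGraph V) (k : ℕ) (E X Y F : Finset V) : Prop where
  hF : F ⊆ E
  hX : X ⊆ E
  hY : Y ⊆ E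
  deg : ∀ v ∈ E, v ∉ F → k + 1 ≤ nb G E v + ind (v ∈ X) + ind (v ∈ Y)
  conn : ∀ D ⊆ E \ F, D.Nonempty →
    2 ≤ (bd G E D).card + ind (∃ v ∈ D, v ∈ X) + ind (∃ v ∈ D, v ∈ Y)
  hyp : Hyp G ((E \ F).card + 1)

theorem Hyp.mono {N M : ℕ} (h : Hyp G N) (hM : M ≤ N) : Hyp G M :=
  fun k E X Y hE => h k E X Y (by omega)

section inst

variable {k : ℕ} {E X Y F F' D Yd : Finset V} {c : ℕ}

theorem Inst.mono (I : Inst G k E X Y F) (h : F ⊆ F') (hF' : F' ⊆ E) : Inst G k E X Y F' :=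
  ⟨hF', I.hX, I.hY, fun v hv hvF => I.deg v hv fun h' => hvF (h h'),
    fun D hD => I.conn D (hD.trans (Finset.sdiff_subset_sdiff subset_rfl h)),
    I.hyp.mono (by have := Finset.card_le_card (Finset.sdiff_subset_sdiff (subset_refl E) h)
                   omega)⟩

theorem Inst.symm (I : Inst G k E X Y F) : Inst G k E Y X F :=
  ⟨I.hF, I.hY, I.hX, fun v hv hvF => by have := I.deg v hv hvF; omega,
    fun D hD hne => by have := I.conn D hD hne; omega, I.hyp⟩

/-- A pocket minimal under inclusion. -/
structure MinPocket (G : SimpleGraph V) (E Y F D Yd : Finset V) (c : ℕ) : Prop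
    extends Pocket G E Y F D Yd c where
  out : (bd G E D \ F).card + ind (∃ v ∈ D, v ∈ Y) ≤ 1
  live : ∀ d ∈ D, ∃ y ∈ Y, ∃ n, Pth G (E \ F) d y n
  min : ∀ D' ⊆ D, D'.Nonempty → D' ≠ D → 2 ≤ (bd G D D').card + ind (∃ v ∈ D', v ∈ Yd)

theorem exists_minPocket (hF : F ⊆ E) (hYE : Y ⊆ E) (hY : ¬ Y ⊆ F) :
    ∃ D Yd c, MinPocket G E Y F D Yd c := by
  obtain ⟨y, hy, hyF⟩ := Finset.not_subset.1 hY
  have hyE : y ∈ E \ F := Finset.mem_sdiff.2 ⟨hYE hy, hyF⟩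
  let P : Finset V → Prop := fun D => D ⊆ comp G (E \ F) y ∧ D.Nonempty ∧
    (bd G E D \ F).card + ind (∃ v ∈ D, v ∈ Y) ≤ 1
  have hP : ∃ n D, P D ∧ D.card = n := by
    refine ⟨_, comp G (E \ F) y, ⟨subset_rfl, ⟨y, self_mem_comp hyE⟩, ?_⟩, rfl⟩
    have h0 : bd G E (comp G (E \ F) y) \ F = ∅ := by
      ext x
      simp only [Finset.mem_sdiff, mem_bd, Finset.notMem_empty, iff_false]
      rintro ⟨⟨⟨h1, h2⟩, d, hd, hdx⟩, h3⟩
      exact h2 (comp_closed _ _ d hd x (Finset.mem_sdiff.2 ⟨h1, h3⟩) hdx)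
    rw [h0]; simpa using ind_le_one _
  classical
  obtain ⟨D, ⟨hD, hne, hout⟩, hcard⟩ := Nat.find_spec hP
  have hmin : ∀ D' ⊆ D, D'.Nonempty → D' ≠ D →
      2 ≤ (bd G E D' \ F).card + ind (∃ v ∈ D', v ∈ Y) := by
    intro D' hD' hne' hDD
    by_contra hlt
    have := Nat.find_min' hP ⟨D', ⟨hD'.trans hD, hne', by omega⟩, rfl⟩
    have := Finset.card_lt_card (hD'.ssubset_of_ne hDD)
    omega
  have hlive : ∀ d ∈ D, ∃ y ∈ Y, ∃ n, Pth G (E \ F) d y n := fun d hd => by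
    obtain ⟨n, hn⟩ := mem_comp.1 (hD hd)
    exact ⟨y, hy, n, hn.symm⟩
  obtain ⟨d, hd⟩ := hne
  obtain ⟨Yd, c, hp⟩ := exists_pocket hF (hD.trans (comp_subset _ _ _)) ⟨d, hd⟩ hout
    ⟨d, hd, hlive d hd⟩
  exact ⟨D, Yd, c, hp, hout, hlive, fun D' hD' hne' hDD => (hmin D' hD' hne' hDD).trans (hp.cmp D' hD')⟩

theorem MinPocket.conn (P : MinPocket G E Y F D Yd c) {Z : Finset V} (hZ : Z ⊆ D)
    (hne : Z.Nonempty) : Conn G D Z Yd := by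
  intro D' hD' hne'
  by_cases h : D' = D
  · subst h
    obtain ⟨z, hz⟩ := hne
    obtain ⟨y, hy⟩ := P.tgt_ne
    rw [ind_pos ⟨z, hZ hz, hz⟩, ind_pos ⟨y, P.tgt hy, hy⟩]; omega
  · have := P.min D' hD' hne' h; omega

theorem card_lt_of_subset_sdiff (hD : D ⊆ E \ F) : D.card < (E \ F).card + 1 :=
  Nat.lt_succ_of_le (Finset.card_le_card hD)

theorem Inst.of_far (I : Inst G k E X Y F) (P : MinPocket G E Y F D Yd c)
    (hfar : ∀ w ∈ F, ∀ v ∈ D, ¬G.Adj w v) : AP (HasLen G E X Y) k := by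
  have hbd : bd G E D \ F = bd G E D := by
    rw [Finset.sdiff_eq_self_iff_disjoint, Finset.disjoint_left]
    intro x hx hxF
    obtain ⟨-, d, hd, hdx⟩ := mem_bd.1 hx
    exact hfar x hxF d hd hdx.symm
  have h1 := I.conn D P.sub P.ne
  have h2 := P.out
  rw [hbd] at h2
  have h3 : ∃ v ∈ D, v ∈ X := by
    by_contra h; rw [ind_neg h] at h1; omega
  obtain ⟨x, hxD, hxX⟩ := h3
  have := I.hyp k D (X ∩ D) Yd (card_lt_of_subset_sdiff P.sub) Finset.inter_subset_right P.tgt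
    (P.conn Finset.inter_subset_right ⟨x, Finset.mem_inter.2 ⟨hxX, hxD⟩⟩) P.ne (by
      intro v hv
      have hvE := Finset.mem_sdiff.1 (P.sub hv)
      have h4 := I.deg v hvE.1 hvE.2
      have h5 := P.deg v hv
      have h6 : nb G F v = 0 := nb_eq_zero.2 fun u hu h => hfar u hu v hv h.symm
      have h7 := ind_mono (p := v ∈ X) (q := v ∈ X ∩ D) fun h => Finset.mem_inter.2 ⟨h, hv⟩
      omega)
  refine this.shift c ?_
  rintro n ⟨u, hu, e, he, hp⟩
  obtain ⟨y, hy, hp⟩ := P.suf u e n he (hp.mono Finset.subset_union_right)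
  exact ⟨u, (Finset.mem_inter.1 hu).1, y, hy, hp⟩

/-- Path lengths from `X` to every vertex of `W` inside `F`. -/
def ToAll (G : SimpleGraph V) (F X W : Finset V) (n : ℕ) : Prop :=
  ∀ w ∈ W, ∃ u ∈ X, Pth G F u w n

theorem Inst.of_near (I : Inst G k E X Y F) (P : MinPocket G E Y F D Yd c) {W : Finset V} {l : ℕ}
    (hl : 1 ≤ l) (hlist : AP (ToAll G F X W) l) (hadj : ∃ w ∈ W, ∃ v ∈ D, G.Adj w v)
    (hdeg : ∀ v ∈ D, nb G F v + ind (v ∈ X) + 1 ≤ l + ind (∃ w ∈ W, G.Adj w v)) :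
    AP (HasLen G E X Y) k := by
  obtain ⟨w, hw, v, hv, hwv⟩ := hadj
  have hC := P.conn (nbS_subset G D W) ⟨v, mem_nbS.2 ⟨hv, w, hw, hwv⟩⟩
  obtain ⟨m, hm, hm1, hA⟩ : ∃ m, k + 1 ≤ l + m ∧ 1 ≤ m ∧ AP (HasLen G D (nbS G D W) Yd) m := by
    by_cases hk : k + 1 ≤ l + 1
    · obtain ⟨n, hn⟩ := hC.hasLen P.ne
      exact ⟨1, hk, le_rfl, AP.one hn⟩
    · refine ⟨k + 1 - l, by omega, by omega, I.hyp _ D _ _ (card_lt_of_subset_sdiff P.sub) (nbS_subset G D W)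
        P.tgt hC P.ne fun v hv => ?_⟩
      have hvE := Finset.mem_sdiff.1 (P.sub hv)
      have h4 := I.deg v hvE.1 hvE.2
      have h5 := P.deg v hv
      have h6 := hdeg v hv
      have h7 := ind_mono (p := ∃ w ∈ W, G.Adj w v) (q := v ∈ nbS G D W)
        fun h => mem_nbS.2 ⟨hv, h⟩
      omega
  refine (hlist.add (1 + c) hA hl hm1 ?_).le (k' := k) (by omega)
  rintro p q hp ⟨z, hz, e, he, hq⟩
  obtain ⟨-, w, hw, hwz⟩ := mem_nbS.1 hz
  obtain ⟨u, hu, hp⟩ := hp w hw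
  obtain ⟨y, hy, h⟩ := P.suf u e _ he (hp.concat hq P.disj hwz)
  exact ⟨u, hu, y, hy, by rwa [show p + q + (1 + c) = p + q + 1 + c by omega]⟩

end inst

/-- An instance of the path problem, with the inductive hypothesis for smaller sets. -/
structure Full (G : SimpleGraph V) (k : ℕ) (E X Y : Finset V) : Prop where
  hX : X ⊆ E
  hY : Y ⊆ E
  conn : Conn G E X Y
  deg : ∀ v ∈ E, k + 1 ≤ nb G E v + ind (v ∈ X) + ind (v ∈ Y)
  hyp : Hyp G E.card
  ne : E.Nonempty

section full

variable {k : ℕ} {E X Y F F' D Yd : Finset V} {c : ℕ}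

theorem Full.symm (I : Full G k E X Y) : Full G k E Y X :=
  ⟨I.hY, I.hX, I.conn.symm, fun v hv => by have := I.deg v hv; omega, I.hyp, I.ne⟩

theorem AP.hasLen_symm (h : AP (HasLen G E X Y) k) : AP (HasLen G E Y X) k :=
  h.mono fun _ h => h.symm

theorem Full.inst (I : Full G k E X Y) (hF : F ⊆ E) (hne : F.Nonempty) : Inst G k E X Y F := by
  refine ⟨hF, I.hX, I.hY, fun v hv _ => I.deg v hv,
    fun D hD => I.conn D (hD.trans Finset.sdiff_subset), I.hyp.mono ?_⟩
  rw [Finset.card_sdiff_of_subset hF]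
  have := Finset.card_pos.2 hne
  have := Finset.card_le_card hF
  omega

theorem nb_erase_add {y v : V} : nb G E v ≤ nb G (E.erase y) v + ind (G.Adj y v) := by
  have h1 := nb_le_add v (A := E) (B := E.erase y) (C := {y}) (fun u hu _ => by
    by_cases h : u = y
    · exact .inr (by simp [h])
    · exact .inl (Finset.mem_erase.2 ⟨h, hu⟩)) (G := G)
  have h2 := nb_le_ind (G := G) (A := {y}) (v := v) ((nb_le_card _ _).trans (by simp))
  have h3 := ind_mono (p := ∃ u ∈ ({y} : Finset V), G.Adj u v) (q := G.Adj y v) (by simp)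
  omega

theorem card_bd_erase_add (y : V) :
    (bd G E D).card ≤ (bd G (E.erase y) D).card + ind (∃ d ∈ D, G.Adj y d) := by
  by_cases h : ∃ d ∈ D, G.Adj y d
  · rw [ind_pos h]
    refine le_trans (Finset.card_le_card fun x hx => ?_) (Finset.card_insert_le y _)
    simp only [mem_bd, Finset.mem_insert, Finset.mem_erase] at hx ⊢
    tauto
  · refine le_trans (Finset.card_le_card fun x hx => ?_) (Nat.le_add_right _ _)
    simp only [mem_bd, Finset.mem_erase] at hx ⊢
    obtain ⟨⟨h1, h2⟩, d, hd, hdx⟩ := hx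
    exact ⟨⟨⟨fun h' => h ⟨d, hd, h' ▸ hdx.symm⟩, h1⟩, h2⟩, d, hd, hdx⟩

theorem Inst.erase (I : Inst G k E X Y F) {y : V} (hy : y ∈ Y) (hYF : Y ⊆ F) :
    Inst G k (E.erase y) (X.erase y) (nbs G (E.erase y) y) (F.erase y) := by
  have hsd : E.erase y \ F.erase y = E \ F := by
    ext x
    simp only [Finset.mem_sdiff, Finset.mem_erase]
    have : x = y → x ∈ F := fun h => h ▸ hYF hy
    tauto
  refine ⟨Finset.erase_subset_erase _ I.hF, Finset.erase_subset_erase _ I.hX, nbs_subset _ _ _, ?_,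
    ?_, hsd ▸ I.hyp⟩
  · intro v hv hvF
    have hvy := (Finset.mem_erase.1 hv).1
    have hvE := (Finset.mem_erase.1 hv).2
    have hvF' : v ∉ F := fun h => hvF (Finset.mem_erase.2 ⟨hvy, h⟩)
    have h1 := I.deg v hvE hvF'
    rw [ind_neg (p := v ∈ Y) fun h => hvF' (hYF h)] at h1
    have h2 := nb_erase_add (G := G) (E := E) (y := y) (v := v)
    have h3 := ind_mono (p := v ∈ X) (q := v ∈ X.erase y) fun h => Finset.mem_erase.2 ⟨hvy, h⟩
    have h4 := ind_mono (p := G.Adj y v) (q := v ∈ nbs G (E.erase y) y) fun h => mem_nbs.2 ⟨hv, h⟩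
    omega
  · intro D hD hne
    rw [hsd] at hD
    have hDy : ∀ d ∈ D, d ≠ y := fun d hd h =>
      (Finset.mem_sdiff.1 (hD hd)).2 (h ▸ hYF hy)
    have hDE : ∀ d ∈ D, d ∈ E := fun d hd => (Finset.mem_sdiff.1 (hD hd)).1
    have h1 := I.conn D hD hne
    rw [ind_neg (p := ∃ v ∈ D, v ∈ Y) fun ⟨v, hv, hv'⟩ =>
      (Finset.mem_sdiff.1 (hD hv)).2 (hYF hv')] at h1
    have h2 := card_bd_erase_add (G := G) (E := E) (D := D) y
    have h3 := ind_mono (p := ∃ v ∈ D, v ∈ X) (q := ∃ v ∈ D, v ∈ X.erase y)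
      fun ⟨v, hv, hv'⟩ => ⟨v, hv, Finset.mem_erase.2 ⟨hDy v hv, hv'⟩⟩
    have h4 := ind_mono (p := ∃ v ∈ D, G.Adj y v) (q := ∃ v ∈ D, v ∈ nbs G (E.erase y) y)
      fun ⟨v, hv, hv'⟩ => ⟨v, hv, mem_nbs.2 ⟨Finset.mem_erase.2 ⟨hDy v hv, hDE v hv⟩, hv'⟩⟩
    omega

theorem Full.erase (I : Full G k E X Y) (hF : F ⊆ E) {y : V} (hy : y ∈ Y) (hYF : Y ⊆ F) :
    Inst G k (E.erase y) (X.erase y) (nbs G (E.erase y) y) (F.erase y) :=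
  (I.inst hF ⟨y, hYF hy⟩).erase hy hYF

theorem hasLen_of_erase {y : V} (hyE : y ∈ E) (hy : y ∈ Y) (n : ℕ)
    (h : HasLen G (E.erase y) (X.erase y) (nbs G (E.erase y) y) n) : HasLen G E X Y (n + 1) := by
  obtain ⟨u, hu, v, hv, hp⟩ := h
  have := hp.snoc (w := y) (by simp) (mem_nbs.1 hv).2.symm
  rw [Finset.insert_erase hyE] at this
  exact ⟨u, (Finset.mem_erase.1 hu).2, y, hy, this⟩

theorem Full.of_erase (I : Full G k E X Y) {y : V} (hy : y ∈ Y)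
    (h : AP (HasLen G (E.erase y) (X.erase y) (nbs G (E.erase y) y)) k) :
    AP (HasLen G E X Y) k :=
  h.shift 1 (hasLen_of_erase (I.hY hy) hy)

theorem Inst.run (I : Inst G k E X Y ∅) (hE : E.Nonempty) : AP (HasLen G E X Y) k :=
  I.hyp k E X Y (by simp) I.hX I.hY (fun D hD => I.conn D (by simpa using hD)) hE
    fun v hv => I.deg v hv (by simp)

theorem Full.card_one (I : Full G k E X Y) (hk : 2 ≤ k) (hY : Y.card ≤ 1) :
    AP (HasLen G E X Y) k := by
  obtain ⟨-, -, -, y, hy, -⟩ := I.conn.hasLen I.ne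
  have hYy : Y ⊆ {y} := fun x hx => by simpa using Finset.card_le_one.1 hY x hx y hy
  have h1 := I.erase (F := {y}) (by simpa using I.hY hy) hy hYy
  have h2 := I.deg y (I.hY hy)
  have h3 := ind_le_one (y ∈ X)
  have h4 := ind_le_one (y ∈ Y)
  obtain ⟨v, hv, hvy⟩ := nb_pos.1 (show 0 < nb G E y by omega)
  refine I.of_erase hy (Inst.run (by simpa using h1) ⟨v, Finset.mem_erase.2 ⟨hvy.ne', hv⟩⟩)

theorem nb_add_one_le (h : ∃ u ∈ F, ¬G.Adj u v) : nb G F v + 1 ≤ F.card := by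
  by_contra hlt
  obtain ⟨u, hu, huv⟩ := h
  exact huv (adj_of_nb_ge (by omega) u hu).symm

theorem clique_nondeg (I : Inst G k E X Y F) (hFX : F ⊆ X) (hF : Clq G F)
    (hcard : 2 ≤ F.card ∨ (1 ≤ F.card ∧ X ⊆ F))
    (hmax : ∀ v ∈ X, v ∉ F → ∃ u ∈ F, ¬G.Adj u v) (hY : ¬ Y ⊆ F) : AP (HasLen G E X Y) k := by
  obtain ⟨D, Yd, c, P⟩ := exists_minPocket I.hF I.hY hY
  by_cases hadj : ∃ w ∈ F, ∃ v ∈ D, G.Adj w v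
  · refine I.of_near P (l := F.card) (by omega) ⟨0, 1, .inl rfl, fun i hi w hw => ?_⟩ hadj
      fun v hv => ?_
    · obtain ⟨u, hu, hp⟩ := pth_in_clique hF hw hi
      exact ⟨u, hFX hu, by simpa using hp.symm⟩
    · have hvF := (Finset.mem_sdiff.1 (P.sub hv)).2
      have h1 : nb G F v = 0 ∨ ind (∃ w ∈ F, G.Adj w v) = 1 := by
        rcases Nat.eq_zero_or_pos (nb G F v) with h | h
        · exact .inl h
        · obtain ⟨u, hu, huv⟩ := nb_pos.1 h
          exact .inr (ind_pos ⟨u, hu, huv.symm⟩)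
      by_cases hvX : v ∈ X
      · have := nb_add_one_le (hmax v hvX hvF)
        rw [ind_pos hvX]
        have : ¬ X ⊆ F := fun h => hvF (h hvX)
        have : 2 ≤ F.card := by tauto
        omega
      · rw [ind_neg hvX]
        have := nb_le_card (G := G) F v
        have : 1 ≤ F.card := by omega
        omega
  · push Not at hadj
    exact I.of_far P hadj

theorem exists_maximal_clique (hF : Clq G F) (hFX : F ⊆ X) :
    ∃ F', F ⊆ F' ∧ F' ⊆ X ∧ Clq G F' ∧ ∀ v ∈ X, v ∉ F' → ∃ u ∈ F', ¬G.Adj u v := by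
  classical
  obtain ⟨F', hF', hmax⟩ := Finset.exists_max_image
    (X.powerset.filter fun F' => F ⊆ F' ∧ Clq G F') Finset.card
    ⟨F, by simp [hFX, hF]⟩
  simp only [Finset.mem_filter, Finset.mem_powerset] at hF' hmax
  refine ⟨F', hF'.2.1, hF'.1, hF'.2.2, fun v hv hvF => ?_⟩
  by_contra hcon
  push Not at hcon
  have := hmax (insert v F') ⟨Finset.insert_subset hv hF'.1,
    hF'.2.1.trans (Finset.subset_insert _ _), ?_⟩
  · rw [Finset.card_insert_of_notMem hvF] at this; omega
  · intro a ha b hb hab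
    rw [Finset.mem_insert] at ha hb
    rcases ha with rfl | ha <;> rcases hb with rfl | hb
    · exact absurd rfl hab
    · exact (hcon b hb).symm
    · exact hcon a ha
    · exact hF'.2.2 a ha b hb hab

theorem Full.of_edge (I : Full G k E X Y) (hk : 2 ≤ k) (hX : HasEdge G X) :
    AP (HasLen G E X Y) k := by
  by_contra hAP
  have hYc : 2 ≤ Y.card := by
    by_contra h; exact hAP (I.card_one hk (by omega))
  have hdeg : ∀ F ⊆ X, Clq G F → 2 ≤ F.card → (∀ v ∈ X, v ∉ F → ∃ u ∈ F, ¬G.Adj u v) → Y ⊆ F := by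
    intro F hFX hF hc hmax
    by_contra hY
    exact hAP (clique_nondeg (I.inst (hFX.trans I.hX) (Finset.card_pos.1 (by omega))) hFX hF
      (.inl hc) hmax hY)
  obtain ⟨a, ha, b, hb, hab⟩ := hX
  obtain ⟨F, habF, hFX, hF, hmax⟩ := exists_maximal_clique (G := G) (F := {a, b}) (X := X) (by
    intro x hx y hy hxy
    simp only [Finset.mem_insert, Finset.mem_singleton] at hx hy
    rcases hx with rfl | rfl <;> rcases hy with rfl | rfl
    exacts [absurd rfl hxy, hab, hab.symm, absurd rfl hxy]) (by
    intro x hx; simp at hx; rcases hx with rfl | rfl <;> assumption)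
  have hFc : 2 ≤ F.card := (Finset.card_pair hab.ne).symm.le.trans (Finset.card_le_card habF)
  have hYF := hdeg F hFX hF hFc hmax
  obtain ⟨y, hy⟩ := Finset.card_pos.1 (show 0 < Y.card by omega)
  have hyF := hYF hy
  have hFE := hFX.trans I.hX
  by_cases hN : nbs G E y ⊆ F
  · have h1 : nb G E y + 1 ≤ F.card := by
      have : nbs G E y ⊆ F.erase y := fun x hx =>
        Finset.mem_erase.2 ⟨(mem_nbs.1 hx).2.ne', hN hx⟩
      have := Finset.card_le_card this
      rw [Finset.card_erase_of_mem hyF] at this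
      change nb G E y ≤ _ at this
      omega
    have h2 := I.deg y (I.hY hy)
    have h3 := ind_le_one (y ∈ X)
    have h4 := ind_le_one (y ∈ Y)
    refine hAP ⟨0, 1, .inl rfl, fun i hi => ?_⟩
    obtain ⟨u, hu, hp⟩ := pth_in_clique hF hyF (n := i) (by omega)
    exact ⟨u, hFX hu, y, hy, by simpa using hp.symm.mono hFE⟩
  have hN' : ¬ nbs G (E.erase y) y ⊆ F.erase y := by
    obtain ⟨v, hv, hvF⟩ := Finset.not_subset.1 hN
    intro h
    exact hvF (Finset.mem_of_mem_erase (h (mem_nbs.2 ⟨Finset.mem_erase.2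
      ⟨(mem_nbs.1 hv).2.ne', (mem_nbs.1 hv).1⟩, (mem_nbs.1 hv).2⟩)))
  have hFy : (F.erase y).card + 1 = F.card := Finset.card_erase_add_one hyF
  have hcard : 2 ≤ (F.erase y).card ∨ (1 ≤ (F.erase y).card ∧ X.erase y ⊆ F.erase y) := by
    by_cases h3 : 3 ≤ F.card
    · exact .inl (by omega)
    refine .inr ⟨by omega, Finset.erase_subset_erase _ ?_⟩
    have hYF' : Y = F := Finset.eq_of_subset_of_card_le hYF (by omega)
    by_contra hX
    subst hYF'
    exact hAP (AP.hasLen_symm (clique_nondeg (I.symm.inst hFE ⟨y, hyF⟩) subset_rfl hF (.inl hFc)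
      (fun v hv hv' => absurd hv hv') hX))
  refine hAP (I.of_erase hy (clique_nondeg (I.erase hFE hy hYF) (Finset.erase_subset_erase _ hFX)
    (fun a ha b hb => hF a (Finset.mem_of_mem_erase ha) b (Finset.mem_of_mem_erase hb)) hcard ?_
    hN'))
  intro v hv hvF
  obtain ⟨hvy, hvX⟩ := Finset.mem_erase.1 hv
  have hvF' : v ∉ F := fun h => hvF (Finset.mem_erase.2 ⟨hvy, h⟩)
  by_contra hcon
  push Not at hcon
  obtain ⟨F'', h1, h2, h3, h4⟩ := exists_maximal_clique (G := G) (F := insert v (F.erase y)) (X := X)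
    (by
      intro a ha b hb hab
      rw [Finset.mem_insert] at ha hb
      rcases ha with rfl | ha <;> rcases hb with rfl | hb
      · exact absurd rfl hab
      · exact (hcon b hb).symm
      · exact hcon a ha
      · exact hF a (Finset.mem_of_mem_erase ha) b (Finset.mem_of_mem_erase hb) hab)
    (Finset.insert_subset hvX ((Finset.erase_subset _ _).trans hFX))
  have h5 := Finset.card_le_card h1
  rw [Finset.card_insert_of_notMem hvF] at h5
  have hyF'' := hdeg F'' h2 h3 (by omega) h4 hy
  obtain ⟨u, hu, huv⟩ := hmax v hvX hvF'
  by_cases huy : u = y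
  · subst huy
    exact huv (h3 u hyF'' v (h1 (Finset.mem_insert_self _ _)) hvy.symm)
  · exact huv (hcon u (Finset.mem_erase.2 ⟨huy, hu⟩))

end full

section theta

variable {k : ℕ} {E X Y F D Yd : Finset V} {c : ℕ}

/-- Induction on a set with at most one exit other than through `X`. -/
theorem Hyp.of_out {N : ℕ} (hyp : Hyp G N) (hN : D.card < N) (hD : D ⊆ E) (hne : D.Nonempty)
    (hout : (bd G E D).card + ind (∃ v ∈ D, v ∈ Y) ≤ 1)
    (hlive : ∃ d ∈ D, ∃ y ∈ Y, ∃ n, Pth G E d y n)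
    (hconn : ∀ D' ⊆ D, D'.Nonempty →
      2 ≤ (bd G E D').card + ind (∃ v ∈ D', v ∈ X) + ind (∃ v ∈ D', v ∈ Y))
    (hdeg : ∀ v ∈ D, k + 1 ≤ nb G E v + ind (v ∈ X) + ind (v ∈ Y)) : AP (HasLen G E X Y) k := by
  obtain ⟨Yd, c, P⟩ := exists_pocket (G := G) (E := E) (Y := Y) (F := ∅) (D := D) (by simp)
    (by simpa using hD) hne (by simpa using hout) (by simpa using hlive)
  refine (hyp k D (X ∩ D) Yd hN Finset.inter_subset_right P.tgt ?_ hne ?_).shift c ?_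
  · intro D' hD' hne
    have h1 := P.cmp D' hD'
    have h2 := hconn D' hD' hne
    have h3 := ind_mono (p := ∃ v ∈ D', v ∈ X) (q := ∃ v ∈ D', v ∈ X ∩ D) (by
      rintro ⟨v, h1, h2⟩; exact ⟨v, h1, Finset.mem_inter.2 ⟨h2, hD' h1⟩⟩)
    simp at h1; omega
  · intro v hv
    have h1 := P.deg v hv
    have h2 := hdeg v hv
    have h3 := ind_mono (p := v ∈ X) (q := v ∈ X ∩ D) fun h => Finset.mem_inter.2 ⟨h, hv⟩
    have : nb G ∅ v = 0 := by simp [nb_eq_zero]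
    omega
  · rintro n ⟨u, hu, e, he, hp⟩
    obtain ⟨y, hy, hp⟩ := P.suf u e n he (by simpa using hp)
    exact ⟨u, (Finset.mem_inter.1 hu).1, y, hy, hp⟩

theorem Full.of_out (I : Full G k E X Y) (hD : D ⊆ E) (hne : D.Nonempty) (hlt : D.card < E.card)
    (hout : (bd G E D).card + ind (∃ v ∈ D, v ∈ Y) ≤ 1) : AP (HasLen G E X Y) k := by
  obtain ⟨d, hd⟩ := hne
  obtain ⟨y, hy, n, hn⟩ := I.conn.exists_pth (hD hd)
  exact I.hyp.of_out hlt hD ⟨d, hd⟩ hout ⟨d, hd, y, hy, n, hn⟩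
    (fun D' hD' => I.conn D' (hD'.trans hD)) fun v hv => I.deg v (hD hv)

/-- A vertex `z` with at least two neighbours in `B`, together with a set `D₁` which contains
vertices of `X`, is attached to `z` but not to `B`, and has at most one further exit. -/
theorem Full.theta (I : Full G k E X Y) (hk : 3 ≤ k) {z : V} {B D₁ : Finset V} {f : ℕ}
    (hB : ∀ b ∈ B, G.Adj z b) (hB2 : 2 ≤ B.card) (hFE : insert z B ⊆ E)
    (hXz : ∃ u ∈ X, Pth G (insert z B) u z f) (hD₁ : D₁ ⊆ E \ insert z B)
    (hX : ∃ v ∈ D₁, v ∈ X) (hz : ∃ v ∈ D₁, G.Adj z v)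
    (hbd : ∀ v ∈ D₁, ∀ b ∈ B, ¬G.Adj v b)
    (hout : (bd G E D₁ \ insert z B).card + ind (∃ v ∈ D₁, v ∈ Y) ≤ 1)
    (hlive : ∃ d ∈ D₁, ∃ y ∈ Y, ∃ n, Pth G (E \ insert z B) d y n) : AP (HasLen G E X Y) k := by
  by_contra hAP
  set F := insert z B with hFdef
  have hzF : z ∈ F := Finset.mem_insert_self _ _
  have hBF : B ⊆ F := Finset.subset_insert _ _
  have hzE : z ∈ E := hFE hzF
  have X2 : ∀ D ⊆ E, D.Nonempty → z ∉ D → 2 ≤ (bd G E D).card + ind (∃ v ∈ D, v ∈ Y) := by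
    intro D hD hne hzD
    by_contra h
    exact hAP (I.of_out hD hne (card_lt_of_ssubset hD hzE hzD) (by omega))
  classical
  obtain ⟨D, hDmem, hmax⟩ := Finset.exists_max_image
    ((E \ F).powerset.filter fun D => D₁ ⊆ D ∧ (∀ v ∈ D, ∀ b ∈ B, ¬G.Adj v b) ∧
      (bd G E D \ F).card + ind (∃ v ∈ D, v ∈ Y) ≤ 1) Finset.card
    ⟨D₁, by simp only [Finset.mem_filter, Finset.mem_powerset]; exact ⟨hD₁, subset_rfl, hbd, hout⟩⟩
  simp only [Finset.mem_filter, Finset.mem_powerset] at hDmem hmax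
  obtain ⟨hDF, hD₁D, hDB, hDout⟩ := hDmem
  have hDE : D ⊆ E := hDF.trans Finset.sdiff_subset
  have hDnF : ∀ v ∈ D, v ∉ F := fun v hv => (Finset.mem_sdiff.1 (hDF hv)).2
  have hzD : z ∉ D := fun h => hDnF z h hzF
  obtain ⟨x, hxD₁, hxX⟩ := hX
  obtain ⟨a, haD₁, hza⟩ := hz
  have hlive' : ∃ d ∈ D, ∃ y ∈ Y, ∃ n, Pth G (E \ F) d y n := by
    obtain ⟨d, hd, h⟩ := hlive; exact ⟨d, hD₁D hd, h⟩
  obtain ⟨Yd, c, P⟩ := exists_pocket hFE hDF ⟨x, hD₁D hxD₁⟩ hDout hlive'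
  have hdeg : ∀ v ∈ D, k + 1 ≤ nb G D v + ind (G.Adj z v) + ind (v ∈ X) + ind (v ∈ Yd) := by
    intro v hv
    have h1 := I.deg v (hDE hv)
    have h2 := P.deg v hv
    have h3 : nb G F v ≤ nb G {z} v := Finset.card_le_card fun u hu => by
      simp only [mem_nbs, hFdef, Finset.mem_insert, Finset.mem_singleton] at hu ⊢
      exact ⟨hu.1.resolve_right fun h => hDB v hv u h hu.2, hu.2⟩
    have h4 := nb_le_ind (G := G) (A := {z}) (v := v) ((nb_le_card _ _).trans (by simp))
    have h5 := ind_mono (p := ∃ u ∈ ({z} : Finset V), G.Adj u v) (q := G.Adj z v) (by simp)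
    omega
  have hconn : ∀ D' ⊆ D, D'.Nonempty → 2 ≤ (bd G D D').card + ind (∃ v ∈ D', G.Adj z v) +
      ind (∃ v ∈ D', v ∈ X) + ind (∃ v ∈ D', v ∈ Yd) := by
    intro D' hD' hne
    have h1 := I.conn D' (hD'.trans hDE) hne
    have h2 := P.cmp D' hD'
    have h3 : (bd G E D').card ≤ (bd G E D' \ F).card + ind (∃ v ∈ D', G.Adj z v) := by
      by_cases h : ∃ v ∈ D', G.Adj z v
      · rw [ind_pos h]
        refine le_trans (Finset.card_le_card fun u hu => ?_) (Finset.card_insert_le z _)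
        rw [Finset.mem_insert]
        by_cases huF : u ∈ F
        · obtain ⟨-, d, hd, hdu⟩ := mem_bd.1 hu
          exact .inl ((Finset.mem_insert.1 huF).resolve_right fun h => hDB d (hD' hd) u h hdu)
        · exact .inr (Finset.mem_sdiff.2 ⟨hu, huF⟩)
      · refine le_trans (Finset.card_le_card fun u hu => ?_) (Nat.le_add_right _ _)
        refine Finset.mem_sdiff.2 ⟨hu, fun huF => ?_⟩
        obtain ⟨-, d, hd, hdu⟩ := mem_bd.1 hu
        rcases Finset.mem_insert.1 huF with rfl | huB
        · exact h ⟨d, hd, hdu.symm⟩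
        · exact hDB d (hD' hd) u huB hdu
    omega
  -- from `X` to `z` inside `D`
  have stage1 : AP (HasLen G D (X ∩ D) (nbs G D z)) (k - 1) := by
    refine I.hyp (k - 1) D _ _ (card_lt_of_ssubset hDE hzE hzD) Finset.inter_subset_right
      (nbs_subset _ _ _) ?_ ⟨x, hD₁D hxD₁⟩ ?_
    swap
    · intro v hv
      have h1 := hdeg v hv
      have h2 := ind_mono (p := v ∈ X) (q := v ∈ X ∩ D) fun h => Finset.mem_inter.2 ⟨h, hv⟩
      have h3 := ind_mono (p := G.Adj z v) (q := v ∈ nbs G D z) fun h => mem_nbs.2 ⟨hv, h⟩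
      have h4 := ind_le_one (v ∈ Yd)
      omega
    intro D₂ hD₂ hne
    by_contra hlt
    have h1 := hconn D₂ hD₂ hne
    have h2 := ind_mono (p := ∃ v ∈ D₂, v ∈ X) (q := ∃ v ∈ D₂, v ∈ X ∩ D)
      fun ⟨v, hv, h⟩ => ⟨v, hv, Finset.mem_inter.2 ⟨h, hD₂ hv⟩⟩
    have h3 := ind_mono (p := ∃ v ∈ D₂, G.Adj z v) (q := ∃ v ∈ D₂, v ∈ nbs G D z)
      fun ⟨v, hv, h⟩ => ⟨v, hv, mem_nbs.2 ⟨hD₂ hv, h⟩⟩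
    have hcard : D₂.card < E.card := card_lt_of_ssubset (hD₂.trans hDE) hzE fun h => hzD (hD₂ h)
    have opt1 : (¬∃ v ∈ D₂, G.Adj z v) → (∃ d ∈ D₂, ∃ x ∈ X ∩ D, ∃ n, Pth G D d x n) → False := by
      intro hzD₂ hl
      have : AP (HasLen G D Yd (X ∩ D)) k := by
        refine I.hyp.of_out hcard hD₂ hne (by omega) hl ?_ ?_
        · intro D' hD' hne'
          have h4 := hconn D' (hD'.trans hD₂) hne'
          rw [ind_neg (p := ∃ v ∈ D', G.Adj z v) fun ⟨v, hv, h⟩ => hzD₂ ⟨v, hD' hv, h⟩] at h4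
          have h5 := ind_mono (p := ∃ v ∈ D', v ∈ X) (q := ∃ v ∈ D', v ∈ X ∩ D)
            fun ⟨v, hv, h⟩ => ⟨v, hv, Finset.mem_inter.2 ⟨h, hD₂ (hD' hv)⟩⟩
          omega
        · intro v hv
          have h4 := hdeg v (hD₂ hv)
          rw [ind_neg (p := G.Adj z v) fun h => hzD₂ ⟨v, hv, h⟩] at h4
          have h5 := ind_mono (p := v ∈ X) (q := v ∈ X ∩ D)
            fun h => Finset.mem_inter.2 ⟨h, hD₂ hv⟩
          omega
      refine hAP (this.shift c ?_)
      rintro n ⟨e, he, u, hu, hp⟩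
      obtain ⟨y, hy, hp⟩ := P.suf u e n he (hp.symm.mono Finset.subset_union_right)
      exact ⟨u, (Finset.mem_inter.1 hu).1, y, hy, hp⟩
    have opt2 : (¬∃ v ∈ D₂, v ∈ X) →
        (∃ d ∈ D₂, ∃ x ∈ ({z} : Finset V), ∃ n, Pth G (insert z D) d x n) → False := by
      intro hXD₂ hl
      have hb : ∀ D' ⊆ D₂, (bd G (insert z D) D').card ≤
          (bd G D D').card + ind (∃ v ∈ D', G.Adj z v) := by
        intro D' hD'
        have := card_bd_erase_add (G := G) (E := insert z D) (D := D') z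
        rwa [Finset.erase_insert hzD] at this
      have hb' : ∀ D' ⊆ D₂, (bd G D D').card + ind (∃ v ∈ D', G.Adj z v) ≤
          (bd G (insert z D) D').card := by
        intro D' hD'
        by_cases h : ∃ v ∈ D', G.Adj z v
        · rw [ind_pos h, ← Finset.card_insert_of_notMem (a := z)]
          · refine Finset.card_le_card fun u hu => ?_
            rw [Finset.mem_insert] at hu
            rcases hu with rfl | hu
            · obtain ⟨v, hv, hzv⟩ := h
              exact mem_bd.2 ⟨⟨Finset.mem_insert_self _ _, fun h => hzD (hD₂ (hD' h))⟩,
                v, hv, hzv.symm⟩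
            · obtain ⟨⟨h1, h2⟩, h3⟩ := mem_bd.1 hu
              exact mem_bd.2 ⟨⟨Finset.mem_insert_of_mem h1, h2⟩, h3⟩
          · exact fun h => hzD (mem_bd.1 h).1.1
        · rw [ind_neg h, add_zero]
          refine Finset.card_le_card fun u hu => ?_
          obtain ⟨⟨h1, h2⟩, h3⟩ := mem_bd.1 hu
          exact mem_bd.2 ⟨⟨Finset.mem_insert_of_mem h1, h2⟩, h3⟩
      have hzi : ∀ D' ⊆ D₂, ¬∃ v ∈ D', v ∈ ({z} : Finset V) := by
        rintro D' hD' ⟨v, hv, hvz⟩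
        rw [Finset.mem_singleton] at hvz
        exact hzD (hD₂ (hD' (hvz ▸ hv)))
      have : AP (HasLen G (insert z D) Yd {z}) k := by
        refine I.hyp.of_out hcard (hD₂.trans (Finset.subset_insert _ _)) hne ?_ hl ?_ ?_
        · have := hb D₂ subset_rfl
          rw [ind_neg (hzi D₂ subset_rfl)]
          omega
        · intro D' hD' hne'
          have h4 := hconn D' (hD'.trans hD₂) hne'
          rw [ind_neg (p := ∃ v ∈ D', v ∈ X) fun ⟨v, hv, h⟩ => hXD₂ ⟨v, hD' hv, h⟩] at h4
          have h5 := hb' D' hD'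
          omega
        · intro v hv
          have h4 := hdeg v (hD₂ hv)
          rw [ind_neg (p := v ∈ X) fun h => hXD₂ ⟨v, hv, h⟩] at h4
          have h5 : nb G D v + ind (G.Adj z v) ≤ nb G (insert z D) v := by
            by_cases h : G.Adj z v
            · rw [ind_pos h, nb, ← Finset.card_insert_of_notMem (a := z)]
              · refine Finset.card_le_card fun u hu => ?_
                rw [Finset.mem_insert] at hu
                rcases hu with rfl | hu
                · simp [h.symm]
                · rw [mem_nbs] at hu ⊢
                  exact ⟨Finset.mem_insert_of_mem hu.1, hu.2⟩
              · exact fun h => hzD (mem_nbs.1 h).1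
            · rw [ind_neg h]; exact nb_mono (Finset.subset_insert _ _) v
          omega
      obtain ⟨u, hu, hpu⟩ := hXz
      refine hAP (this.shift (f + c) ?_)
      rintro n ⟨e, he, z', hz', hp⟩
      rw [Finset.mem_singleton] at hz'
      subst hz'
      have hg := hpu.glue hp.symm (by
        rw [Finset.erase_insert hzD]; exact P.disj)
      obtain ⟨y, hy, hp⟩ := P.suf u e _ he (hg.mono (by
        intro w hw
        rcases Finset.mem_union.1 hw with h | h
        · exact Finset.mem_union_left _ h
        · rcases Finset.mem_insert.1 h with rfl | h
          exacts [Finset.mem_union_left _ hzF, Finset.mem_union_right _ h]))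
      exact ⟨u, hu, y, hy, by rwa [show n + (f + c) = f + n + c by omega]⟩
    by_cases hX2 : ∃ v ∈ D₂, v ∈ X
    · have hz2 : ¬∃ v ∈ D₂, G.Adj z v := by
        intro h; rw [ind_pos h] at h3; rw [ind_pos hX2] at h2; omega
      obtain ⟨v, hv, hvX⟩ := hX2
      exact opt1 hz2 ⟨v, hv, v, Finset.mem_inter.2 ⟨hvX, hD₂ hv⟩, 0, .nil (hD₂ hv)⟩
    have hzlive : ∀ d ∈ D₂, ∀ v n, Pth G D d v n → G.Adj z v → False := by
      intro d hd v n hp hzv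
      exact opt2 hX2 ⟨d, hd, z, by simp, n + 1, hp.snoc hzD hzv.symm⟩
    by_cases hz2 : ∃ v ∈ D₂, G.Adj z v
    · obtain ⟨v, hv, hzv⟩ := hz2
      exact hzlive v hv v 0 (.nil (hD₂ hv)) hzv
    obtain ⟨d, hd⟩ := hne
    have h4 := hconn (comp G D d) (comp_subset _ _ _) ⟨d, self_mem_comp (hD₂ hd)⟩
    rw [closed_iff_bd.1 (comp_closed D d), Finset.card_empty] at h4
    have h5 := ind_le_one (∃ v ∈ comp G D d, v ∈ Yd)
    by_cases hXK : ∃ v ∈ comp G D d, v ∈ X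
    · obtain ⟨v, hv, hvX⟩ := hXK
      obtain ⟨n, hn⟩ := mem_comp.1 hv
      exact opt1 hz2 ⟨d, hd, v, Finset.mem_inter.2 ⟨hvX, hn.end_mem⟩, n, hn⟩
    · rw [ind_neg hXK] at h4
      have : ∃ v ∈ comp G D d, G.Adj z v := by
        by_contra h; rw [ind_neg h] at h4; omega
      obtain ⟨v, hv, hzv⟩ := this
      obtain ⟨n, hn⟩ := mem_comp.1 hv
      exact hzlive d hd v n hn hzv
  -- from `z` to `Y` outside `D`
  set R := (E \ D).erase z with hR
  have hmemR : ∀ {v}, v ∈ R ↔ v ≠ z ∧ v ∈ E ∧ v ∉ D := by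
    intro v; simp [hR]
  have hRE : R ⊆ E := fun v hv => (hmemR.1 hv).2.1
  have hBR : B ⊆ R := fun b hb =>
    hmemR.2 ⟨(hB b hb).ne', hFE (hBF hb), fun h => hDnF b h (hBF hb)⟩
  obtain ⟨w, hw⟩ : ∃ w, bd G E D \ F ⊆ {w} := by
    rcases (bd G E D \ F).eq_empty_or_nonempty with h | ⟨w, hw⟩
    · exact ⟨z, by simp [h]⟩
    · have h1 : (bd G E D \ F).card ≤ 1 := by omega
      exact ⟨w, fun x hx => by simpa using Finset.card_le_one.1 h1 x hx w hw⟩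
  have hRD : ∀ v ∈ R, v ≠ w → ∀ d ∈ D, ¬G.Adj d v := by
    intro v hv hvw d hd hdv
    obtain ⟨h1, h2, h3⟩ := hmemR.1 hv
    have hvF : v ∉ F := fun h => hDB d hd v ((Finset.mem_insert.1 h).resolve_left h1) hdv
    exact hvw (by simpa using hw (Finset.mem_sdiff.2 ⟨mem_bd.2 ⟨⟨h2, h3⟩, d, hd, hdv⟩, hvF⟩))
  have stage2 : AP (HasLen G R (nbs G R z) (Y ∩ R)) 2 := by
    refine two_paths R _ _ w (nbs_subset _ _ _) Finset.inter_subset_right ?_ ?_ ?_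
    · intro D₂ hD₂ hne
      by_contra hlt
      have hzD₂ : z ∉ D₂ := fun h => (hmemR.1 (hD₂ h)).1 rfl
      have h2 := ind_mono (p := ∃ v ∈ D₂, v ∈ Y) (q := ∃ v ∈ D₂, v ∈ Y ∩ R)
        fun ⟨v, hv, h⟩ => ⟨v, hv, Finset.mem_inter.2 ⟨h, hD₂ hv⟩⟩
      have h3 := ind_mono (p := ∃ v ∈ D₂, G.Adj z v) (q := ∃ v ∈ D₂, v ∈ nbs G R z)
        fun ⟨v, hv, h⟩ => ⟨v, hv, mem_nbs.2 ⟨hD₂ hv, h⟩⟩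
      by_cases hwD : w ∈ D₂ ∧ ∃ d ∈ D, G.Adj d w
      · obtain ⟨hwD, hdw⟩ := hwD
        have hwR := hmemR.1 (hD₂ hwD)
        have hwbd : w ∈ bd G E D \ F := by
          refine Finset.mem_sdiff.2 ⟨mem_bd.2 ⟨hwR.2, hdw⟩, fun h => ?_⟩
          obtain ⟨d, hd, hdw⟩ := hdw
          exact hDB d hd w ((Finset.mem_insert.1 h).resolve_left hwR.1) hdw
        have hDY : ¬∃ v ∈ D, v ∈ Y := by
          intro h; rw [ind_pos h] at hDout
          have := Finset.card_pos.2 ⟨w, hwbd⟩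
          omega
        have hD'E : D ∪ D₂ ⊆ E := Finset.union_subset hDE (hD₂.trans hRE)
        have hzD' : z ∉ D ∪ D₂ := by simp [hzD, hzD₂]
        have hbd' : ∀ v ∈ bd G E (D ∪ D₂), v ≠ z → v ∈ bd G R D₂ := by
          intro v hv hvz
          obtain ⟨⟨h1, h2⟩, d, hd, hdv⟩ := mem_bd.1 hv
          rw [Finset.mem_union, not_or] at h2
          have hvR : v ∈ R := hmemR.2 ⟨hvz, h1, h2.1⟩
          rcases Finset.mem_union.1 hd with hd | hd
          · exact absurd hdv (hRD v hvR (fun h => h2.2 (h ▸ hwD)) d hd)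
          · exact mem_bd.2 ⟨⟨hvR, h2.2⟩, d, hd, hdv⟩
        have hYD' := ind_mono (p := ∃ v ∈ D ∪ D₂, v ∈ Y) (q := ∃ v ∈ D₂, v ∈ Y) (by
          rintro ⟨v, hv, hvY⟩
          rcases Finset.mem_union.1 hv with hv | hv
          · exact absurd ⟨v, hv, hvY⟩ hDY
          · exact ⟨v, hv, hvY⟩)
        by_cases hz2 : ∃ v ∈ D₂, G.Adj z v
        · rw [ind_pos hz2] at h3
          have h4 := X2 (D ∪ D₂) hD'E ⟨w, Finset.mem_union_right _ hwD⟩ hzD'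
          have h5 : bd G E (D ∪ D₂) ⊆ {z} := by
            intro v hv
            by_contra hvz
            have := Finset.card_pos.2 ⟨v, hbd' v hv (by simpa using hvz)⟩
            omega
          have := Finset.card_le_card h5
          rw [Finset.card_singleton] at this
          omega
        · have hBD₂ : ∀ b ∈ B, b ∉ D₂ := fun b hb hbD => hz2 ⟨b, hbD, hB b hb⟩
          have hD'F : D ∪ D₂ ⊆ E \ F := by
            intro v hv
            refine Finset.mem_sdiff.2 ⟨hD'E hv, fun hvF => ?_⟩
            rcases Finset.mem_insert.1 hvF with rfl | hvB
            · exact hzD' hv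
            · rcases Finset.mem_union.1 hv with hv | hv
              · exact hDnF v hv hvF
              · exact hBD₂ v hvB hv
          by_cases hb : ∃ b ∈ B, b ∈ bd G R D₂
          · obtain ⟨b, hbB, hb⟩ := hb
            have h1 := Finset.card_pos.2 ⟨b, hb⟩
            have hb1 : ∀ v ∈ bd G R D₂, v = b := fun v hv =>
              Finset.card_le_one.1 (by omega) v hv b hb
            have hnY : ¬∃ v ∈ D₂, v ∈ Y := by
              intro h; rw [ind_pos h] at h2; omega
            obtain ⟨d, hd, y, hy, n, hp⟩ := hlive'
            have hcl : Closed G (E \ F) (D ∪ D₂) := by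
              intro d hd v hv hdv
              rw [Finset.mem_sdiff] at hv
              by_contra hvD
              have hvz : v ≠ z := fun h => hv.2 (h ▸ hzF)
              have := hb1 v (hbd' v (mem_bd.2 ⟨⟨hv.1, hvD⟩, d, hd, hdv⟩) hvz)
              exact hv.2 (this ▸ hBF hbB)
            have := hcl.mem_of_pth hp (Finset.mem_union_left _ hd)
            rcases Finset.mem_union.1 this with h | h
            · exact hDY ⟨y, h, hy⟩
            · exact hnY ⟨y, h, hy⟩
          · have h4 := hmax (D ∪ D₂) ⟨hD'F, hD₁D.trans Finset.subset_union_left, ?_, ?_⟩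
            · have : D.card < (D ∪ D₂).card := Finset.card_lt_card
                ⟨Finset.subset_union_left, fun h => hwR.2.2 (h (Finset.mem_union_right _ hwD))⟩
              omega
            · intro v hv b hbB hvb
              rcases Finset.mem_union.1 hv with hv | hv
              · exact hDB v hv b hbB hvb
              · exact hb ⟨b, hbB, mem_bd.2 ⟨⟨hBR hbB, hBD₂ b hbB⟩, v, hv, hvb⟩⟩
            · have : (bd G E (D ∪ D₂) \ F).card ≤ (bd G R D₂).card :=
                Finset.card_le_card fun v hv => by
                  rw [Finset.mem_sdiff] at hv
                  exact hbd' v hv.1 fun h => hv.2 (h ▸ hzF)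
              omega
      · have h4 := X2 D₂ (hD₂.trans hRE) hne hzD₂
        have h5 : (bd G E D₂).card ≤ (bd G R D₂).card + ind (∃ v ∈ D₂, G.Adj z v) := by
          refine (card_bd_erase_add z).trans (Nat.add_le_add_right (Finset.card_le_card ?_) _)
          intro v hv
          obtain ⟨⟨h1, h2⟩, d, hd, hdv⟩ := mem_bd.1 hv
          rw [Finset.mem_erase] at h1
          refine mem_bd.2 ⟨⟨hmemR.2 ⟨h1.1, h1.2, fun hvD => ?_⟩, h2⟩, d, hd, hdv⟩
          by_cases hdw : d = w
          · exact hwD ⟨hdw ▸ hd, v, hvD, hdw ▸ hdv.symm⟩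
          · exact hRD d (hD₂ hd) hdw v hvD hdv.symm
        omega
    · intro v hv hvw
      obtain ⟨h1, h2, h3⟩ := hmemR.1 hv
      have h4 := I.deg v h2
      have h5 : nb G E v ≤ nb G R v + ind (G.Adj z v) := by
        refine nb_erase_add.trans (Nat.add_le_add_right (Finset.card_le_card ?_) _)
        intro u hu
        rw [mem_nbs, Finset.mem_erase] at hu
        exact mem_nbs.2 ⟨hmemR.2 ⟨hu.1.1, hu.1.2, fun huD => hRD v hv hvw u huD hu.2.symm⟩, hu.2⟩
      have h6 := ind_mono (p := G.Adj z v) (q := v ∈ nbs G R z) fun h => mem_nbs.2 ⟨hv, h⟩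
      have h7 := ind_mono (p := v ∈ Y) (q := v ∈ Y ∩ R) fun h => Finset.mem_inter.2 ⟨h, hv⟩
      have h8 := ind_le_one (v ∈ X)
      omega
    · obtain ⟨b, hb, hbw⟩ := Finset.exists_mem_ne (show 1 < B.card by omega) w
      exact ⟨b, hBR hb, hbw⟩
  refine hAP ((stage1.add 2 stage2 (by omega) (by omega) ?_).le (by omega))
  rintro p q ⟨u, hu, v, hv, hp⟩ ⟨v', hv', y, hy, hq⟩
  rw [Finset.mem_inter] at hu hy
  have h := (hp.snoc hzD (mem_nbs.1 hv).2.symm).concat hq (by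
    rw [Finset.disjoint_left]
    intro a ha haR
    obtain ⟨h1, -, h3⟩ := hmemR.1 haR
    exact (Finset.mem_insert.1 ha).elim h1 h3) (mem_nbs.1 hv').2
  exact ⟨u, hu.1, y, hy.1, by
    rw [show p + q + 2 = p + 1 + q + 1 by omega]
    exact h.mono (Finset.union_subset (Finset.insert_subset hzE hDE) hRE)⟩

end theta

section nondegenerate

variable {k : ℕ} {E X Y T S A C : Finset V}

theorem nb_of_far {W : Finset V} {v : V} (h : ∀ w ∈ W, ¬G.Adj w v) : nb G W v = 0 :=
  nb_eq_zero.2 fun u hu huv => h u hu huv.symm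

theorem nb_dichotomy (A : Finset V) (v : V) :
    nb G A v = 0 ∨ (0 < nb G A v ∧ ind (∃ u ∈ A, G.Adj u v) = 1) := by
  rcases Nat.eq_zero_or_pos (nb G A v) with h | h
  · exact .inl h
  · obtain ⟨u, hu, huv⟩ := nb_pos.1 h
    exact .inr ⟨h, ind_pos ⟨u, hu, huv.symm⟩⟩

/-- Complete bipartite core, without edges inside its parts. -/
theorem bipartite_nondeg (I : Inst G k E X Y (T ∪ S)) (hT : T ⊆ X) (hTS : Cmpl G T S)
    (hcard : S.card + 1 ≤ T.card)
    (hvX : ∀ v ∈ E, v ∉ T ∪ S → v ∈ X → nb G T v = 0 ∧ ∃ s ∈ S, ¬G.Adj s v)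
    (hvT : ∀ v ∈ E, v ∉ T ∪ S → nb G T v ≤ S.card + 1 ∧ (0 < nb G T v → nb G S v = 0))
    (hside : (∀ v ∈ E, v ∉ T ∪ S → v ∉ X) ∨ (Full G k E X Y ∧ 3 ≤ k))
    (hY : ¬Y ⊆ T ∪ S) : AP (HasLen G E X Y) k := by
  obtain ⟨D, Yd, c, P⟩ := exists_minPocket (G := G) I.hF I.hY hY
  have hDE : ∀ v ∈ D, v ∈ E ∧ v ∉ T ∪ S := fun v hv => Finset.mem_sdiff.1 (P.sub hv)
  by_cases hDT : ∃ w ∈ T, ∃ v ∈ D, G.Adj w v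
  · refine I.of_near P (W := T) (l := S.card + 1) (by omega)
      ⟨0, 2, .inr rfl, fun i hi w hw => ?_⟩ hDT fun v hv => ?_
    · by_cases hi0 : i = 0
      · subst hi0; exact ⟨w, hT hw, by simpa using Pth.nil (Finset.mem_union_left _ hw)⟩
      obtain ⟨u, hu, hne⟩ := Finset.exists_mem_ne (show 1 < T.card by omega) w
      refine ⟨u, hT hu, ?_⟩
      rw [show 0 + i * 2 = 2 * i by omega]
      exact pth_even hTS hu hw hne (by omega) (by omega) (by omega)
    · obtain ⟨h1, h2⟩ := hDE v hv
      have h3 := nb_union_le (G := G) T S v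
      obtain ⟨h4, h5⟩ := hvT v h1 h2
      have h6 := nb_le_card (G := G) S v
      by_cases hX : v ∈ X
      · obtain ⟨h7, h8⟩ := hvX v h1 h2 hX
        have := nb_add_one_le h8
        rw [ind_pos hX]; omega
      · rw [ind_neg hX]
        rcases nb_dichotomy (G := G) T v with h | ⟨h, h'⟩
        · omega
        · have := h5 h; omega
  push Not at hDT
  by_cases hDS : ∃ w ∈ S, ∃ v ∈ D, G.Adj w v
  · have hS : 0 < S.card := by obtain ⟨w, hw, -⟩ := hDS; exact Finset.card_pos.2 ⟨w, hw⟩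
    by_cases hDX : 2 ≤ S.card ∨ ∀ v ∈ D, v ∉ X
    · refine I.of_near P (W := S) (l := S.card) (by omega)
        ⟨1, 2, .inr rfl, fun i hi w hw => ?_⟩ hDS fun v hv => ?_
      · obtain ⟨b, hb⟩ := Finset.card_pos.1 (show 0 < T.card by omega)
        refine ⟨b, hT hb, ?_⟩
        rw [show 1 + i * 2 = 2 * i + 1 by omega]
        exact pth_odd hTS hb hw (by omega) hi
      · obtain ⟨h1, h2⟩ := hDE v hv
        have h3 := nb_union_le (G := G) T S v
        have h4 := nb_of_far fun w hw => hDT w hw v hv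
        have h6 := nb_le_card (G := G) S v
        by_cases hX : v ∈ X
        · obtain ⟨h7, h8⟩ := hvX v h1 h2 hX
          have := nb_add_one_le h8
          have : 2 ≤ S.card := hDX.resolve_right fun h => h v hv hX
          rw [ind_pos hX]
          rcases nb_dichotomy (G := G) S v with h | ⟨h, h'⟩ <;> omega
        · rw [ind_neg hX]
          rcases nb_dichotomy (G := G) S v with h | ⟨h, h'⟩ <;> omega
    · push Not at hDX
      obtain ⟨hS1, x, hxD, hxX⟩ := hDX
      rcases hside with h | ⟨hfull, hk⟩
      · exact absurd hxX (h x (hDE x hxD).1 (hDE x hxD).2)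
      obtain ⟨z, rfl⟩ := Finset.card_eq_one.1 (show S.card = 1 by omega)
      have hins : T ∪ {z} = insert z T := by ext; simp
      obtain ⟨b, hb⟩ := Finset.card_pos.1 (show 0 < T.card by omega)
      obtain ⟨w, hw, a, ha, hwa⟩ := hDS
      rw [Finset.mem_singleton] at hw
      subst hw
      have hsub := P.sub
      have hout := P.out
      have hlive := P.live x hxD
      have hFE := I.hF
      rw [hins] at hsub hout hlive hFE
      rw [Finset.card_singleton] at hcard
      refine hfull.theta hk (B := T) (f := 1) (fun b hb => (hTS b hb w (by simp)).symm)
        (by omega) hFE ⟨b, hT hb, .adj (hTS b hb w (by simp)) (by simp [hb]) (by simp)⟩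
        hsub ⟨x, hxD, hxX⟩ ⟨a, ha, hwa⟩ (fun v hv b hb h => hDT b hb v hv h.symm) hout
        ⟨x, hxD, hlive⟩
  push Not at hDS
  refine I.of_far P fun w hw v hv => ?_
  rcases Finset.mem_union.1 hw with hw | hw
  exacts [hDT w hw v hv, hDS w hw v hv]

/-- Complete bipartite core, with an edge inside the part `S`. -/
theorem edge_nondeg (I : Inst G k E X Y (T ∪ S)) (hT : T ⊆ X) (hTS : Cmpl G T S)
    (hcard : S.card ≤ T.card) (hedge : HasEdge G S)
    (hvX : ∀ v ∈ E, v ∉ T ∪ S → v ∈ X → nb G T v = 0)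
    (hvT : ∀ v ∈ E, v ∉ T ∪ S → nb G T v ≤ S.card)
    (hvS : ∀ v ∈ E, v ∉ T ∪ S → S.card ≤ nb G S v → nb G T v < S.card)
    (hY : ¬Y ⊆ T ∪ S) : AP (HasLen G E X Y) k := by
  obtain ⟨D, Yd, c, P⟩ := exists_minPocket (G := G) I.hF I.hY hY
  have hDE : ∀ v ∈ D, v ∈ E ∧ v ∉ T ∪ S := fun v hv => Finset.mem_sdiff.1 (P.sub hv)
  obtain ⟨s, hs, s', hs', hss⟩ := hedge
  have hS2 : 2 ≤ S.card := Finset.one_lt_card.2 ⟨s, hs, s', hs', hss.ne⟩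
  obtain ⟨b, hb⟩ := Finset.card_pos.1 (show 0 < T.card by omega)
  have hiso : ∀ v, ¬G.Adj s v → ¬G.Adj s' v → nb G S v + 2 ≤ S.card := by
    intro v h h'
    have : nbs G S v ⊆ (S.erase s).erase s' := fun u hu => by
      rw [mem_nbs] at hu
      simp only [Finset.mem_erase]
      exact ⟨fun e => h' (e ▸ hu.2.symm), fun e => h (e ▸ hu.2.symm), hu.1⟩
    have := Finset.card_le_card this
    rw [Finset.card_erase_of_mem (Finset.mem_erase.2 ⟨hss.ne', hs'⟩),
      Finset.card_erase_of_mem hs] at this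
    change nb G S v ≤ _ at this
    omega
  classical
  set S₁ := S.filter fun w => ∃ w' ∈ S, G.Adj w' w with hS₁
  have hmem : ∀ {w}, w ∈ S₁ ↔ w ∈ S ∧ ∃ w' ∈ S, G.Adj w' w := by simp [hS₁]
  have hsS₁ : s ∈ S₁ := hmem.2 ⟨hs, s', hs', hss.symm⟩
  have hsS₁' : s' ∈ S₁ := hmem.2 ⟨hs', s, hs, hss⟩
  have hiso' : ∀ v, (ind (∃ w ∈ S₁, G.Adj w v) = 1) ∨ nb G S v + 2 ≤ S.card := by
    intro v
    by_cases h : ∃ w ∈ S₁, G.Adj w v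
    · exact .inl (ind_pos h)
    · push Not at h
      exact .inr (hiso v (h s hsS₁) (h s' hsS₁'))
  by_cases hDS₁ : ∃ w ∈ S₁, ∃ v ∈ D, G.Adj w v
  · refine I.of_near P (W := S₁) (l := 2 * S.card - 1) (by omega)
      ⟨1, 1, .inl rfl, fun i hi w hw => ⟨b, hT hb, ?_⟩⟩ hDS₁ fun v hv => ?_
    · obtain ⟨hwS, w', hw', hww⟩ := hmem.1 hw
      rcases Nat.even_or_odd' i with ⟨j, rfl | rfl⟩
      · rw [show 1 + 2 * j * 1 = 2 * j + 1 by omega]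
        exact pth_odd hTS hb hwS (by omega) (by omega)
      · rw [show 1 + (2 * j + 1) * 1 = 2 * j + 2 by omega]
        exact pth_via_edge hTS hb hw' hwS hww (by omega) (by omega)
    · obtain ⟨h1, h2⟩ := hDE v hv
      have h3 := nb_union_le (G := G) T S v
      have h4 := hvT v h1 h2
      have h5 := hvS v h1 h2
      have h6 := nb_le_card (G := G) S v
      have h8 := hiso' v
      by_cases hX : v ∈ X
      · have h7 := hvX v h1 h2 hX
        rw [ind_pos hX]; omega
      · rw [ind_neg hX]; omega
  push Not at hDS₁
  by_cases hDT : ∃ w ∈ T, ∃ v ∈ D, G.Adj w v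
  · refine I.of_near P (W := T) (l := 2 * S.card - 2) (by omega)
      ⟨2, 1, .inl rfl, fun i hi w hw => ?_⟩ hDT fun v hv => ?_
    · obtain ⟨u, hu, hp⟩ := pth_edge_back hTS hcard ⟨s, hs, s', hs', hss⟩ hw (n := 2 + i * 1)
        (by omega) (by omega)
      exact ⟨u, hT hu, hp⟩
    · obtain ⟨h1, h2⟩ := hDE v hv
      have h3 := nb_union_le (G := G) T S v
      have h4 := hvT v h1 h2
      have h8 := hiso v (hDS₁ s hsS₁ v hv) (hDS₁ s' hsS₁' v hv)
      have h9 := nb_dichotomy (G := G) T v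
      by_cases hX : v ∈ X
      · have h7 := hvX v h1 h2 hX
        rw [ind_pos hX]; omega
      · rw [ind_neg hX]; omega
  push Not at hDT
  by_cases hDS : ∃ w ∈ S, ∃ v ∈ D, G.Adj w v
  · refine I.of_near P (W := S) (l := S.card) (by omega)
      ⟨1, 2, .inr rfl, fun i hi w hw => ⟨b, hT hb, ?_⟩⟩ hDS fun v hv => ?_
    · rw [show 1 + i * 2 = 2 * i + 1 by omega]
      exact pth_odd hTS hb hw (by omega) hi
    · have h3 := nb_union_le (G := G) T S v
      have h4 := nb_of_far fun w hw => hDT w hw v hv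
      have h8 := hiso v (hDS₁ s hsS₁ v hv) (hDS₁ s' hsS₁' v hv)
      have h9 := ind_le_one (v ∈ X)
      omega
  push Not at hDS
  refine I.of_far P fun w hw v hv => ?_
  rcases Finset.mem_union.1 hw with hw | hw
  exacts [hDT w hw v hv, hDS w hw v hv]

/-- Complete bipartite core with parts `T` and `A ∪ C`, where the clique `C` is complete to `A`. -/
theorem clique_core_nondeg (I : Inst G k E X Y (T ∪ (A ∪ C))) (hT : T ⊆ X) (hTA : Cmpl G T A)
    (hTC : Cmpl G T C) (hAC : Cmpl G A C) (hC : Clq G C) (hCne : C.Nonempty) (hTne : T.Nonempty)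
    (hcond : A.card ≤ T.card ∨ (A.card ≤ T.card + 1 ∧ HasEdge G A))
    (hle : T.card ≤ A.card + C.card) (hW2 : 2 ≤ A.card + C.card)
    (huniv : ∀ v ∈ E, v ∉ T ∪ (A ∪ C) → ∃ u ∈ T ∪ (A ∪ C), ¬G.Adj u v)
    (hvX : ∀ v ∈ E, v ∉ T ∪ (A ∪ C) → v ∈ X → nb G T v = 0)
    (hside : 2 ≤ T.card ∨ (Full G k E X Y ∧ 3 ≤ k ∧
      ∀ v ∈ X, v ∉ T ∪ (A ∪ C) → ∃ u ∈ A ∪ C, ¬G.Adj u v))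
    (hY : ¬Y ⊆ T ∪ (A ∪ C)) : AP (HasLen G E X Y) k := by
  obtain ⟨D, Yd, c, P⟩ := exists_minPocket (G := G) I.hF I.hY hY
  have hDE : ∀ v ∈ D, v ∈ E ∧ v ∉ T ∪ (A ∪ C) := fun v hv => Finset.mem_sdiff.1 (P.sub hv)
  have hWcard : (A ∪ C).card = A.card + C.card := Finset.card_union_of_disjoint hAC.disj
  have hTW : Cmpl G T (A ∪ C) := fun a ha b hb => by
    rcases Finset.mem_union.1 hb with hb | hb
    exacts [hTA a ha b hb, hTC a ha b hb]
  have hTc := Finset.card_pos.2 hTne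
  by_cases hDW : ∃ w ∈ A ∪ C, ∃ v ∈ D, G.Adj w v
  · refine I.of_near P (W := A ∪ C) (l := A.card + C.card + T.card - 1) (by omega)
      ⟨1, 1, .inl rfl, fun i hi w hw => ?_⟩ hDW fun v hv => ?_
    · obtain ⟨u, hu, hp⟩ := pth_clique (1 + i * 1) hTA hTC hAC hC hCne hTne hcond (by omega) hw
        (by omega) (by omega)
      exact ⟨u, hT hu, hp⟩
    · obtain ⟨h1, h2⟩ := hDE v hv
      have h3 := nb_union_le (G := G) T (A ∪ C) v
      have h6 := nb_le_card (G := G) (A ∪ C) v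
      have h7 := nb_le_card (G := G) T v
      have h8 := nb_dichotomy (G := G) (A ∪ C) v
      by_cases hX : v ∈ X
      · have h7 := hvX v h1 h2 hX
        rw [ind_pos hX]
        rcases hside with h9 | ⟨-, -, h9⟩
        · omega
        · have := nb_add_one_le (h9 v hX h2)
          omega
      · have h9 := nb_add_one_le (huniv v h1 h2)
        rw [Finset.card_union_of_disjoint hTW.disj] at h9
        rw [ind_neg hX]; omega
  push Not at hDW
  by_cases hDT : ∃ w ∈ T, ∃ v ∈ D, G.Adj w v
  · by_cases hDX : 2 ≤ T.card ∨ ∀ v ∈ D, v ∉ X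
    · refine I.of_near P (W := T) (l := T.card) (by omega)
        ⟨0, 2, .inr rfl, fun i hi w hw => ?_⟩ hDT fun v hv => ?_
      · by_cases hi0 : i = 0
        · subst hi0; exact ⟨w, hT hw, by simpa using Pth.nil (Finset.mem_union_left _ hw)⟩
        obtain ⟨u, hu, hne⟩ := Finset.exists_mem_ne (show 1 < T.card by omega) w
        refine ⟨u, hT hu, ?_⟩
        rw [show 0 + i * 2 = 2 * i by omega]
        exact pth_even hTW hu hw hne (by omega) (by omega) (by omega)
      · obtain ⟨h1, h2⟩ := hDE v hv
        have h3 := nb_union_le (G := G) T (A ∪ C) v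
        have h4 := nb_of_far fun w hw => hDW w hw v hv
        have h7 := nb_le_card (G := G) T v
        have h8 := nb_dichotomy (G := G) T v
        by_cases hX : v ∈ X
        · have h7 := hvX v h1 h2 hX
          have : 2 ≤ T.card := hDX.resolve_right fun h => h v hv hX
          rw [ind_pos hX]; omega
        · rw [ind_neg hX]; omega
    · push Not at hDX
      obtain ⟨hT1, x, hxD, hxX⟩ := hDX
      rcases hside with h | ⟨hfull, hk, -⟩
      · omega
      obtain ⟨z, rfl⟩ := Finset.card_eq_one.1 (show T.card = 1 by omega)
      obtain ⟨w, hw, a, ha, hwa⟩ := hDT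
      rw [Finset.mem_singleton] at hw
      subst hw
      have hsub := P.sub
      have hout := P.out
      have hlive := P.live x hxD
      have hFE := I.hF
      have hins : {w} ∪ (A ∪ C) = insert w (A ∪ C) := rfl
      rw [hins] at hsub hout hlive hFE
      refine hfull.theta hk (B := A ∪ C) (f := 0) (fun b hb => hTW w (by simp) b hb)
        (by omega) hFE ⟨w, hT (by simp), .nil (by simp)⟩
        hsub ⟨x, hxD, hxX⟩ ⟨a, ha, hwa⟩ (fun v hv b hb h => hDW b hb v hv h.symm) hout
        ⟨x, hxD, hlive⟩
  push Not at hDT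
  refine I.of_far P fun w hw v hv => ?_
  rcases Finset.mem_union.1 hw with hw | hw
  exacts [hDT w hw v hv, hDW w hw v hv]

end nondegenerate

section sides

variable {k : ℕ} {E X Y T S A C F₀ : Finset V}

theorem Cmpl.union {T A C : Finset V} (h : Cmpl G T A) (h' : Cmpl G T C) : Cmpl G T (A ∪ C) :=
  fun a ha b hb => by
    rcases Finset.mem_union.1 hb with hb | hb
    exacts [h a ha b hb, h' a ha b hb]

theorem Cmpl.insert_right {T A : Finset V} {v : V} (h : Cmpl G T A) (h' : ∀ u ∈ T, G.Adj u v) :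
    Cmpl G T (insert v A) := fun a ha b hb => by
  rcases Finset.mem_insert.1 hb with rfl | hb
  exacts [h' a ha, h a ha b hb]

theorem Clq.insert {C : Finset V} {v : V} (h : Clq G C) (h' : ∀ u ∈ C, G.Adj u v) :
    Clq G (insert v C) := fun a ha b hb hab => by
  rcases Finset.mem_insert.1 ha with rfl | ha' <;> rcases Finset.mem_insert.1 hb with rfl | hb'
  exacts [absurd rfl hab, (h' b hb').symm, h' a ha', h a ha' b hb' hab]

/-- An independent set meets only one side of a complete bipartite core. -/
theorem Cmpl.ind_subset (h : Cmpl G T S) (hY : Ind G Y) (hYF : Y ⊆ T ∪ S) : Y ⊆ T ∨ Y ⊆ S := by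
  by_contra! hcon
  obtain ⟨h1, h2⟩ := hcon
  obtain ⟨y, hy, hyT⟩ := Finset.not_subset.1 h1
  obtain ⟨z, hz, hzS⟩ := Finset.not_subset.1 h2
  have hyS := (Finset.mem_union.1 (hYF hy)).resolve_left hyT
  have hzT := (Finset.mem_union.1 (hYF hz)).resolve_right hzS
  exact hY z hz y hy (h z hzT y hyS)

theorem exists_grown_clique (hFE : T ∪ (A ∪ C) ⊆ E)
    (hTC : Cmpl G T C) (hAC : Cmpl G A C) (hC : Clq G C) :
    ∃ C', C ⊆ C' ∧ T ∪ (A ∪ C') ⊆ E ∧ Cmpl G T C' ∧ Cmpl G A C' ∧ Clq G C' ∧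
      ∀ v ∈ E, v ∉ T ∪ (A ∪ C') → ∃ u ∈ T ∪ (A ∪ C'), ¬G.Adj u v := by
  classical
  have hTE : T ⊆ E := Finset.subset_union_left.trans hFE
  have hAE : A ⊆ E := (Finset.subset_union_left.trans Finset.subset_union_right).trans hFE
  have hCE : C ⊆ E := (Finset.subset_union_right.trans Finset.subset_union_right).trans hFE
  obtain ⟨C', hC', hmax⟩ := Finset.exists_max_image
    (E.powerset.filter fun C' => C ⊆ C' ∧ Cmpl G T C' ∧ Cmpl G A C' ∧ Clq G C') Finset.card
    ⟨C, by simp [hTC, hAC, hC, hCE]⟩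
  simp only [Finset.mem_filter, Finset.mem_powerset] at hC' hmax
  obtain ⟨h1, h2, h3, h4, h5⟩ := hC'
  refine ⟨C', h2, Finset.union_subset hTE (Finset.union_subset hAE h1), h3, h4, h5,
    fun v hv hvF => ?_⟩
  by_contra! hcon
  have hvC : v ∉ C' := fun h => hvF (by simp [h])
  have := hmax (insert v C') ⟨Finset.insert_subset hv h1, h2.trans (Finset.subset_insert _ _),
    h3.insert_right fun u hu => hcon u (by simp [hu]),
    h4.insert_right fun u hu => hcon u (by simp [hu]), h5.insert fun u hu => hcon u (by simp [hu])⟩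
  rw [Finset.card_insert_of_notMem hvC] at this
  omega

/-- Enlarging the clique part of a core until it becomes nondegenerate. -/
theorem clique_core_grow (I : Inst G k E X Y F₀) (hF₀ : F₀ ⊆ T ∪ (A ∪ C))
    (hFE : T ∪ (A ∪ C) ⊆ E) (hX : Ind G X) (hT : T ⊆ X) (hTA : Cmpl G T A)
    (hTC : Cmpl G T C) (hAC : Cmpl G A C) (hC : Clq G C) (hCne : C.Nonempty) (hT2 : 2 ≤ T.card)
    (hcond : A.card ≤ T.card ∨ (A.card ≤ T.card + 1 ∧ HasEdge G A))
    (hle : T.card ≤ A.card + C.card) :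
    AP (HasLen G E X Y) k ∨ ∃ C', C ⊆ C' ∧ T ∪ (A ∪ C') ⊆ E ∧ Cmpl G T C' ∧ Cmpl G A C' ∧
      Clq G C' ∧ Y ⊆ T ∪ (A ∪ C') := by
  obtain ⟨C', h1, h2, h3, h4, h5, h6⟩ := exists_grown_clique hFE hTC hAC hC
  by_cases hY : Y ⊆ T ∪ (A ∪ C')
  · exact .inr ⟨C', h1, h2, h3, h4, h5, hY⟩
  have hc := Finset.card_le_card h1
  have hsub : T ∪ (A ∪ C) ⊆ T ∪ (A ∪ C') :=
    Finset.union_subset_union subset_rfl (Finset.union_subset_union subset_rfl h1)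
  refine .inl (clique_core_nondeg (I.mono (hF₀.trans hsub) h2) hT hTA h3 h4 h5 (hCne.mono h1)
    (Finset.card_pos.1 (by omega)) hcond (by omega) (by omega) h6
    (fun v _ _ hvX => nb_eq_zero.2 fun u hu huv => hX v hvX u (hT hu) huv) (.inl hT2) hY)

/-- Both roots attach to the same two vertices. -/
theorem Full.special_two (I : Full G k E X X) (hk : 3 ≤ k) (hX : Ind G X) (h2 : X.card = 2) :
    AP (HasLen G E X X) k := by
  obtain ⟨b, b', hbb, rfl⟩ := Finset.card_eq_two.1 h2
  have hb : b ∈ ({b, b'} : Finset V) := by simp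
  have hb' : b' ∈ ({b, b'} : Finset V) := by simp
  have J := (I.inst I.hX ⟨b, hb⟩).erase hb' subset_rfl
  have hE' : ({b, b'} : Finset V).erase b' = {b} := by
    ext x; simp only [Finset.mem_erase, Finset.mem_insert, Finset.mem_singleton]
    constructor
    · tauto
    · rintro rfl; exact ⟨hbb, .inl rfl⟩
  rw [hE'] at J
  have J' := J.symm.erase (y := b) (by simp) subset_rfl
  have hd := I.deg b (I.hX hb)
  rw [ind_pos hb] at hd
  obtain ⟨v, hv, hvb⟩ := nb_pos.1 (show 0 < nb G E b by omega)
  have hne : ((E.erase b').erase b).Nonempty := by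
    refine ⟨v, ?_⟩
    simp only [Finset.mem_erase]
    exact ⟨hvb.ne', fun h => hX b hb b' hb' (h ▸ hvb), hv⟩
  have h1 := Inst.run (by simpa using J') hne
  have h3 : AP (HasLen G (E.erase b') (nbs G (E.erase b') b') {b}) k :=
    h1.shift 1 (hasLen_of_erase (J.hX (by simp)) (Finset.mem_singleton_self b))
  have h4 := h3.hasLen_symm
  rw [← hE'] at h4
  exact I.of_erase hb' h4

end sides

section outcomes

variable {k : ℕ} {E X Y T S A C : Finset V}

theorem nbs_erase_subset {E X F : Finset V} {y : V} (hX : Ind G X) (hy : y ∈ X)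
    (h : nbs G (E.erase y) y ⊆ X.erase y ∪ F) : nbs G E y ⊆ F := by
  intro v hv
  have hadj := (mem_nbs.1 hv).2
  have := h (mem_nbs.2 ⟨Finset.mem_erase.2 ⟨hadj.ne', (mem_nbs.1 hv).1⟩, hadj⟩)
  exact (Finset.mem_union.1 this).resolve_left fun h => hX y hy v (Finset.mem_of_mem_erase h) hadj

theorem erase_union_of_disjoint {X F : Finset V} {y : V} (h : y ∉ F) :
    (X ∪ F).erase y = X.erase y ∪ F := by
  rw [Finset.erase_union_distrib, Finset.erase_eq_of_notMem h]

theorem Full.side_bipartite (I : Full G k E X Y) (hk : 3 ≤ k) (hXi : Ind G X) (hYi : Ind G Y)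
    (hT : T ⊆ X) (hSE : S ⊆ E) (hTS : Cmpl G T S) (hcard : S.card + 1 ≤ T.card)
    (hTall : ∀ v ∈ X, v ∉ T → ∃ s ∈ S, ¬G.Adj s v)
    (hvT : ∀ v ∈ E, v ∉ X → v ∉ S → nb G T v ≤ S.card + 1)
    (htri : ∀ b ∈ X, ∀ s ∈ E, ∀ s' ∈ E, G.Adj b s → G.Adj b s' → ¬G.Adj s s') :
    AP (HasLen G E X Y) k ∨ Y.card < X.card ∨ (Y ⊆ X ∧ (X = Y → AP (HasLen G E X Y) k)) := by
  have hTc := Finset.card_le_card hT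
  have hind : ∀ v ∈ X, nb G T v = 0 := fun v hvX =>
    nb_eq_zero.2 fun u hu huv => hXi v hvX u (hT hu) huv
  by_cases hY : Y ⊆ T ∪ S
  swap
  · refine .inl (bipartite_nondeg (I.inst (Finset.union_subset (hT.trans I.hX) hSE)
      ((Finset.card_pos.1 (show 0 < T.card by omega)).mono Finset.subset_union_left)) hT hTS hcard
      (fun v _ hvF hvX => ⟨hind v hvX, hTall v hvX fun h => hvF (Finset.mem_union_left _ h)⟩)
      (fun v hv hvF => ?_) (.inr ⟨I, hk⟩) hY)
    constructor
    · by_cases hvX : v ∈ X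
      · rw [hind v hvX]; omega
      · exact hvT v hv hvX fun h => hvF (Finset.mem_union_right _ h)
    · intro hpos
      obtain ⟨b, hb, hvb⟩ := nb_pos.1 hpos
      exact nb_eq_zero.2 fun s hs hvs =>
        htri b (hT hb) v hv s (hSE hs) hvb.symm (hTS b hb s hs) hvs
  rcases hTS.ind_subset hYi hY with hYT | hYS
  swap
  · have := Finset.card_le_card hYS
    exact .inr (.inl (by omega))
  refine .inr (.inr ⟨hYT.trans hT, ?_⟩)
  rintro rfl
  obtain rfl := Finset.Subset.antisymm hT hYT
  rcases (show T.card ≤ 1 ∨ T.card = 2 ∨ 3 ≤ T.card by omega) with h1 | h2 | h3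
  · exact I.card_one (by omega) h1
  · exact I.special_two hk hXi h2
  obtain ⟨y, hy⟩ := Finset.card_pos.1 (show 0 < T.card by omega)
  obtain ⟨S', hS', hS'c⟩ := Finset.exists_subset_card_eq (Nat.min_le_left S.card (T.card - 2))
  have hyS : y ∉ S' := fun h => hXi y hy y hy (hTS y hy y (hS' h))
  have hTc := Finset.card_erase_add_one hy
  have hS'E := hS'.trans hSE
  have hFE := Finset.union_subset I.hX hS'E
  have J := I.erase hFE hy Finset.subset_union_left
  rw [erase_union_of_disjoint hyS] at J
  by_cases hN : nbs G (E.erase y) y ⊆ T.erase y ∪ S'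
  swap
  · refine I.of_erase hy (bipartite_nondeg J subset_rfl
      (hTS.mono (Finset.erase_subset _ _) hS') (by omega) (fun v _ hvF hvX => ?_)
      (fun v hv hvF => ?_) (.inl fun v _ hvF hvX => ?_) hN)
    · exact absurd (Finset.mem_union_left _ hvX) hvF
    · have hvT' : v ∉ T := fun h => hvF (Finset.mem_union_left _
        (Finset.mem_erase.2 ⟨(Finset.mem_erase.1 hv).1, h⟩))
      have hvE := Finset.mem_of_mem_erase hv
      constructor
      · have h4 := nb_le_card (G := G) (T.erase y) v
        have h5 := nb_mono (G := G) (v := v) (Finset.erase_subset y T)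
        by_cases hc : S'.card = T.card - 2
        · omega
        · obtain rfl : S' = S := Finset.eq_of_subset_of_card_le hS' (by omega)
          have := hvT v hvE hvT' fun h => hvF (Finset.mem_union_right _ h)
          omega
      · intro hpos
        obtain ⟨b, hb, hvb⟩ := nb_pos.1 hpos
        have hb' := Finset.mem_of_mem_erase hb
        exact nb_eq_zero.2 fun s hs hvs =>
          htri b hb' v hvE s (hS'E hs) hvb.symm (hTS b hb' s (hS' hs)) hvs
    · exact absurd (Finset.mem_union_left _ hvX) hvF
  have hN' := Finset.card_le_card (nbs_erase_subset hXi hy hN)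
  change nb G E y ≤ _ at hN'
  have hd := I.deg y (I.hX hy)
  rw [ind_pos hy] at hd
  refine ⟨0, 2, .inr rfl, fun i hi => ?_⟩
  obtain ⟨u, hu, huy⟩ := Finset.exists_mem_ne (show 1 < T.card by omega) y
  rcases Nat.eq_zero_or_pos i with rfl | hi0
  · exact ⟨y, hy, y, hy, by simpa using Pth.nil (I.hX hy)⟩
  · refine ⟨u, hu, y, hy, ?_⟩
    rw [show 0 + i * 2 = 2 * i by omega]
    exact (pth_even (hTS.mono subset_rfl hS') hu hy huy hi0 (by omega) (by omega)).mono hFE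

theorem Full.special_clique_core (I : Full G k E X X) (hk : 3 ≤ k) (hXi : Ind G X) {y : V}
    (hy : y ∈ X) (hX3 : 3 ≤ X.card) (hFE : X.erase y ∪ (A ∪ C) ⊆ E.erase y)
    (hTA : Cmpl G (X.erase y) A) (hTC : Cmpl G (X.erase y) C) (hAC : Cmpl G A C) (hC : Clq G C)
    (hCne : C.Nonempty)
    (hcond : A.card + 1 ≤ X.card ∨ (A.card ≤ X.card ∧ HasEdge G A))
    (hle : X.card ≤ A.card + C.card + 1) {F₀ : Finset V}
    (J : Inst G k (E.erase y) (X.erase y) (nbs G (E.erase y) y) F₀)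
    (hF₀ : F₀ ⊆ X.erase y ∪ (A ∪ C)) : AP (HasLen G E X X) k := by
  have hTc := Finset.card_erase_add_one hy
  have hcond' : A.card ≤ (X.erase y).card ∨ (A.card ≤ (X.erase y).card + 1 ∧ HasEdge G A) :=
    hcond.imp (fun h => by omega) fun h => ⟨by omega, h.2⟩
  rcases clique_core_grow J hF₀ hFE
    (fun a ha b hb => hXi a (Finset.mem_of_mem_erase ha) b (Finset.mem_of_mem_erase hb)) subset_rfl
    hTA hTC hAC hC hCne (by omega) hcond' (by omega) with h | ⟨C', h1, h2, h3, h4, h5, hN⟩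
  · exact I.of_erase hy h
  have hN' := nbs_erase_subset hXi hy hN
  have hN'' := Finset.card_le_card hN'
  change nb G E y ≤ _ at hN''
  rw [Finset.card_union_of_disjoint h4.disj] at hN''
  have hd := I.deg y (I.hX hy)
  rw [ind_pos hy] at hd
  obtain ⟨w, hw, hyw⟩ := nb_pos.1 (show 0 < nb G E y by omega)
  have hwF := hN' (mem_nbs.2 ⟨hw, hyw⟩)
  have := Finset.card_le_card h1
  refine ⟨2, 1, .inl rfl, fun i hi => ?_⟩
  obtain ⟨u, hu, hp⟩ := pth_clique (1 + i) hTA h3 h4 h5 (hCne.mono h1)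
    (Finset.card_pos.1 (by omega)) hcond' (by omega) hwF (by omega) (by omega)
  refine ⟨u, Finset.mem_of_mem_erase hu, y, hy, ?_⟩
  rw [show 2 + i * 1 = 1 + i + 1 by omega]
  exact ((hp.mono h2).snoc (by simp) hyw.symm).mono (by rw [Finset.insert_erase (I.hX hy)])

theorem Full.side_edge (I : Full G k E X Y) (hk : 3 ≤ k) (hXi : Ind G X) (hYi : Ind G Y)
    (hT : T ⊆ X) (hSE : S ⊆ E) (hTS : Cmpl G T S) (hcard : S.card ≤ T.card) (hedge : HasEdge G S)
    (hvT : ∀ v ∈ E, v ∉ T ∪ S → nb G T v ≤ S.card)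
    (hvS : ∀ v ∈ E, v ∉ T ∪ S → S.card ≤ nb G S v → nb G T v < S.card) :
    AP (HasLen G E X Y) k ∨ Y.card < X.card ∨ (Y ⊆ X ∧ (X = Y → AP (HasLen G E X Y) k)) := by
  have hTc := Finset.card_le_card hT
  have hind : ∀ v ∈ X, nb G T v = 0 := fun v hvX =>
    nb_eq_zero.2 fun u hu huv => hXi v hvX u (hT hu) huv
  by_cases hY : Y ⊆ T ∪ S
  swap
  · refine .inl (edge_nondeg (I.inst (Finset.union_subset (hT.trans I.hX) hSE) ?_) hT hTS hcard
      hedge (fun v _ hvF hvX => hind v hvX) hvT hvS hY)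
    obtain ⟨s, hs, -⟩ := hedge
    exact ⟨s, by simp [hs]⟩
  rcases hTS.ind_subset hYi hY with hYT | hYS
  swap
  · have := Finset.card_le_card hYS
    refine .inr (.inl ?_)
    by_contra hcon
    obtain rfl := Finset.eq_of_subset_of_card_le hYS (by omega)
    obtain ⟨a, ha, b, hb, hab⟩ := hedge
    exact hYi a ha b hb hab
  refine .inr (.inr ⟨hYT.trans hT, ?_⟩)
  rintro rfl
  obtain rfl := Finset.Subset.antisymm hT hYT
  rcases (show T.card ≤ 1 ∨ T.card = 2 ∨ 3 ≤ T.card by omega) with h1 | h2 | h3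
  · exact I.card_one (by omega) h1
  · exact I.special_two hk hXi h2
  obtain ⟨y, hy⟩ := Finset.card_pos.1 (show 0 < T.card by omega)
  obtain ⟨s, hs, s', hs', hss⟩ := hedge
  have hpair : ({s, s'} : Finset V) ⊆ S := by
    intro x hx; simp only [Finset.mem_insert, Finset.mem_singleton] at hx
    rcases hx with rfl | rfl <;> assumption
  have h2S : 2 ≤ S.card := (Finset.card_pair hss.ne).symm.le.trans (Finset.card_le_card hpair)
  obtain ⟨S', hpS', hS', hS'c⟩ := Finset.exists_subsuperset_card_eq (n := min S.card (T.card - 1))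
    hpair (by rw [Finset.card_pair hss.ne]; omega) (by omega)
  have hyS : y ∉ S' := fun h => hXi y hy y hy (hTS y hy y (hS' h))
  have hTc := Finset.card_erase_add_one hy
  have hS'E := hS'.trans hSE
  have hFE := Finset.union_subset I.hX hS'E
  have hTS' := hTS.mono (Finset.erase_subset y _) hS'
  have hedge' : HasEdge G S' := ⟨s, hpS' (by simp), s', hpS' (by simp), hss⟩
  have J := I.erase hFE hy Finset.subset_union_left
  rw [erase_union_of_disjoint hyS] at J
  have hmem : ∀ v ∈ E.erase y, v ∉ T.erase y ∪ S' → v ∉ T := fun v hv hvF h =>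
    hvF (Finset.mem_union_left _ (Finset.mem_erase.2 ⟨(Finset.mem_erase.1 hv).1, h⟩))
  by_cases huniv : ∃ v ∈ E.erase y, v ∉ T.erase y ∪ S' ∧ S'.card ≤ nb G S' v ∧
      S'.card ≤ nb G (T.erase y) v
  · obtain ⟨v, hv, hvF, hvS', hvT'⟩ := huniv
    have hvT0 := hmem v hv hvF
    have h5 := nb_mono (G := G) (v := v) (Finset.erase_subset y T)
    have hc : S'.card = T.card - 1 := by
      by_contra hc
      obtain rfl : S' = S := Finset.eq_of_subset_of_card_le hS' (by omega)
      have := hvS v (Finset.mem_of_mem_erase hv) (fun h => (Finset.mem_union.1 h).elim hvT0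
        fun h => hvF (Finset.mem_union_right _ h)) hvS'
      omega
    refine I.special_clique_core hk hXi hy h3 (A := S') (C := {v}) ?_ hTS' ?_ ?_ ?_ (by simp)
      (.inr ⟨by omega, hedge'⟩) (by rw [Finset.card_singleton]; omega) J
      (Finset.union_subset_union subset_rfl Finset.subset_union_left)
    · rw [← Finset.union_assoc]
      exact Finset.union_subset J.hF (by simpa using hv)
    · intro a ha b hb
      rw [Finset.mem_singleton.1 hb]
      exact (adj_of_nb_ge (by omega) a ha).symm
    · intro a ha b hb
      rw [Finset.mem_singleton.1 hb]
      exact (adj_of_nb_ge (by omega) a ha).symm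
    · intro a ha b hb hab
      rw [Finset.mem_singleton.1 ha, Finset.mem_singleton.1 hb] at hab
      exact absurd rfl hab
  push Not at huniv
  by_cases hN : nbs G (E.erase y) y ⊆ T.erase y ∪ S'
  swap
  · refine I.of_erase hy (edge_nondeg J subset_rfl hTS' (by omega) hedge' (fun v _ hvF hvX => ?_)
      (fun v hv hvF => ?_) huniv hN)
    · exact absurd (Finset.mem_union_left _ hvX) hvF
    · have hvE := Finset.mem_of_mem_erase hv
      have h4 := nb_le_card (G := G) (T.erase y) v
      have h5 := nb_mono (G := G) (v := v) (Finset.erase_subset y T)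
      by_cases hc : S'.card = T.card - 1
      · omega
      · obtain rfl : S' = S := Finset.eq_of_subset_of_card_le hS' (by omega)
        have := hvT v hvE fun h => (Finset.mem_union.1 h).elim (hmem v hv hvF)
          fun h => hvF (Finset.mem_union_right _ h)
        omega
  have hN' := Finset.card_le_card (nbs_erase_subset hXi hy hN)
  change nb G E y ≤ _ at hN'
  have hd := I.deg y (I.hX hy)
  rw [ind_pos hy] at hd
  obtain ⟨b, hb⟩ := Finset.card_pos.1 (show 0 < (T.erase y).card by omega)
  have hlist : ∀ i < k, Pth G (T.erase y ∪ S') b s' (1 + i) := by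
    intro i hi
    rcases Nat.even_or_odd' i with ⟨j, rfl | rfl⟩
    · rw [show 1 + 2 * j = 2 * j + 1 by omega]
      exact pth_odd hTS' hb (hpS' (by simp)) (by omega) (by omega)
    · rw [show 1 + (2 * j + 1) = 2 * j + 2 by omega]
      exact pth_via_edge hTS' hb (hpS' (by simp)) (hpS' (by simp)) hss (by omega) (by omega)
  refine ⟨2, 1, .inl rfl, fun i hi => ⟨b, Finset.mem_of_mem_erase hb, y, hy, ?_⟩⟩
  rw [show 2 + i * 1 = 1 + i + 1 by omega]
  exact (((hlist i hi).mono J.hF).snoc (by simp) (hTS y hy s' (hS' (hpS' (by simp)))).symm).mono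
    (by rw [Finset.insert_erase (I.hX hy)])

end outcomes

section outcomes

variable {k : ℕ} {E X Y T S A C : Finset V}

theorem Full.side_clique (I : Full G k E X Y) (hk : 3 ≤ k) (hXi : Ind G X) (hYi : Ind G Y)
    (hT : T ⊆ X) (hTne : T.Nonempty) (hAE : A ⊆ E) (hCE : C ⊆ E)
    (hTA : Cmpl G T A) (hTC : Cmpl G T C) (hAC : Cmpl G A C) (hC : Clq G C)
    (hCne : C.Nonempty) (hAT : A.card ≤ T.card) (hcond : A.card + 1 ≤ T.card ∨ HasEdge G A)
    (hle : T.card + 1 ≤ A.card + C.card)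
    (huniv : ∀ v ∈ E, v ∉ T ∪ (A ∪ C) → ∃ u ∈ T ∪ (A ∪ C), ¬G.Adj u v)
    (hone : 2 ≤ T.card ∨ ∀ v ∈ X, v ∉ T ∪ (A ∪ C) → ∃ u ∈ A ∪ C, ¬G.Adj u v) :
    AP (HasLen G E X Y) k ∨ Y.card < X.card ∨ (Y ⊆ X ∧ (X = Y → AP (HasLen G E X Y) k)) := by
  have hTW := hTA.union hTC
  have hTc := Finset.card_pos.2 hTne
  have hWE := Finset.union_subset hAE hCE
  have hFE : T ∪ (A ∪ C) ⊆ E := Finset.union_subset (hT.trans I.hX) hWE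
  by_cases hY : Y ⊆ T ∪ (A ∪ C)
  swap
  · refine .inl (clique_core_nondeg (I.inst hFE (hTne.mono Finset.subset_union_left)) hT hTA hTC
      hAC hC hCne hTne (.inl hAT) (by omega) (by omega) huniv (fun v _ hvF hvX => ?_)
      (hone.imp_right fun h => ⟨I, hk, h⟩) hY)
    exact nb_eq_zero.2 fun u hu huv => hXi v hvX u (hT hu) huv
  have hnX : ∀ v ∈ A ∪ C, v ∉ X := fun v hv hvX => by
    obtain ⟨b, hb⟩ := hTne
    exact hXi b (hT hb) v hvX (hTW b hb v hv)
  rcases hTW.ind_subset hYi hY with hYT | hYW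
  · refine .inr (.inr ⟨hYT.trans hT, ?_⟩)
    rintro rfl
    obtain rfl := Finset.Subset.antisymm hT hYT
    rcases (show T.card ≤ 1 ∨ T.card = 2 ∨ 3 ≤ T.card by omega) with h1 | h2 | h3
    · exact I.card_one (by omega) h1
    · exact I.special_two hk hXi h2
    obtain ⟨y, hy⟩ := hTne
    have hyW : y ∉ A ∪ C := fun h => hnX y h hy
    have J := I.erase hFE hy Finset.subset_union_left
    rw [erase_union_of_disjoint hyW] at J
    have hsub := Finset.erase_subset y T
    exact I.special_clique_core hk hXi hy h3 J.hF (hTA.mono hsub subset_rfl)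
      (hTC.mono hsub subset_rfl) hAC hC hCne (hcond.imp id fun h => ⟨hAT, h⟩) (by omega) J
      subset_rfl
  left
  by_cases hY1 : Y.card ≤ 1
  · exact I.card_one (by omega) hY1
  have hYA : Y ⊆ A := by
    intro y hy
    refine (Finset.mem_union.1 (hYW hy)).resolve_right fun hyC => ?_
    obtain ⟨y', hy', hne⟩ := Finset.exists_mem_ne (show 1 < Y.card by omega) y
    rcases Finset.mem_union.1 (hYW hy') with h | h
    · exact hYi y' hy' y hy (hAC y' h y hyC)
    · exact hYi y' hy' y hy (hC y' h y hyC hne)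
  have hYc := Finset.card_le_card hYA
  obtain ⟨y, hy, y', hy', hyy⟩ := Finset.one_lt_card.1 (show 1 < Y.card by omega)
  have hyA := hYA hy
  have hyT : y ∉ T := fun h => hnX y (Finset.mem_union_left _ hyA) (hT h)
  have hyC : y ∉ C := Finset.disjoint_left.1 hAC.disj hyA
  have hF : (T ∪ (A ∪ C)).erase y = T ∪ (A.erase y ∪ C) := by
    rw [Finset.erase_union_distrib, Finset.erase_union_distrib, Finset.erase_eq_of_notMem hyT,
      Finset.erase_eq_of_notMem hyC]
  have J := I.erase hFE hy hY
  rw [hF] at J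
  have hsub := Finset.erase_subset y A
  have hAc := Finset.card_erase_add_one hyA
  rw [Finset.erase_eq_of_notMem (fun h => hnX y (Finset.mem_union_left _ hyA) h)] at J
  have hcond' : (A.erase y).card ≤ T.card ∨ ((A.erase y).card ≤ T.card + 1 ∧
    HasEdge G (A.erase y)) := .inl (by omega)
  rcases clique_core_grow J subset_rfl J.hF hXi hT (hTA.mono subset_rfl hsub) hTC
    (hAC.mono hsub subset_rfl) hC hCne (by omega) hcond' (by omega) with
    h | ⟨C', h1, h2, h3, h4, h5, hN⟩
  · exact h.shift 1 fun n hn => hasLen_of_erase (I.hY hy) hy n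
      (by rwa [Finset.erase_eq_of_notMem fun h => hnX y (Finset.mem_union_left _ hyA) h])
  have hc := Finset.card_le_card h1
  have hy'A : y' ∈ A.erase y := Finset.mem_erase.2 ⟨hyy.symm, hYA hy'⟩
  have hN' : nbs G E y ⊆ (T ∪ (A.erase y ∪ C')).erase y' := by
    intro v hv
    have hadj := (mem_nbs.1 hv).2
    refine Finset.mem_erase.2 ⟨fun h => hYi y hy y' hy' (h ▸ hadj), hN (mem_nbs.2 ⟨?_, hadj⟩)⟩
    exact Finset.mem_erase.2 ⟨hadj.ne', (mem_nbs.1 hv).1⟩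
  have hN'' := Finset.card_le_card hN'
  rw [Finset.card_erase_of_mem (by simp only [Finset.mem_union]; exact .inr (.inl hy'A)),
    Finset.card_union_of_disjoint ((hTA.mono subset_rfl hsub).union h3).disj,
    Finset.card_union_of_disjoint h4.disj] at hN''
  change nb G E y ≤ _ at hN''
  have hd := I.deg y (I.hY hy)
  rw [ind_pos hy, ind_neg fun h => hnX y (Finset.mem_union_left _ hyA) h] at hd
  refine ⟨1, 1, .inl rfl, fun i hi => ?_⟩
  obtain ⟨u, hu, hp⟩ := pth_clique (1 + i * 1) (hTA.mono subset_rfl hsub) h3 h4 h5 (hCne.mono h1)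
    hTne hcond' (by omega) (Finset.mem_union_left _ hy'A) (by omega) (by omega)
  exact ⟨u, hT hu, y', hy', hp.mono (h2.trans (Finset.erase_subset _ _))⟩

end outcomes

section choice

variable {k : ℕ} {E X Y T S A C : Finset V}

theorem Full.side_of_no_triangle (I : Full G k E X Y) (hk : 3 ≤ k) (hXi : Ind G X)
    (hYi : Ind G Y)
    (htri : ∀ b ∈ X, ∀ s ∈ E, ∀ s' ∈ E, G.Adj b s → G.Adj b s' → ¬G.Adj s s') :
    AP (HasLen G E X Y) k ∨ Y.card < X.card ∨ (Y ⊆ X ∧ (X = Y → AP (HasLen G E X Y) k)) := by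
  classical
  obtain ⟨-, x, hx, -⟩ := I.conn.hasLen I.ne
  let T : Finset V → Finset V := fun S => X.filter fun b => ∀ s ∈ S, G.Adj b s
  have hmemT : ∀ {S b}, b ∈ T S ↔ b ∈ X ∧ ∀ s ∈ S, G.Adj b s := by simp [T]
  obtain ⟨S, hS, hmax⟩ := Finset.exists_max_image
    (E.powerset.filter fun S => S.card + 1 ≤ (T S).card) Finset.card
    ⟨∅, by
      simp only [Finset.mem_filter, Finset.mem_powerset, Finset.empty_subset, true_and,
        Finset.card_empty]
      exact Finset.card_pos.2 ⟨x, hmemT.2 ⟨hx, by simp⟩⟩⟩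
  simp only [Finset.mem_filter, Finset.mem_powerset] at hS hmax
  refine I.side_bipartite hk hXi hYi (T := T S) (S := S) (Finset.filter_subset _ _) hS.1
    (fun a ha b hb => (hmemT.1 ha).2 b hb) hS.2 (fun v hv hvT => ?_) (fun v hv hvX hvS => ?_) htri
  · by_contra! hcon
    exact hvT (hmemT.2 ⟨hv, fun s hs => (hcon s hs).symm⟩)
  · by_contra! hcon
    have h1 : nbs G (T S) v ⊆ T (insert v S) := fun b hb => by
      obtain ⟨hbT, hvb⟩ := mem_nbs.1 hb
      obtain ⟨hbX, hbS⟩ := hmemT.1 hbT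
      refine hmemT.2 ⟨hbX, fun s hs => ?_⟩
      rcases Finset.mem_insert.1 hs with rfl | hs
      exacts [hvb.symm, hbS s hs]
    have h2 := Finset.card_le_card h1
    change nb G (T S) v ≤ _ at h2
    have h3 := Finset.card_insert_of_notMem hvS
    have := hmax (insert v S) ⟨Finset.insert_subset hv hS.1, by omega⟩
    omega

/-- A complete bipartite core with an edge inside `S`. -/
def EdgeCore (G : SimpleGraph V) (E X T S : Finset V) : Prop :=
  T ⊆ X ∧ S ⊆ E ∧ Cmpl G T S ∧ HasEdge G S ∧ S.card ≤ T.card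

/-- A complete bipartite core with parts `T` and `A ∪ C`, with `C` a clique complete to `A`. -/
def CliqueCore (G : SimpleGraph V) (E X T A C : Finset V) : Prop :=
  T ⊆ X ∧ T.Nonempty ∧ A ⊆ E ∧ C ⊆ E ∧ Cmpl G T A ∧ Cmpl G T C ∧ Cmpl G A C ∧ Clq G C ∧
    C.Nonempty ∧ A.card ≤ T.card ∧ (A.card + 1 ≤ T.card ∨ HasEdge G A) ∧
    T.card + 1 ≤ A.card + C.card

theorem HasEdge.two_le {S : Finset V} (h : HasEdge G S) : 2 ≤ S.card := by
  obtain ⟨a, ha, b, hb, hab⟩ := h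
  exact Finset.one_lt_card.2 ⟨a, ha, b, hb, hab.ne⟩

theorem HasEdge.mono {S S' : Finset V} (h : HasEdge G S) (hS : S ⊆ S') : HasEdge G S' := by
  obtain ⟨a, ha, b, hb, hab⟩ := h
  exact ⟨a, hS ha, b, hS hb, hab⟩

theorem Cmpl.insert_left {T A : Finset V} {v : V} (h : Cmpl G T A) (h' : ∀ u ∈ A, G.Adj v u) :
    Cmpl G (insert v T) A := (h.symm.insert_right fun u hu => (h' u hu).symm).symm

theorem Full.side_of_triangle (I : Full G k E X Y) (hk : 3 ≤ k) (hXi : Ind G X) (hYi : Ind G Y)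
    {b s s' : V} (hb : b ∈ X) (hs : s ∈ E) (hs' : s' ∈ E) (hbs : G.Adj b s) (hbs' : G.Adj b s')
    (hss : G.Adj s s') :
    AP (HasLen G E X Y) k ∨ Y.card < X.card ∨ (Y ⊆ X ∧ (X = Y → AP (HasLen G E X Y) k)) := by
  classical
  let P : ℕ → Prop := fun l => (∃ T S, EdgeCore G E X T S ∧ l + 1 = 2 * S.card) ∨
    (∃ T A C, CliqueCore G E X T A C ∧ l + 1 = A.card + C.card + T.card)
  have hbound : ∀ l, P l → l ≤ 3 * E.card := by
    rintro l (⟨T, S, ⟨h1, h2, -⟩, hl⟩ | ⟨T, A, C, ⟨h1, -, h2, h3, -⟩, hl⟩)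
    · have := Finset.card_le_card h2
      omega
    · have := Finset.card_le_card h2
      have := Finset.card_le_card h3
      have := Finset.card_le_card (h1.trans I.hX)
      omega
  have h0 : P 2 := by
    refine .inr ⟨{b}, ∅, {s, s'}, ⟨by simpa using hb, by simp, by simp, ?_, ?_, ?_, ?_, ?_, by simp,
      by simp, .inl (by simp), by rw [Finset.card_pair hss.ne]; simp⟩, by
        rw [Finset.card_pair hss.ne]; simp⟩
    · intro x hx
      simp only [Finset.mem_insert, Finset.mem_singleton] at hx
      rcases hx with rfl | rfl <;> assumption
    · intro x _ y hy; simp at hy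
    · intro x hx y hy
      simp only [Finset.mem_insert, Finset.mem_singleton] at hx hy
      subst hx
      rcases hy with rfl | rfl <;> assumption
    · intro x hx; simp at hx
    · intro x hx y hy hxy
      simp only [Finset.mem_insert, Finset.mem_singleton] at hx hy
      rcases hx with rfl | rfl <;> rcases hy with rfl | rfl
      exacts [absurd rfl hxy, hss, hss.symm, absurd rfl hxy]
  obtain ⟨l, hl, hmax⟩ : ∃ l, P l ∧ ∀ l', P l' → l' ≤ l := by
    refine ⟨Nat.findGreatest P (3 * E.card), Nat.findGreatest_spec (hbound 2 h0) h0,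
      fun l' hl' => ?_⟩
    by_contra! hcon
    exact Nat.findGreatest_is_greatest hcon (hbound l' hl') hl'
  rcases hl with ⟨T, S, ⟨hT, hSE, hTS, hedge, hcard⟩, hl⟩ |
    ⟨T, A, C, ⟨hT, hTne, hAE, hCE, hTA, hTC, hAC, hC, hCne, hAT, hcond, hle⟩, hl⟩
  · have h2 := hedge.two_le
    refine I.side_edge hk hXi hYi hT hSE hTS hcard hedge (fun v hv hvF => ?_)
      fun v hv hvF hvS => ?_
    · by_contra! hcon
      have hvS : v ∉ S := fun h => hvF (Finset.mem_union_right _ h)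
      have hc := Finset.card_insert_of_notMem hvS
      have := hmax (2 * (S.card + 1) - 1) (.inl ⟨nbs G T v, insert v S,
        ⟨(nbs_subset G T v).trans hT, Finset.insert_subset hv hSE, ?_,
          hedge.mono (Finset.subset_insert _ _), ?_⟩, by omega⟩)
      · omega
      · exact (hTS.mono (nbs_subset G T v) subset_rfl).insert_right
          fun u hu => (mem_nbs.1 hu).2.symm
      · change _ ≤ nb G T v
        omega
    · by_contra! hcon
      obtain ⟨T', hT', hT'c⟩ := Finset.exists_subset_card_eq (s := nbs G T v) hcon
      have hT'T := hT'.trans (nbs_subset G T v)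
      have := hmax (2 * S.card) (.inr ⟨T', S, {v}, ⟨hT'T.trans hT,
        Finset.card_pos.1 (by omega), hSE, by simpa using hv, hTS.mono hT'T subset_rfl, ?_, ?_, ?_,
        by simp, by omega, .inr hedge, by rw [Finset.card_singleton]; omega⟩,
        by rw [Finset.card_singleton]; omega⟩)
      · omega
      · intro a ha c hc
        rw [Finset.mem_singleton.1 hc]
        exact (mem_nbs.1 (hT' ha)).2.symm
      · intro a ha c hc
        rw [Finset.mem_singleton.1 hc]
        exact (adj_of_nb_ge hvS a ha).symm
      · intro a ha c hc hac
        rw [Finset.mem_singleton.1 ha, Finset.mem_singleton.1 hc] at hac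
        exact absurd rfl hac
  · have hTc := Finset.card_pos.2 hTne
    refine I.side_clique hk hXi hYi hT hTne hAE hCE hTA hTC hAC hC hCne hAT hcond hle
      (fun v hv hvF => ?_) ?_
    · by_contra! hcon
      have hvC : v ∉ C := fun h => hvF (by simp [h])
      have hc := Finset.card_insert_of_notMem hvC
      have := hmax (l + 1) (.inr ⟨T, A, insert v C, ⟨hT, hTne, hAE, Finset.insert_subset hv hCE,
        hTA, hTC.insert_right fun u hu => hcon u (by simp [hu]),
        hAC.insert_right fun u hu => hcon u (by simp [hu]),
        hC.insert fun u hu => hcon u (by simp [hu]), by simp, hAT, hcond, by omega⟩, by omega⟩)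
      omega
    · by_contra! hcon
      obtain ⟨hT1, v, hv, hvF, hvW⟩ := hcon
      have hvT : v ∉ T := fun h => hvF (by simp [h])
      have hc := Finset.card_insert_of_notMem hvT
      have hA1 : A = ∅ := by
        rcases hcond with h | h
        · exact Finset.card_eq_zero.1 (by omega)
        · have := h.two_le; omega
      subst hA1
      rw [Finset.card_empty] at *
      have hTC' : Cmpl G (insert v T) C :=
        hTC.insert_left fun u hu => (hvW u (by simp [hu])).symm
      by_cases h3 : 3 ≤ C.card
      · have := hmax (l + 1) (.inr ⟨insert v T, ∅, C, ⟨Finset.insert_subset hv hT, by simp, by simp,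
          hCE, hTA.insert_left (by simp), hTC', hAC, hC, hCne, by simp, .inl (by simp),
          by rw [Finset.card_empty]; omega⟩, by rw [Finset.card_empty]; omega⟩)
        omega
      · obtain ⟨c, hc1, c', hc2, hcc⟩ := Finset.one_lt_card.1 (show 1 < C.card by omega)
        have := hmax 3 (.inl ⟨insert v T, C, ⟨Finset.insert_subset hv hT, hCE, hTC',
          ⟨c, hc1, c', hc2, hC c hc1 c' hc2 hcc⟩, by omega⟩, by omega⟩)
        omega

theorem Full.side (I : Full G k E X Y) (hk : 3 ≤ k) (hXi : Ind G X) (hYi : Ind G Y) :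
    AP (HasLen G E X Y) k ∨ Y.card < X.card ∨ (Y ⊆ X ∧ (X = Y → AP (HasLen G E X Y) k)) := by
  by_cases htri : ∀ b ∈ X, ∀ s ∈ E, ∀ s' ∈ E, G.Adj b s → G.Adj b s' → ¬G.Adj s s'
  · exact I.side_of_no_triangle hk hXi hYi htri
  · push Not at htri
    obtain ⟨b, hb, s, hs, s', hs', h1, h2, h3⟩ := htri
    exact I.side_of_triangle hk hXi hYi hb hs hs' h1 h2 h3

theorem Full.run (I : Full G k E X Y) (hk : 3 ≤ k) : AP (HasLen G E X Y) k := by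
  by_cases hX : HasEdge G X
  · exact I.of_edge (by omega) hX
  by_cases hY : HasEdge G Y
  · exact (I.symm.of_edge (by omega) hY).hasLen_symm
  have hXi : Ind G X := fun a ha b hb h => hX ⟨a, ha, b, hb, h⟩
  have hYi : Ind G Y := fun a ha b hb h => hY ⟨a, ha, b, hb, h⟩
  rcases I.side hk hXi hYi with h | h | ⟨h, h'⟩
  · exact h
  · rcases I.symm.side hk hYi hXi with g | g | ⟨g, -⟩
    · exact g.hasLen_symm
    · omega
    · have := Finset.card_le_card g
      omega
  · rcases I.symm.side hk hYi hXi with g | g | ⟨g, -⟩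
    · exact g.hasLen_symm
    · have := Finset.card_le_card h
      omega
    · exact h' (Finset.Subset.antisymm g h)

/-- Main theorem on paths: if `E` with roots attached along `X` and `Y` is 2-connected with
degrees at least `k + 1`, then there are `k` admissible paths between `X` and `Y`. -/
theorem paths (N : ℕ) : Hyp G N := by
  induction N with
  | zero => intro k E X Y h; omega
  | succ N ih =>
    intro k E X Y hN hX hY hconn hne hdeg
    rcases (show k = 0 ∨ k = 1 ∨ k = 2 ∨ 3 ≤ k by omega) with rfl | rfl | rfl | hk
    · exact AP.zero _
    · obtain ⟨n, hn⟩ := hconn.hasLen hne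
      exact AP.one hn
    · obtain ⟨z, hz⟩ := hne
      refine two_paths E X Y z hX hY hconn (fun v hv _ => hdeg v hv) ?_
      have h1 := hdeg z hz
      have h2 := ind_le_one (z ∈ X)
      have h3 := ind_le_one (z ∈ Y)
      obtain ⟨v, hv, hzv⟩ := nb_pos.1 (show 0 < nb G E z by omega)
      exact ⟨v, hv, hzv.ne'⟩
    · exact Full.run ⟨hX, hY, hconn, hdeg, ih.mono (by omega), hne⟩ hk

end choice

/-- A 2-connected graph of minimum degree at least `k` with a vertex set `F` such that vertices
outside `F` have at most `r - 1` neighbours in `F`. -/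
structure Amb [Fintype V] (G : SimpleGraph V) (k : ℕ) (F : Finset V) (r : ℕ) : Prop where
  hk : 3 ≤ k
  hr : 2 ≤ r
  hF : 3 ≤ F.card
  two : ∀ D : Finset V, D.Nonempty → (∃ v, v ∉ D ∧ v ∉ bd G Finset.univ D) →
    2 ≤ (bd G Finset.univ D).card
  deg : ∀ v, k ≤ nb G Finset.univ v
  out : ∀ v, v ∉ F → nb G F v + 1 ≤ r

/-- `E` is a component of the complement of `F`. -/
structure Piece (G : SimpleGraph V) (F E : Finset V) : Prop where
  ne : E.Nonempty
  disj : Disjoint E F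
  closed : ∀ e ∈ E, ∀ w, G.Adj e w → w ∈ E ∨ w ∈ F
  conn : ∀ D ⊆ E, D.Nonempty → Closed G E D → D = E

section

variable [Fintype V] {k r : ℕ} {F E P Q : Finset V}

theorem exists_piece {v : V} (hv : v ∉ F) : ∃ E, v ∈ E ∧ Piece G F E := by
  have hv' : v ∈ Finset.univ \ F := by simp [hv]
  have hs := comp_subset G (Finset.univ \ F) v
  refine ⟨comp G (Finset.univ \ F) v, self_mem_comp hv', ⟨v, self_mem_comp hv'⟩,
    Finset.disjoint_left.2 fun x hx hx' => (Finset.mem_sdiff.1 (hs hx)).2 hx', ?_,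
    fun D hD hne hc => comp_connected hD hne hc⟩
  intro e he w hw
  by_cases hwF : w ∈ F
  · exact .inr hwF
  · exact .inl (comp_closed _ v e he w (by simp [hwF]) hw)

theorem Piece.pth (hE : Piece G F E) {u v : V} (hu : u ∈ E) (hv : v ∈ E) : ∃ n, Pth G E u v n := by
  have := hE.conn (comp G E u) (comp_subset _ _ _) ⟨u, self_mem_comp hu⟩ (comp_closed E u)
  rw [← this] at hv
  exact mem_comp.1 hv

theorem Piece.nb_univ (hE : Piece G F E) {v : V} (hv : v ∈ E) :
    nb G Finset.univ v = nb G E v + nb G F v := by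
  rw [← nb_union hE.disj]
  unfold nb; congr 1; ext x
  simp only [mem_nbs, Finset.mem_univ, true_and, Finset.mem_union]
  exact ⟨fun h => ⟨hE.closed v hv x h, h⟩, fun h => h.2⟩

theorem Piece.bd_pos (hE : Piece G F E) {D : Finset V} (hD : D ⊆ E) (hne : D.Nonempty)
    (hDE : D ≠ E) : 1 ≤ (bd G E D).card := by
  by_contra h
  exact hDE (hE.conn D hD hne (closed_iff_bd.2 (Finset.card_eq_zero.1 (by omega))))

/-- Subsets of a piece without neighbours in `F` have at least two boundary vertices. -/
theorem Piece.two_le_bd (hA : Amb G k F r) (hE : Piece G F E) {D : Finset V} (hD : D ⊆ E)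
    (hne : D.Nonempty) (hF : ∀ d ∈ D, ∀ f ∈ F, ¬G.Adj d f) : 2 ≤ (bd G E D).card := by
  have hsub : bd G Finset.univ D ⊆ bd G E D := fun x hx => by
    simp only [mem_bd, Finset.mem_univ, true_and] at hx ⊢
    obtain ⟨h1, d, hd, hdx⟩ := hx
    rcases hE.closed d (hD hd) x hdx with h | h
    · exact ⟨⟨h, h1⟩, d, hd, hdx⟩
    · exact absurd hdx (hF d hd x h)
  obtain ⟨f, hf⟩ := Finset.card_pos.1 (show 0 < F.card by have := hA.hF; omega)
  have hfE : f ∉ E := Finset.disjoint_right.1 hE.disj hf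
  refine (hA.two D hne ⟨f, fun h => hfE (hD h), fun h => hfE ?_⟩).trans (Finset.card_le_card hsub)
  exact (mem_bd.1 (hsub h)).1.1

/-- The attachments of a piece root it in a connected way. -/
theorem Piece.conn_nbS (hA : Amb G k F r) (hE : Piece G F E)
    (hPQ : ∀ e ∈ E, ∀ f ∈ F, G.Adj e f → f ∈ P ∪ Q)
    (hX : (nbS G E P).Nonempty) (hY : (nbS G E Q).Nonempty) :
    Conn G E (nbS G E P) (nbS G E Q) := by
  intro D hD hne
  by_cases hDE : D = E
  · subst hDE
    obtain ⟨x, hx⟩ := hX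
    obtain ⟨y, hy⟩ := hY
    rw [ind_pos ⟨x, nbS_subset _ _ _ hx, hx⟩, ind_pos ⟨y, nbS_subset _ _ _ hy, hy⟩]
    omega
  have h1 := hE.bd_pos hD hne hDE
  by_cases hx : ∃ v ∈ D, v ∈ nbS G E P
  · rw [ind_pos hx]; omega
  by_cases hy : ∃ v ∈ D, v ∈ nbS G E Q
  · rw [ind_pos hy]; omega
  have := hE.two_le_bd hA hD hne fun d hd f hf hdf => by
    rcases Finset.mem_union.1 (hPQ d (hD hd) f hf hdf) with h | h
    · exact hx ⟨d, hd, mem_nbS.2 ⟨hD hd, f, h, hdf.symm⟩⟩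
    · exact hy ⟨d, hd, mem_nbS.2 ⟨hD hd, f, h, hdf.symm⟩⟩
  omega

/-- Paths through a piece. -/
theorem Piece.attach (hA : Amb G k F r) (hrk : r ≤ k) (hE : Piece G F E)
    (hPQ : ∀ e ∈ E, ∀ f ∈ F, G.Adj e f → f ∈ P ∪ Q)
    (hX : (nbS G E P).Nonempty) (hY : (nbS G E Q).Nonempty) :
    AP (HasLen G E (nbS G E P) (nbS G E Q)) (k - r + 1) := by
  refine paths (E.card + 1) (k - r + 1) E _ _ (by omega) (nbS_subset _ _ _) (nbS_subset _ _ _)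
    (hE.conn_nbS hA hPQ hX hY) hE.ne fun v hv => ?_
  have h1 := hE.nb_univ hv
  have h2 := hA.deg v
  have h3 := hA.out v (Finset.disjoint_left.1 hE.disj hv)
  have h4 := hA.hr
  by_cases h0 : nb G F v = 0
  · omega
  obtain ⟨f, hf, hvf⟩ := nb_pos.1 (Nat.pos_of_ne_zero h0)
  rcases Finset.mem_union.1 (hPQ v hv f hf hvf) with h | h
  · rw [ind_pos (p := v ∈ nbS G E P) (mem_nbS.2 ⟨hv, f, h, hvf.symm⟩)]; omega
  · rw [ind_pos (p := v ∈ nbS G E Q) (mem_nbS.2 ⟨hv, f, h, hvf.symm⟩)]; omega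

/-- Closing up paths through `E` with paths in `F`. -/
theorem AP.close {m n l : ℕ} (h : AP (HasLen G E (nbS G E P) (nbS G E Q)) m)
    (hL : AP (fun n => ∀ p ∈ P, ∀ q ∈ Q, Pth G F p q n) n) (hEF : Disjoint E F)
    (hPQ : Disjoint P Q) (hm : 1 ≤ m) (hn : 1 ≤ n) (hl : l ≤ m + n - 1) : AP (HasCycleLen G) l := by
  refine (AP.add 2 h hL hm hn ?_).le hl
  rintro a b ⟨u, hu, v, hv, huv⟩ hb
  obtain ⟨p, hp, hpu⟩ := (mem_nbS.1 hu).2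
  obtain ⟨q, hq, hqv⟩ := (mem_nbS.1 hv).2
  have h1 := (hb p hp q hq).symm
  refine huv.cycle_concat h1 hEF hqv.symm hpu ?_
  by_contra h0
  obtain rfl : b = 0 := by omega
  cases h1
  exact Finset.disjoint_left.1 hPQ hp hq

theorem Piece.cycles (hA : Amb G k F r) (hrk : r ≤ k) (hE : Piece G F E)
    (hPQ : ∀ e ∈ E, ∀ f ∈ F, G.Adj e f → f ∈ P ∪ Q)
    (hX : (nbS G E P).Nonempty) (hY : (nbS G E Q).Nonempty) (hd : Disjoint P Q)
    (hL : AP (fun n => ∀ p ∈ P, ∀ q ∈ Q, Pth G F p q n) r) : AP (HasCycleLen G) k :=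
  (hE.attach hA hrk hPQ hX hY).close hL hE.disj hd (by omega) (by have := hA.hr; omega) (by omega)

/-- Subsets of a piece whose outside neighbours are at most two vertices. -/
theorem Piece.two_out (hA : Amb G k F r) (hE : Piece G F E) {D : Finset V} {z p : V}
    (hD : D ⊆ E) (hne : D.Nonempty) (hp : p ∈ E) (hpD : p ∉ D) (hz : z ∈ F)
    (hout : ∀ d ∈ D, ∀ w, G.Adj d w → w ∈ D ∨ w = z ∨ w = p) :
    AP (HasLen G D (nbS G D {z}) (nbS G D {p})) (k - 1) := by
  have hzE : z ∉ E := Finset.disjoint_right.1 hE.disj hz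
  have hk := hA.hk
  refine paths (D.card + 1) (k - 1) D _ _ (by omega) (nbS_subset _ _ _) (nbS_subset _ _ _)
    ?_ hne fun v hv => ?_
  · intro D' hD' hne'
    have hsub : bd G Finset.univ D' ⊆ bd G D D' ∪ ((bd G Finset.univ D' ∩ {z}) ∪
        (bd G Finset.univ D' ∩ {p})) := fun x hx => by
      have hx0 := hx
      simp only [mem_bd, Finset.mem_univ, true_and, Finset.mem_union, Finset.mem_inter,
        Finset.mem_singleton] at hx ⊢
      obtain ⟨h1, d, hd, hdx⟩ := hx
      rcases hout d (hD' hd) x hdx with h | h | h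
      · exact .inl ⟨⟨h, h1⟩, d, hd, hdx⟩
      · exact .inr (.inl ⟨⟨h1, d, hd, hdx⟩, h⟩)
      · exact .inr (.inr ⟨⟨h1, d, hd, hdx⟩, h⟩)
    have hz1 : (bd G Finset.univ D' ∩ {z}).card ≤ ind (∃ v ∈ D', v ∈ nbS G D {z}) := by
      by_cases h : ∃ v ∈ D', v ∈ nbS G D {z}
      · rw [ind_pos h]
        exact (Finset.card_le_card Finset.inter_subset_right).trans (by simp)
      · rw [Finset.card_eq_zero.2]
        · omega
        rw [Finset.eq_empty_iff_forall_notMem]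
        intro x hx
        simp only [mem_bd, Finset.mem_univ, true_and, Finset.mem_inter,
          Finset.mem_singleton] at hx
        obtain ⟨⟨-, d, hd, hdx⟩, rfl⟩ := hx
        exact h ⟨d, hd, mem_nbS.2 ⟨hD' hd, x, by simp, hdx.symm⟩⟩
    have hp1 : (bd G Finset.univ D' ∩ {p}).card ≤ ind (∃ v ∈ D', v ∈ nbS G D {p}) := by
      by_cases h : ∃ v ∈ D', v ∈ nbS G D {p}
      · rw [ind_pos h]
        exact (Finset.card_le_card Finset.inter_subset_right).trans (by simp)
      · rw [Finset.card_eq_zero.2]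
        · omega
        rw [Finset.eq_empty_iff_forall_notMem]
        intro x hx
        simp only [mem_bd, Finset.mem_univ, true_and, Finset.mem_inter,
          Finset.mem_singleton] at hx
        obtain ⟨⟨-, d, hd, hdx⟩, rfl⟩ := hx
        exact h ⟨d, hd, mem_nbS.2 ⟨hD' hd, x, by simp, hdx.symm⟩⟩
    obtain ⟨f, hf, hfz⟩ := Finset.exists_mem_ne (show 1 < F.card by have := hA.hF; omega) z
    have hfE : f ∉ E := Finset.disjoint_right.1 hE.disj hf
    have h2 := hA.two D' hne' ⟨f, fun h => hfE (hD (hD' h)), fun h => by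
      simp only [mem_bd, Finset.mem_univ, true_and] at h
      obtain ⟨-, d, hd, hdf⟩ := h
      rcases hout d (hD' hd) f hdf with h | h | h
      exacts [hfE (hD h), hfz h, hfE (h ▸ hp)]⟩
    have h3 := Finset.card_le_card hsub
    have h4 := Finset.card_union_le (bd G D D') ((bd G Finset.univ D' ∩ {z}) ∪
        (bd G Finset.univ D' ∩ {p}))
    have h5 := Finset.card_union_le (bd G Finset.univ D' ∩ {z}) (bd G Finset.univ D' ∩ {p})
    omega
  · have h1 := hA.deg v
    have h2 : nb G Finset.univ v ≤ nb G D v + nb G ({z} ∪ {p}) v :=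
      nb_le_add v fun u _ hvu => by
        rcases hout v hv u hvu with h | h | h
        · exact .inl h
        · exact .inr (by simp [h])
        · exact .inr (by simp [h])
    have h3 := nb_union_le (G := G) {z} {p} v
    have h4 : ∀ w, nb G {w} v ≤ ind (v ∈ nbS G D {w}) := fun w => by
      by_cases h : G.Adj w v
      · rw [ind_pos (mem_nbS.2 ⟨hv, w, by simp, h⟩)]
        exact (nb_le_card _ _).trans (by simp)
      · rw [nb_eq_zero.2 (by simpa using fun h' => h h'.symm)]; omega
    have h5 := h4 z
    have h6 := h4 p
    omega

/-- Like `Piece.cycles`, but allowing a further attachment `z`. -/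
theorem Piece.cycles_drop (hA : Amb G k F r) (hr : 3 ≤ r) (hrk : r ≤ k) (hE : Piece G F E) {z : V}
    (hz : z ∈ F) (hPQ : ∀ e ∈ E, ∀ f ∈ F, G.Adj e f → f ∈ P ∪ Q ∨ f = z)
    (hX : (nbS G E P).Nonempty) (hY : (nbS G E Q).Nonempty) (hd : Disjoint P Q)
    (hL : AP (fun n => ∀ p ∈ P, ∀ q ∈ Q, Pth G F p q n) r)
    (hL2 : ∀ f ∈ P, AP (fun n => Pth G F f z n) 2) : AP (HasCycleLen G) k := by
  by_cases hC : Conn G E (nbS G E P) (nbS G E Q)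
  · refine AP.close (m := k - r + 1) ?_ hL hE.disj hd (by omega) (by omega) (by omega)
    refine paths (E.card + 1) (k - r + 1) E _ _ (by omega) (nbS_subset _ _ _) (nbS_subset _ _ _)
      hC hE.ne fun v hv => ?_
    have h1 := hE.nb_univ hv
    have h2 := hA.deg v
    have h3 := hA.out v (Finset.disjoint_left.1 hE.disj hv)
    by_cases h0 : nb G F v ≤ 1
    · omega
    obtain ⟨f, hf, hfz⟩ := Finset.exists_mem_ne (show 1 < (nbs G F v).card by
      change 1 < nb G F v; omega) z
    obtain ⟨hf, hvf⟩ := mem_nbs.1 hf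
    rcases Finset.mem_union.1 ((hPQ v hv f hf hvf).resolve_right hfz) with h | h
    · rw [ind_pos (p := v ∈ nbS G E P) (mem_nbS.2 ⟨hv, f, h, hvf.symm⟩)]; omega
    · rw [ind_pos (p := v ∈ nbS G E Q) (mem_nbS.2 ⟨hv, f, h, hvf.symm⟩)]; omega
  unfold Conn at hC
  push Not at hC
  obtain ⟨D, hD, hne, hlt⟩ := hC
  have hDE : D ≠ E := by
    rintro rfl
    obtain ⟨x, hx⟩ := hX
    obtain ⟨y, hy⟩ := hY
    rw [ind_pos ⟨x, nbS_subset _ _ _ hx, hx⟩, ind_pos ⟨y, nbS_subset _ _ _ hy, hy⟩] at hlt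
    omega
  have h1 := hE.bd_pos hD hne hDE
  have hDX : ¬∃ v ∈ D, v ∈ nbS G E P := fun h => by rw [ind_pos h] at hlt; omega
  have hDY : ¬∃ v ∈ D, v ∈ nbS G E Q := fun h => by rw [ind_pos h] at hlt; omega
  obtain ⟨p, hp⟩ := Finset.card_eq_one.1 (show (bd G E D).card = 1 by omega)
  have hpm : p ∈ bd G E D := by simp [hp]
  obtain ⟨⟨hpE, hpD⟩, -⟩ := mem_bd.1 hpm
  have hout : ∀ d ∈ D, ∀ w, G.Adj d w → w ∈ D ∨ w = z ∨ w = p := by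
    intro d hd w hdw
    by_cases hwD : w ∈ D
    · exact .inl hwD
    rcases hE.closed d (hD hd) w hdw with h | h
    · refine .inr (.inr ?_)
      have : w ∈ bd G E D := mem_bd.2 ⟨⟨h, hwD⟩, d, hd, hdw⟩
      simpa [hp] using this
    · rcases hPQ d (hD hd) w h hdw with h' | h'
      · rcases Finset.mem_union.1 h' with h' | h'
        · exact absurd ⟨d, hd, mem_nbS.2 ⟨hD hd, w, h', hdw.symm⟩⟩ hDX
        · exact absurd ⟨d, hd, mem_nbS.2 ⟨hD hd, w, h', hdw.symm⟩⟩ hDY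
      · exact .inr (.inl h')
  have hAP := hE.two_out hA hD hne hpE hpD hz hout
  obtain ⟨x, hx⟩ := hX
  obtain ⟨hxE, f, hf, hfx⟩ := mem_nbS.1 hx
  have hxD : x ∉ D := fun h => hDX ⟨x, h, hx⟩
  obtain ⟨m, hm⟩ : ∃ m, Pth G (E \ D) p x m := by
    obtain ⟨n, hn⟩ := hE.pth hpE hxE
    rcases hn.last_exit hxD with h | ⟨e, he, p', hep, m, hm⟩
    · exact ⟨n, h⟩
    · have h1 := Finset.mem_sdiff.1 hm.start_mem
      have : p' ∈ bd G E D := mem_bd.2 ⟨⟨h1.1, h1.2⟩, e, he, hep⟩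
      obtain rfl : p' = p := by simpa [hp] using this
      exact ⟨m, hm⟩
  refine (AP.add (m + 1 + 2) hAP (hL2 f hf) (by omega) (by omega) ?_).le (by omega)
  rintro a b ⟨u, hu, v, hv, huv⟩ hb
  obtain ⟨z', hz', hzu⟩ := (mem_nbS.1 hu).2
  obtain ⟨p', hp', hpv⟩ := (mem_nbS.1 hv).2
  rw [Finset.mem_singleton] at hz' hp'
  subst z' p'
  have h3 := huv.concat hm Finset.disjoint_sdiff hpv.symm
  rw [Finset.union_sdiff_of_subset hD] at h3
  have h4 := h3.cycle_concat hb hE.disj hfx.symm hzu (by omega)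
  rwa [show a + b + (m + 1 + 2) = a + m + 1 + b + 2 by omega]

end

/-- `S` and `T` are completely joined, except possibly for the pair `x₀`, `y₀`. -/
structure KM (G : SimpleGraph V) (S T : Finset V) (x₀ y₀ : V) : Prop where
  hx : x₀ ∈ S
  hy : y₀ ∈ T
  disj : Disjoint S T
  adj : ∀ x ∈ S, ∀ y ∈ T, ¬(x = x₀ ∧ y = y₀) → G.Adj x y

namespace KM

variable {S T : Finset V} {x₀ y₀ p q : V} {i : ℕ}

theorem symm (h : KM G S T x₀ y₀) : KM G T S y₀ x₀ :=
  ⟨h.hy, h.hx, h.disj.symm, fun x hx y hy hxy => (h.adj y hy x hx fun h' => hxy h'.symm).symm⟩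

theorem left (h : KM G S T x₀ y₀) : Cmpl G S (T.erase y₀) := fun a ha b hb =>
  h.adj a ha b (Finset.mem_of_mem_erase hb) fun h' => Finset.ne_of_mem_erase hb h'.2

theorem right (h : KM G S T x₀ y₀) : Cmpl G (S.erase x₀) T := fun a ha b hb =>
  h.adj a (Finset.mem_of_mem_erase ha) b hb fun h' => Finset.ne_of_mem_erase ha h'.1

theorem ne (h : KM G S T x₀ y₀) (hp : p ∈ S) (hq : q ∈ T) : p ≠ q :=
  fun e => Finset.disjoint_left.1 h.disj hp (e ▸ hq)

theorem sub_left (_ : KM G S T x₀ y₀) : S ∪ T.erase y₀ ⊆ S ∪ T :=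
  Finset.union_subset_union_right (Finset.erase_subset _ _)

theorem insert_sub (h : KM G S T x₀ y₀) : insert y₀ (S ∪ T.erase y₀) ⊆ S ∪ T := by
  intro x hx
  simp only [Finset.mem_insert, Finset.mem_union, Finset.mem_erase] at hx ⊢
  rcases hx with rfl | hx | hx
  exacts [.inr h.hy, .inl hx, .inr hx.2]

theorem y_even (h : KM G S T x₀ y₀) (hS : 2 ≤ S.card) (hq : q ∈ T) (hqy : q ≠ y₀) (hi1 : 1 ≤ i)
    (hi : i ≤ S.card) (hi' : i < T.card) : Pth G (S ∪ T) y₀ q (2 * i) := by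
  obtain ⟨b, hb, hbx⟩ := Finset.exists_mem_ne (show 1 < S.card by omega) x₀
  have h1 := pth_odd h.left (i := i - 1) hb (Finset.mem_erase.2 ⟨hqy, hq⟩) (by omega)
    (by rw [Finset.card_erase_of_mem h.hy]; omega)
  have h2 := h1.cons' (w := y₀) (by simp [Finset.disjoint_right.1 h.disj h.hy])
    (h.adj b hb y₀ h.hy fun h' => hbx h'.1).symm
  rw [show 2 * i = 2 * (i - 1) + 1 + 1 by omega]
  exact h2.mono h.insert_sub

theorem y_odd (h : KM G S T x₀ y₀) (hp : p ∈ S) (hb : ∃ b ∈ S, b ≠ x₀ ∧ b ≠ p) (hi1 : 1 ≤ i)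
    (hi : i < S.card) (hi' : i < T.card) : Pth G (S ∪ T) y₀ p (2 * i + 1) := by
  obtain ⟨b, hb, hbx, hbp⟩ := hb
  have h1 := pth_even h.left (i := i) hb hp hbp hi1 (by omega)
    (by rw [Finset.card_erase_of_mem h.hy]; omega)
  have h2 := h1.cons' (w := y₀) (by simp [Finset.disjoint_right.1 h.disj h.hy])
    (h.adj b hb y₀ h.hy fun h' => hbx h'.1).symm
  exact h2.mono h.insert_sub

theorem exists_ne_ne {A : Finset V} (hA : 3 ≤ A.card) (a b : V) : ∃ c ∈ A, c ≠ a ∧ c ≠ b := by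
  have h1 := Finset.pred_card_le_card_erase (s := A) (a := a)
  obtain ⟨c, hc, hcb⟩ := Finset.exists_mem_ne (show 1 < (A.erase a).card by omega) b
  exact ⟨c, Finset.mem_of_mem_erase hc, Finset.ne_of_mem_erase hc, hcb⟩

theorem pth_odd (h : KM G S T x₀ y₀) (hS : 3 ≤ S.card) (hT : 3 ≤ T.card) (hp : p ∈ S) (hq : q ∈ T)
    (hpq : ¬(p = x₀ ∧ q = y₀) ∨ 1 ≤ i) (hi : i < S.card) (hi' : i < T.card) :
    Pth G (S ∪ T) p q (2 * i + 1) := by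
  by_cases hi0 : i = 0
  · subst hi0
    exact .adj (h.adj p hp q hq (hpq.resolve_right (by omega))) (by simp [hp]) (by simp [hq])
  by_cases hqy : q = y₀
  · subst hqy
    exact (h.y_odd hp (exists_ne_ne hS _ _) (by omega) hi hi').symm
  by_cases hpx : p = x₀
  · subst hpx
    have := h.symm.y_odd hq (exists_ne_ne hT _ _) (i := i) (by omega) hi' hi
    rwa [Finset.union_comm] at this
  by_cases hi2 : i < T.card - 1
  · exact (AdmissiblePaths.pth_odd h.left hp (Finset.mem_erase.2 ⟨hqy, hq⟩) hi
      (by rwa [Finset.card_erase_of_mem h.hy])).mono h.sub_left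
  obtain ⟨b, hb, hbx, hbp⟩ := exists_ne_ne hS x₀ p
  have h1 := AdmissiblePaths.pth_odd (h.left.mono (Finset.erase_subset p S) subset_rfl) (i := i - 1)
    (Finset.mem_erase.2 ⟨hbp, hb⟩) (Finset.mem_erase.2 ⟨hqy, hq⟩)
    (by rw [Finset.card_erase_of_mem hp]; omega) (by rw [Finset.card_erase_of_mem h.hy]; omega)
  have h2 := h1.cons' (w := y₀) (by simp [Finset.disjoint_right.1 h.disj h.hy])
    (h.adj b hb y₀ h.hy fun h' => hbx h'.1).symm
  have h3 := h2.cons' (w := p) (by simp [Finset.disjoint_left.1 h.disj hp, h.ne hp h.hy])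
    (h.adj p hp y₀ h.hy fun h' => hpx h'.1)
  rw [show 2 * i + 1 = 2 * (i - 1) + 1 + 1 + 1 by omega]
  refine h3.mono fun x hx => ?_
  simp only [Finset.mem_insert, Finset.mem_union, Finset.mem_erase] at hx ⊢
  rcases hx with rfl | rfl | hx | hx
  exacts [.inl hp, .inr h.hy, .inl hx.2, .inr hx.2]

theorem pth_even (h : KM G S T x₀ y₀) (hS : 3 ≤ S.card) (hp : p ∈ T) (hq : q ∈ T)
    (hpq : p ≠ q) (hi1 : 1 ≤ i) (hi : i ≤ S.card) (hi' : i < T.card) :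
    Pth G (S ∪ T) p q (2 * i) := by
  by_cases hpy : p = y₀
  · subst hpy
    exact h.y_even (by omega) hq hpq.symm hi1 hi hi'
  by_cases hqy : q = y₀
  · subst hqy
    exact (h.y_even (by omega) hp hpq hi1 hi hi').symm
  by_cases hi2 : i ≤ S.card - 1
  · refine (AdmissiblePaths.pth_even h.right.symm hp hq hpq hi1 hi'
      (by rwa [Finset.card_erase_of_mem h.hx])).mono ?_
    rw [Finset.union_comm]
    exact Finset.union_subset_union_left (Finset.erase_subset _ _)
  obtain ⟨b, hb, hbx⟩ := Finset.exists_mem_ne (show 1 < S.card by omega) x₀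
  obtain ⟨c, hc, hcx, hcb⟩ := exists_ne_ne hS x₀ b
  have h1 := AdmissiblePaths.pth_odd (i := i - 2) (u := c) (w := q)
    (h.left.mono (Finset.erase_subset b S) (Finset.erase_subset p _))
    (Finset.mem_erase.2 ⟨hcb, hc⟩) (Finset.mem_erase.2 ⟨hpq.symm, Finset.mem_erase.2 ⟨hqy, hq⟩⟩)
    (by rw [Finset.card_erase_of_mem hb]; omega)
    (by rw [Finset.card_erase_of_mem (Finset.mem_erase.2 ⟨hpy, hp⟩),
      Finset.card_erase_of_mem h.hy]; omega)
  have h2 := h1.cons' (w := y₀) (by simp [Finset.disjoint_right.1 h.disj h.hy])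
    (h.adj c hc y₀ h.hy fun h' => hcx h'.1).symm
  have h3 := h2.cons' (w := b) (by simp [Finset.disjoint_left.1 h.disj hb, h.ne hb h.hy])
    (h.adj b hb y₀ h.hy fun h' => hbx h'.1)
  have h4 := h3.cons' (w := p) (by
    simp [Finset.disjoint_right.1 h.disj hp, hpy, (h.ne hb hp).symm])
    (h.adj b hb p hp fun h' => hbx h'.1).symm
  rw [show 2 * i = 2 * (i - 2) + 1 + 1 + 1 + 1 by omega]
  refine h4.mono fun x hx => ?_
  simp only [Finset.mem_insert, Finset.mem_union, Finset.mem_erase] at hx ⊢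
  rcases hx with rfl | rfl | rfl | hx | hx
  exacts [.inr hp, .inl hb, .inr h.hy, .inl hx.2, .inr hx.2.2]

theorem cycle_even (h : KM G S T x₀ y₀) (hS : 2 ≤ S.card) (hT : 3 ≤ T.card) {j : ℕ} (hj : 2 ≤ j)
    (hjS : j ≤ S.card) (hjT : j ≤ T.card) : HasCycleLen G (2 * j) := by
  obtain ⟨p, hp, hpx⟩ := Finset.exists_mem_ne (show 1 < S.card by omega) x₀
  obtain ⟨q, hq, hqy⟩ := Finset.exists_mem_ne (show 1 < T.card by omega) y₀
  have hpq : G.Adj p q := h.adj p hp q hq fun h' => hpx h'.1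
  obtain ⟨A, hA⟩ : ∃ A, Pth G A p q (2 * (j - 1) + 1) := by
    by_cases h3 : 3 ≤ S.card
    · exact ⟨_, h.pth_odd h3 hT hp hq (.inr (by omega)) (by omega) (by omega)⟩
    · exact ⟨_, AdmissiblePaths.pth_odd h.left hp (Finset.mem_erase.2 ⟨hqy, hq⟩) (by omega)
        (by rw [Finset.card_erase_of_mem h.hy]; omega)⟩
  have := hA.cycle (by omega) hpq.symm
  rwa [show 2 * (j - 1) + 1 + 1 = 2 * j by omega] at this

end KM

section

variable [Fintype V] {k r : ℕ} {F E E' P Q S T : Finset V} {x₀ y₀ : V}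

/-- A piece missing a vertex of `F` has two attachments. -/
theorem Piece.two_attach (hA : Amb G k F r) (hE : Piece G F E)
    (hf : ∃ f ∈ F, ∀ e ∈ E, ¬G.Adj e f) :
    ∃ f₁ ∈ F, ∃ f₂ ∈ F, f₁ ≠ f₂ ∧ (nbS G E {f₁}).Nonempty ∧ (nbS G E {f₂}).Nonempty := by
  obtain ⟨f, hf, hfE⟩ := hf
  have h2 := hA.two E hE.ne ⟨f, Finset.disjoint_right.1 hE.disj hf, fun h => by
    obtain ⟨-, d, hd, hdf⟩ := mem_bd.1 h
    exact hfE d hd hdf⟩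
  obtain ⟨f₁, h1, f₂, h2, h12⟩ := Finset.one_lt_card.1 h2
  obtain ⟨⟨-, h1E⟩, d₁, hd₁, h1⟩ := mem_bd.1 h1
  obtain ⟨⟨-, h2E⟩, d₂, hd₂, h2⟩ := mem_bd.1 h2
  refine ⟨f₁, (hE.closed _ hd₁ _ h1).resolve_left h1E, f₂, (hE.closed _ hd₂ _ h2).resolve_left h2E,
    h12, ⟨d₁, ?_⟩, ⟨d₂, ?_⟩⟩
  · exact mem_nbS.2 ⟨hd₁, f₁, by simp, h1.symm⟩
  · exact mem_nbS.2 ⟨hd₂, f₂, by simp, h2.symm⟩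

theorem nbS_nonempty {D W : Finset V} : (nbS G D W).Nonempty ↔ ∃ d ∈ D, ∃ w ∈ W, G.Adj d w := by
  constructor
  · rintro ⟨x, hx⟩
    obtain ⟨h1, w, hw, h2⟩ := mem_nbS.1 hx
    exact ⟨x, h1, w, hw, h2.symm⟩
  · rintro ⟨x, hx, w, hw, h⟩
    exact ⟨x, mem_nbS.2 ⟨hx, w, hw, h.symm⟩⟩

theorem AP.odd {L : ℕ → Prop} (n : ℕ) (h : ∀ i < n, L (2 * i + 1)) : AP L n :=
  ⟨1, 2, .inr rfl, fun i hi => by have := h i hi; rwa [show 1 + i * 2 = 2 * i + 1 by omega]⟩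

theorem AP.even {L : ℕ → Prop} (n : ℕ) (h : ∀ i, 1 ≤ i → i ≤ n → L (2 * i)) : AP L n :=
  ⟨2, 2, .inr rfl, fun i hi => by
    have := h (i + 1) (by omega) (by omega); rwa [show 2 + i * 2 = 2 * (i + 1) by omega]⟩

/-- A piece attached to both sides. -/
theorem KM.case_both (h : KM G S T x₀ y₀) (hA : Amb G k (S ∪ T) r) (hrk : r ≤ k) (hr : 3 ≤ r)
    (hS : r ≤ S.card) (hT : r ≤ T.card) (hE : Piece G (S ∪ T) E) (hX : (nbS G E S).Nonempty)
    (hY : (nbS G E T).Nonempty) : AP (HasCycleLen G) k := by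
  have hodd3 : ∀ f ∈ S, Pth G (S ∪ T) f y₀ 3 := fun f hf =>
    h.pth_odd (i := 1) (by omega) (by omega) hf h.hy (.inr le_rfl) (by omega) (by omega)
  have hodd5 : ∀ f ∈ S, Pth G (S ∪ T) f y₀ 5 := fun f hf =>
    h.pth_odd (i := 2) (by omega) (by omega) hf h.hy (.inr (by omega)) (by omega) (by omega)
  by_cases ha : (nbS G E (T.erase y₀)).Nonempty
  · refine hE.cycles_drop hA hr hrk (z := y₀) (P := S) (Q := T.erase y₀) (by simp [h.hy]) ?_ hX ha
      (h.disj.mono_right (Finset.erase_subset _ _)) ?_ ?_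
    · intro e _ f hf _
      by_cases hfy : f = y₀
      · exact .inr hfy
      · exact .inl (by simp at hf ⊢; tauto)
    · refine AP.odd r fun i hi p hp q hq => ?_
      exact h.pth_odd (by omega) (by omega) hp (Finset.mem_of_mem_erase hq)
        (.inl fun h' => Finset.ne_of_mem_erase hq h'.2) (by omega) (by omega)
    · exact fun f hf => AP.two (hodd3 f hf) (hodd5 f hf) (.inr rfl)
  have ha' : ∀ e ∈ E, ∀ f ∈ T, G.Adj e f → f = y₀ := fun e he f hf hef => by
    by_contra hfy
    exact ha (nbS_nonempty.2 ⟨e, he, f, Finset.mem_erase.2 ⟨hfy, hf⟩, hef⟩)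
  have hY' : (nbS G E {y₀}).Nonempty := by
    obtain ⟨e, he, f, hf, hef⟩ := nbS_nonempty.1 hY
    exact nbS_nonempty.2 ⟨e, he, f, by simp [ha' e he f hf hef], hef⟩
  by_cases hb : (nbS G E (S.erase x₀)).Nonempty
  · refine hE.cycles_drop hA hr hrk (z := x₀) (P := S.erase x₀) (Q := {y₀}) (by simp [h.hx]) ?_ hb
      hY' ?_ ?_ ?_
    · intro e he f hf hef
      by_cases hfx : f = x₀
      · exact .inr hfx
      · refine .inl ?_
        rcases Finset.mem_union.1 hf with hf | hf
        · simp [hf, hfx]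
        · simp [ha' e he f hf hef]
    · simp [Finset.disjoint_right.1 h.disj h.hy]
    · refine AP.odd r fun i hi p hp q hq => ?_
      obtain rfl := Finset.mem_singleton.1 hq
      exact h.pth_odd (by omega) (by omega) (Finset.mem_of_mem_erase hp) h.hy
        (.inl fun h' => Finset.ne_of_mem_erase hp h'.1) (by omega) (by omega)
    · intro f hf
      have hf' := Finset.mem_of_mem_erase hf
      have hne := Finset.ne_of_mem_erase hf
      have h1 := h.symm.pth_even (i := 1) (by omega) hf' h.hx hne le_rfl (by omega) (by omega)
      have h2 := h.symm.pth_even (i := 2) (by omega) hf' h.hx hne (by omega) (by omega) (by omega)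
      rw [Finset.union_comm] at h1 h2
      exact AP.two (n := 2) (m := 4) h1 h2 (.inr rfl)
  have hb' : ∀ e ∈ E, ∀ f ∈ S, G.Adj e f → f = x₀ := fun e he f hf hef => by
    by_contra hfx
    exact hb (nbS_nonempty.2 ⟨e, he, f, Finset.mem_erase.2 ⟨hfx, hf⟩, hef⟩)
  have hX' : (nbS G E {x₀}).Nonempty := by
    obtain ⟨e, he, f, hf, hef⟩ := nbS_nonempty.1 hX
    exact nbS_nonempty.2 ⟨e, he, f, by simp [hb' e he f hf hef], hef⟩
  have hN : ∀ e ∈ E, ∀ f ∈ S ∪ T, G.Adj e f → f ∈ ({x₀} ∪ {y₀} : Finset V) := by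
    intro e he f hf hef
    rcases Finset.mem_union.1 hf with hf | hf
    · simp [hb' e he f hf hef]
    · simp [ha' e he f hf hef]
  have hxy : Disjoint ({x₀} : Finset V) {y₀} := by simpa using (h.ne h.hx h.hy)
  have hk := hA.hk
  have hAP : AP (HasLen G E (nbS G E {x₀}) (nbS G E {y₀})) (k - 1) := by
    refine paths (E.card + 1) (k - 1) E _ _ (by omega) (nbS_subset _ _ _) (nbS_subset _ _ _)
      (hE.conn_nbS hA hN hX' hY') hE.ne fun v hv => ?_
    have h1 := hE.nb_univ hv
    have h2 := hA.deg v
    have h3 : nb G (S ∪ T) v ≤ nb G {x₀} v + nb G {y₀} v :=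
      nb_le_add v fun u hu hvu => by simpa using hN v hv u hu hvu
    have h4 : ∀ w, nb G {w} v ≤ ind (v ∈ nbS G E {w}) := fun w => by
      by_cases h : G.Adj w v
      · rw [ind_pos (mem_nbS.2 ⟨hv, w, by simp, h⟩)]
        exact (nb_le_card _ _).trans (by simp)
      · rw [nb_eq_zero.2 (by simpa using fun h' => h h'.symm)]; omega
    have h5 := h4 x₀
    have h6 := h4 y₀
    omega
  have hL : AP (fun n => ∀ p ∈ ({x₀} : Finset V), ∀ q ∈ ({y₀} : Finset V),
      Pth G (S ∪ T) p q n) 2 := by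
    refine AP.two (n := 3) (m := 5) ?_ ?_ (.inr rfl)
    · simpa using hodd3 _ h.hx
    · simpa using hodd5 _ h.hx
  exact AP.close hAP hL hE.disj hxy (by omega) (by omega) (by omega)

theorem Cmpl.case_both (h : Cmpl G S T) (hA : Amb G k (S ∪ T) r) (hrk : r ≤ k) (hS : r ≤ S.card)
    (hT : r ≤ T.card) (hE : Piece G (S ∪ T) E) (hX : (nbS G E S).Nonempty)
    (hY : (nbS G E T).Nonempty) : AP (HasCycleLen G) k :=
  hE.cycles hA hrk (fun _ _ _ hf _ => hf) hX hY h.disj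
    (AP.odd r fun _ hi _ hp _ hq => pth_odd h hp hq (by omega) (by omega))

/-- A piece attached to one side `T` only splits its attachments. -/
theorem Piece.one_side (hA : Amb G k (S ∪ T) r) (hE : Piece G (S ∪ T) E)
    (hX : ¬(nbS G E S).Nonempty) (hSne : S.Nonempty) :
    ∃ f₁ ∈ T, (nbS G E {f₁}).Nonempty ∧ (nbS G E (T.erase f₁)).Nonempty ∧
      ∀ e ∈ E, ∀ f ∈ S ∪ T, G.Adj e f → f ∈ {f₁} ∪ T.erase f₁ := by
  obtain ⟨x, hx⟩ := hSne
  have hX' : ∀ e ∈ E, ∀ f ∈ S, ¬G.Adj e f := fun e he f hf h => hX (nbS_nonempty.2 ⟨e, he, f, hf, h⟩)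
  obtain ⟨f₁, hf₁, f₂, hf₂, h12, h1, h2⟩ :=
    hE.two_attach hA ⟨x, by simp [hx], fun e he => hX' e he x hx⟩
  have key : ∀ f ∈ S ∪ T, (nbS G E {f}).Nonempty → f ∈ T := by
    intro f hf hne
    obtain ⟨e, he, f', hf', hef⟩ := nbS_nonempty.1 hne
    obtain rfl := Finset.mem_singleton.1 hf'
    exact (Finset.mem_union.1 hf).resolve_left fun h => hX' e he _ h hef
  have h2' : (nbS G E (T.erase f₁)).Nonempty := by
    obtain ⟨e, he, f, hf, hef⟩ := nbS_nonempty.1 h2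
    obtain rfl := Finset.mem_singleton.1 hf
    exact nbS_nonempty.2 ⟨e, he, f, Finset.mem_erase.2 ⟨h12.symm, key _ hf₂ h2⟩, hef⟩
  refine ⟨f₁, key f₁ hf₁ h1, h1, h2', ?_⟩
  intro e he g hg heg
  have hgT := (Finset.mem_union.1 hg).resolve_left fun h => hX' e he g h heg
  by_cases hgf : g = f₁
  · simp [hgf]
  · simp [hgf, hgT]

theorem AP.close_one {f₁ : V} {m n l : ℕ} (hf : f₁ ∈ T)
    (h : AP (HasLen G E (nbS G E {f₁}) (nbS G E (T.erase f₁))) m)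
    (hL : AP (fun n => ∀ p ∈ T, ∀ q ∈ T, p ≠ q → Pth G F p q n) n) (hEF : Disjoint E F)
    (hm : 1 ≤ m) (hn : 1 ≤ n) (hl : l ≤ m + n - 1) : AP (HasCycleLen G) l := by
  refine h.close (hL.mono fun n hn p hp q hq => ?_) hEF (by simp) hm hn hl
  obtain rfl := Finset.mem_singleton.1 hp
  exact hn p hf q (Finset.mem_of_mem_erase hq) (Finset.ne_of_mem_erase hq).symm

/-- A piece attached to one side `T` only, with enough paths between vertices of `T`. -/
theorem Piece.case_one (hA : Amb G k (S ∪ T) r) (hrk : r ≤ k) (hE : Piece G (S ∪ T) E)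
    (hX : ¬(nbS G E S).Nonempty) (hSne : S.Nonempty) (hEF : Disjoint E F)
    (hL : AP (fun n => ∀ p ∈ T, ∀ q ∈ T, p ≠ q → Pth G F p q n) r) :
    AP (HasCycleLen G) k := by
  obtain ⟨f₁, hf, h1, h2, h3⟩ := hE.one_side hA hX hSne
  have := hA.hr
  exact AP.close_one hf (hE.attach hA hrk h3 h1 h2) hL hEF (by omega) (by omega) (by omega)

end

section

variable [Fintype V] {k r : ℕ} {F E E' P Q S T : Finset V} {x₀ y₀ : V}

theorem Piece.disjoint_of_ne (hE : Piece G F E) (hE' : Piece G F E') (h : E ≠ E') :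
    Disjoint E E' := by
  by_contra hd
  have hne : (E ∩ E').Nonempty := by
    rwa [Finset.nonempty_iff_ne_empty, ne_eq, ← Finset.disjoint_iff_inter_eq_empty]
  have h1 := hE.conn (E ∩ E') Finset.inter_subset_left hne fun d hd c hc hdc =>
    Finset.mem_inter.2 ⟨hc, (hE'.closed d (Finset.mem_inter.1 hd).2 c hdc).resolve_right
      (Finset.disjoint_left.1 hE.disj hc)⟩
  have h2 := hE'.conn (E ∩ E') Finset.inter_subset_right hne fun d hd c hc hdc =>
    Finset.mem_inter.2 ⟨(hE.closed d (Finset.mem_inter.1 hd).1 c hdc).resolve_right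
      (Finset.disjoint_left.1 hE'.disj hc), hc⟩
  exact h (h1.symm.trans h2)

/-- Paths between vertices of `S` using an edge in `T`. -/
theorem KM.pth_edge (h : KM G S T x₀ y₀) (hr : 2 ≤ r) (hS : r ≤ S.card) (hT : r ≤ T.card)
    (hTe : HasEdge G T) {p q : V} (hp : p ∈ S) (hq : q ∈ S) (hpq : p ≠ q) {n : ℕ} (hn : 2 ≤ n)
    (hnr : n ≤ r + 1) : Pth G (S ∪ T) p q n := by
  rcases Nat.even_or_odd' n with ⟨i, rfl | rfl⟩
  · exact (AdmissiblePaths.pth_even h.left hp hq hpq (by omega) (by omega)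
      (by rw [Finset.card_erase_of_mem h.hy]; omega)).mono h.sub_left
  obtain ⟨t, ht, t', ht', hne, htt⟩ : ∃ t ∈ T, ∃ t' ∈ T, t' ≠ y₀ ∧ G.Adj t t' := by
    obtain ⟨a, ha, b, hb, hab⟩ := hTe
    by_cases hby : b = y₀
    · exact ⟨b, hb, a, ha, fun e => hab.ne (e.trans hby.symm), hab.symm⟩
    · exact ⟨a, ha, b, hb, hby, hab⟩
  have key : ∀ p ∈ S, ∀ q ∈ S, p ≠ q → p ≠ x₀ → Pth G (S ∪ T) p q (2 * i + 1) := by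
    intro p hp q hq hpq hpx
    have hmem : t' ∈ (T.erase y₀).erase t := by simp [htt.ne', hne, ht']
    have hc : T.card ≤ ((T.erase y₀).erase t).card + 2 := by
      have h1 := Finset.pred_card_le_card_erase (s := T) (a := y₀)
      have h2 := Finset.pred_card_le_card_erase (s := T.erase y₀) (a := t)
      omega
    have hc1 := Finset.card_pos.2 ⟨t', hmem⟩
    have h1 := AdmissiblePaths.pth_odd (i := i - 1)
      (h.left.symm.mono (Finset.erase_subset t _) (Finset.erase_subset p _)) hmem
      (Finset.mem_erase.2 ⟨hpq.symm, hq⟩) (by omega)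
      (by rw [Finset.card_erase_of_mem hp]; omega)
    have h2 := h1.cons' (w := t) (by simp [Finset.disjoint_right.1 h.disj ht]) htt
    have h3 := h2.cons' (w := p) (by
      simp [Finset.disjoint_left.1 h.disj hp, h.ne hp ht])
      (h.adj p hp t ht fun h' => hpx h'.1)
    rw [show 2 * i + 1 = 2 * (i - 1) + 1 + 1 + 1 by omega]
    refine h3.mono fun x hx => ?_
    simp only [Finset.mem_insert, Finset.mem_union, Finset.mem_erase] at hx ⊢
    rcases hx with rfl | rfl | hx | hx
    exacts [.inl hp, .inr ht, .inr hx.2.2, .inl hx.2]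
  by_cases hpx : p = x₀
  · exact (key q hq p hp hpq.symm fun e => hpq (hpx.trans e.symm)).symm
  · exact key p hp q hq hpq hpx

/-- Paths between vertices of `S` using a piece attached to `T`. -/
theorem KM.pth_piece (h : KM G S T x₀ y₀) (hr : 2 ≤ r) (hS : r ≤ S.card) (hT : r ≤ T.card)
    (hE : Piece G (S ∪ T) E) {m : ℕ} (hm : 1 ≤ m)
    (hL : AP (HasLen G E (nbS G E (T.erase y₀)) (nbS G E {y₀})) m) :
    AP (fun n => ∀ p ∈ S, ∀ q ∈ S, p ≠ q → Pth G (S ∪ T ∪ E) p q n) (r - 1 + m - 1) := by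
  have h0 : AP (fun n => ∃ i < r - 1, n = 2 * i + 1) (r - 1) := AP.odd _ fun i hi => ⟨i, hi, rfl⟩
  refine AP.add 3 h0 hL (by omega) hm ?_
  rintro a b ⟨i, hi, rfl⟩ ⟨u, hu, v, hv, huv⟩
  obtain ⟨t, ht, htu⟩ := (mem_nbS.1 hu).2
  obtain ⟨y, hy, hyv⟩ := (mem_nbS.1 hv).2
  obtain rfl := Finset.mem_singleton.1 hy
  have key : ∀ p ∈ S, ∀ q ∈ S, p ≠ q → q ≠ x₀ → Pth G (S ∪ T ∪ E) p q (2 * i + 1 + b + 3) := by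
    intro p hp q hq hpq hqx
    have hyT := h.hy
    have hqE : q ∉ E := Finset.disjoint_right.1 hE.disj (by simp [hq])
    have hyE : y ∉ E := Finset.disjoint_right.1 hE.disj (by simp [hyT])
    have h1 := AdmissiblePaths.pth_odd (i := i)
      (h.left.mono (Finset.erase_subset q _) subset_rfl) (Finset.mem_erase.2 ⟨hpq, hp⟩) ht
      (by rw [Finset.card_erase_of_mem hq]; omega) (by rw [Finset.card_erase_of_mem hyT]; omega)
    have h2 := h1.concat huv (hE.disj.symm.mono_left (Finset.union_subset_union
      (Finset.erase_subset _ _) (Finset.erase_subset _ _))) htu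
    have h3 := h2.snoc (w := y) (by simp [hyE, Finset.disjoint_right.1 h.disj hyT]) hyv.symm
    have h4 := h3.snoc (w := q) (by
      simp [hqE, Finset.disjoint_left.1 h.disj hq, h.ne hq hyT])
      (h.adj q hq y hyT fun h' => hqx h'.1).symm
    rw [show 2 * i + 1 + b + 3 = 2 * i + 1 + b + 1 + 1 + 1 by omega]
    refine h4.mono fun x hx => ?_
    simp only [Finset.mem_insert, Finset.mem_union, Finset.mem_erase] at hx ⊢
    rcases hx with rfl | rfl | (hx | hx) | hx
    exacts [.inl (.inl hq), .inl (.inr hyT), .inl (.inl hx.2), .inl (.inr hx.2), .inr hx]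
  intro p hp q hq hpq
  by_cases hqx : q = x₀
  · exact (key q hq p hp hpq.symm fun e => hpq (e.trans hqx.symm)).symm
  · exact key p hp q hq hpq hqx

/-- A piece attached to a smallest side `S` only, when `S` has fewer than `k` vertices. -/
theorem KM.case_small (h : KM G S T x₀ y₀) (hA : Amb G k (S ∪ T) r) (hrk : r < k)
    (hS : S.card = r) (hT : r ≤ T.card) (hE : Piece G (S ∪ T) E) (hX : ¬(nbS G E T).Nonempty)
    (hboth : ∀ E', Piece G (S ∪ T) E' → (nbS G E' S).Nonempty → (nbS G E' T).Nonempty →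
      AP (HasCycleLen G) k) : AP (HasCycleLen G) k := by
  have hr := hA.hr
  have hA' := hA
  have hE₁ := hE
  rw [Finset.union_comm] at hA' hE₁
  by_cases hTe : HasEdge G T
  · refine hE₁.case_one hA' hrk.le hX ⟨y₀, h.hy⟩ hE.disj ⟨2, 1, .inl rfl, ?_⟩
    intro i hi p hp q hq hpq
    exact h.pth_edge hr (by omega) hT hTe hp hq hpq (by omega) (by omega)
  obtain ⟨w, hw, hyw⟩ : ∃ w, w ∉ S ∪ T ∧ G.Adj y₀ w := by
    by_contra hcon
    push Not at hcon
    have h1 := hA.deg y₀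
    have h2 : nb G Finset.univ y₀ ≤ nb G S y₀ + nb G T y₀ := nb_le_add y₀ fun u _ hu => by
      by_contra h3
      exact hcon u (by simpa using h3) hu
    have h3 := nb_le_card (G := G) S y₀
    have h4 : nb G T y₀ = 0 := nb_eq_zero.2 fun u hu hyu => hTe ⟨y₀, h.hy, u, hu, hyu⟩
    omega
  obtain ⟨E', hwE, hE'⟩ := exists_piece (G := G) hw
  have hyE' : (nbS G E' {y₀}).Nonempty := nbS_nonempty.2 ⟨w, hwE, y₀, by simp, hyw.symm⟩
  have hTE' : (nbS G E' T).Nonempty := nbS_nonempty.2 ⟨w, hwE, y₀, h.hy, hyw.symm⟩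
  by_cases hSE : (nbS G E' S).Nonempty
  · exact hboth E' hE' hSE hTE'
  have hSE' : ∀ e ∈ E', ∀ f ∈ S, ¬G.Adj e f := fun e he f hf hef =>
    hSE (nbS_nonempty.2 ⟨e, he, f, hf, hef⟩)
  have hQ : (nbS G E' (T.erase y₀)).Nonempty := by
    obtain ⟨f₁, hf₁, f₂, hf₂, h12, h1, h2⟩ :=
      hE'.two_attach hA ⟨x₀, by simp [h.hx], fun e he => hSE' e he x₀ h.hx⟩
    have key : ∀ f ∈ S ∪ T, (nbS G E' {f}).Nonempty → f ≠ y₀ → (nbS G E' (T.erase y₀)).Nonempty := by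
      intro f hf hne hfy
      obtain ⟨e, he, f', hf', hef⟩ := nbS_nonempty.1 hne
      obtain rfl := Finset.mem_singleton.1 hf'
      have := (Finset.mem_union.1 hf).resolve_left fun h => hSE' e he _ h hef
      exact nbS_nonempty.2 ⟨e, he, f', Finset.mem_erase.2 ⟨hfy, this⟩, hef⟩
    by_cases h1y : f₁ = y₀
    · exact key f₂ hf₂ h2 fun e => h12 (h1y.trans e.symm)
    · exact key f₁ hf₁ h1 h1y
  have hL := hE'.attach hA hrk.le (P := T.erase y₀) (Q := {y₀}) (fun e he f hf hef => by
    have hfT := (Finset.mem_union.1 hf).resolve_left fun h => hSE' e he _ h hef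
    by_cases hfy : f = y₀
    · simp [hfy]
    · simp [hfy, hfT]) hQ hyE'
  have hEE : E ≠ E' := fun e => hX (e ▸ hTE')
  refine hE₁.case_one hA' hrk.le hX ⟨y₀, h.hy⟩ (F := S ∪ T ∪ E')
    (Finset.disjoint_union_right.2 ⟨hE.disj, hE.disjoint_of_ne hE' hEE⟩)
    ((h.pth_piece hr hS.ge hT hE' (by omega) hL).le (by omega))

end

section

variable [Fintype V] {k r : ℕ} {F E D X Y P Q S T : Finset V} {x₀ y₀ : V}

theorem Conn.of_connected (hX : X.Nonempty) (hY : Y.Nonempty) (hXD : X ⊆ D) (hYD : Y ⊆ D)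
    (hD : ∀ D' ⊆ D, D'.Nonempty → Closed G D D' → D' = D)
    (h2 : ∀ D' ⊆ D, D'.Nonempty → (¬∃ v ∈ D', v ∈ X) → (¬∃ v ∈ D', v ∈ Y) → 2 ≤ (bd G D D').card) :
    Conn G D X Y := by
  intro D' hD' hne
  by_cases hDD : D' = D
  · subst hDD
    obtain ⟨x, hx⟩ := hX
    obtain ⟨y, hy⟩ := hY
    rw [ind_pos ⟨x, hXD hx, hx⟩, ind_pos ⟨y, hYD hy, hy⟩]
    omega
  have h1 : 1 ≤ (bd G D D').card := by
    by_contra h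
    exact hDD (hD D' hD' hne (closed_iff_bd.2 (Finset.card_eq_zero.1 (by omega))))
  by_cases hx : ∃ v ∈ D', v ∈ X
  · rw [ind_pos hx]; omega
  by_cases hy : ∃ v ∈ D', v ∈ Y
  · rw [ind_pos hy]; omega
  have := h2 D' hD' hne hx hy
  omega

/-- Paths of all even lengths between two vertices of `S`. -/
theorem KM.pth_even_left (h : KM G S T x₀ y₀) (hST : S.card ≤ T.card) {p q : V}
    (hp : p ∈ S) (hq : q ∈ S) (hpq : p ≠ q) {i : ℕ} (hi1 : 1 ≤ i) (hi : i < S.card) :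
    Pth G (S ∪ T) p q (2 * i) :=
  (AdmissiblePaths.pth_even h.left hp hq hpq hi1 hi
    (by rw [Finset.card_erase_of_mem h.hy]; omega)).mono h.sub_left

/-- A piece attached only to a side `S` with exactly `k` vertices. -/
theorem KM.case_tight (h : KM G S T x₀ y₀) (hA : Amb G k (S ∪ T) k) (hS : S.card = k)
    (hT : k ≤ T.card) (hE : Piece G (S ∪ T) E) (hX : ¬(nbS G E T).Nonempty) :
    AP (HasCycleLen G) k := by
  have hk := hA.hk
  have hA' := hA
  have hE₁ := hE
  rw [Finset.union_comm] at hA' hE₁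
  have hTE : ∀ e ∈ E, ∀ f ∈ T, ¬G.Adj e f := fun e he f hf hef =>
    hX (nbS_nonempty.2 ⟨e, he, f, hf, hef⟩)
  have hd := hE.disj
  have hSE : ∀ {s}, s ∈ S → s ∉ E := fun hs => Finset.disjoint_right.1 hd (by simp [hs])
  have hTE' : ∀ {s}, s ∈ T → s ∉ E := fun hs => Finset.disjoint_right.1 hd (by simp [hs])
  have hEF : ∀ {e}, e ∈ E → e ∉ S ∪ T := fun he => Finset.disjoint_left.1 hd he
  have hdeg : ∀ v ∈ E, k ≤ nb G E v + nb G S v := fun v hv => by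
    have h1 := hE.nb_univ hv
    have h2 := hA.deg v
    have h3 := nb_union_le (G := G) S T v
    rw [nb_eq_zero.2 (hTE v hv)] at h3
    omega
  have hout : ∀ v ∈ E, nb G S v + 1 ≤ k := fun v hv => by
    have h1 := hA.out v (hEF hv)
    have h2 := nb_mono (G := G) (Finset.subset_union_left (s₁ := S) (s₂ := T)) v
    omega
  have heven := fun {p q : V} hp hq hpq {i : ℕ} hi1 hi =>
    h.pth_even_left (by omega) (p := p) (q := q) hp hq hpq (i := i) hi1 hi
  by_cases hL0 : ∀ v ∈ E, 2 ≤ nb G E v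
  · obtain ⟨f₁, hf, h1, h2, h3⟩ := hE₁.one_side hA' hX ⟨y₀, h.hy⟩
    refine AP.close_one (m := 2) (n := k - 1) hf ?_ (F := S ∪ T) ?_ hd (by omega) (by omega)
      (by omega)
    · refine two_paths E _ _ f₁ (nbS_subset _ _ _) (nbS_subset _ _ _)
        (hE₁.conn_nbS hA' h3 h1 h2) (fun v hv _ => ?_)
        (by obtain ⟨e, he⟩ := hE.ne; exact ⟨e, he, fun e' => hSE hf (e' ▸ he)⟩)
      have h4 := hL0 v hv
      have h5 := hdeg v hv
      by_cases h0 : nb G S v = 0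
      · omega
      obtain ⟨f, hf, hvf⟩ := nb_pos.1 (Nat.pos_of_ne_zero h0)
      rcases Finset.mem_union.1 (h3 v hv f (by simp [hf]) hvf) with h | h
      · rw [ind_pos (p := v ∈ nbS G E {f₁}) (mem_nbS.2 ⟨hv, f, h, hvf.symm⟩)]; omega
      · rw [ind_pos (p := v ∈ nbS G E (S.erase f₁)) (mem_nbS.2 ⟨hv, f, h, hvf.symm⟩)]; omega
    · exact AP.even _ fun i hi1 hi p hp q hq hpq => heven hp hq hpq hi1 (by omega)
  -- vertices of degree one in `E`
  set L : Finset V := E.filter fun v => nb G E v ≤ 1 with hLdef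
  have hLE : L ⊆ E := Finset.filter_subset _ _
  have hmemL : ∀ {v}, v ∈ L ↔ v ∈ E ∧ nb G E v ≤ 1 := by simp [hLdef]
  have hLS : ∀ {u}, u ∈ L → k ≤ nb G S u + 1 := fun hu => by
    have := hdeg _ (hmemL.1 hu).1
    have := (hmemL.1 hu).2
    omega
  have huniq : ∀ {u}, u ∈ L → ∀ a ∈ E, ∀ b ∈ E, G.Adj u a → G.Adj u b → a = b := by
    intro u hu a ha b hb hua hub
    exact Finset.card_le_one.1 (hmemL.1 hu).2 a (mem_nbs.2 ⟨ha, hua⟩) b (mem_nbs.2 ⟨hb, hub⟩)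
  have hsupp : ∀ {u}, u ∈ L → ∃ w ∈ E, G.Adj u w := fun hu => nb_pos.1 (by
    have := hLS hu
    have := hdeg _ (hmemL.1 hu).1
    have := hout _ (hmemL.1 hu).1
    omega)
  have hnbr : ∀ {u}, u ∈ L → ∀ p, ∃ s ∈ S, s ≠ p ∧ G.Adj u s := fun {u} hu p => by
    obtain ⟨s, hs, hsp⟩ := Finset.exists_mem_ne (show 1 < (nbs G S u).card by
      have := hLS hu
      change 1 < nb G S u; omega) p
    exact ⟨s, (mem_nbs.1 hs).1, hsp, (mem_nbs.1 hs).2⟩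
  obtain ⟨u₀, hu₀⟩ : L.Nonempty := by
    push Not at hL0
    obtain ⟨v, hv, hlt⟩ := hL0
    exact ⟨v, hmemL.2 ⟨hv, by omega⟩⟩
  have hleaf : ∀ {u}, u ∈ L → ∀ q ∈ S, ∀ i, 1 ≤ i → i < S.card →
      Pth G (insert u (S ∪ T)) u q (2 * i + 1) := by
    intro u hu q hq i hi1 hi
    obtain ⟨s, hs, hsq, hus⟩ := hnbr hu q
    exact (heven hs hq hsq hi1 hi).cons' (hEF (hLE hu)) hus
  have hleafcyc : ∀ j, 2 ≤ j → j ≤ k → HasCycleLen G (2 * j) := by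
    intro j hj hjk
    obtain ⟨q, hq, -, huq⟩ := hnbr hu₀ u₀
    have := (hleaf hu₀ q hq (j - 1) (by omega) (by omega)).cycle (by omega) huq.symm
    rwa [show 2 * (j - 1) + 1 + 1 = 2 * j by omega] at this
  by_cases hadj : ∃ u ∈ L, ∃ v ∈ L, G.Adj u v
  · obtain ⟨u, hu, v, hv, huv⟩ := hadj
    refine ⟨4, 1, .inl rfl, fun i hi => ?_⟩
    rcases Nat.even_or_odd' (4 + i * 1) with ⟨j, hj | hj⟩
    · rw [hj]; exact hleafcyc j (by omega) (by omega)
    · obtain ⟨q, hq, -, huq⟩ := hnbr hu u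
      have h1 := (hleaf hv q hq (j - 1) (by omega) (by omega)).cons' (w := u)
        (by rw [Finset.mem_insert, not_or]; exact ⟨huv.ne, hEF (hLE hu)⟩) huv
      have := h1.cycle (by omega) huq.symm
      rw [hj]
      rwa [show 2 * (j - 1) + 1 + 1 + 1 = 2 * j + 1 by omega] at this
  push Not at hadj
  by_cases hsame : ∃ u ∈ L, ∃ v ∈ L, u ≠ v ∧ ∃ w ∈ E, G.Adj u w ∧ G.Adj v w
  · obtain ⟨u, hu, v, hv, huv, w, hw, huw, hvw⟩ := hsame
    refine ⟨4, 2, .inr rfl, fun i hi => ?_⟩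
    rw [show 4 + i * 2 = 2 * (i + 2) by omega]
    by_cases hik : i + 2 ≤ k
    · exact hleafcyc _ (by omega) hik
    obtain ⟨q, hq, -, huq⟩ := hnbr hu u
    have h1 := hleaf hv q hq (k - 1) (by omega) (by omega)
    have h2 := h1.cons' (w := w) (by
      rw [Finset.mem_insert, not_or]; exact ⟨hvw.ne', hEF hw⟩) hvw.symm
    have h3 := h2.cons' (w := u) (by
      simp only [Finset.mem_insert, not_or]; exact ⟨huw.ne, huv, hEF (hLE hu)⟩) huw
    have := h3.cycle (by omega) huq.symm
    rwa [show 2 * (k - 1) + 1 + 1 + 1 + 1 = 2 * (i + 2) by omega] at this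
  push Not at hsame
  set E₀ := E \ L with hE₀
  have hE₀E : E₀ ⊆ E := Finset.sdiff_subset
  have hmem₀ : ∀ {v}, v ∈ E₀ ↔ v ∈ E ∧ v ∉ L := by simp [hE₀]
  have hsupp₀ : ∀ {u}, u ∈ L → ∃ w ∈ E₀, G.Adj u w := fun {u} hu => by
    obtain ⟨w, hw, huw⟩ := hsupp hu
    exact ⟨w, hmem₀.2 ⟨hw, fun hwL => hadj u hu w hwL huw⟩, huw⟩
  have hconn₀ : ∀ D ⊆ E₀, D.Nonempty → Closed G E₀ D → D = E₀ := by
    intro D hD hne hc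
    have := hE.conn (D ∪ nbS G L D) (Finset.union_subset (hD.trans hE₀E)
      ((nbS_subset _ _ _).trans hLE)) (hne.mono Finset.subset_union_left) ?_
    · refine hD.antisymm fun x hx => ?_
      have hx' := (hmem₀.1 hx)
      rw [← this] at hx'
      exact (Finset.mem_union.1 hx'.1).resolve_right fun h => hx'.2 (nbS_subset _ _ _ h)
    · intro d hd c hcE hdc
      rcases Finset.mem_union.1 hd with hd | hd
      · by_cases hcL : c ∈ L
        · exact Finset.mem_union_right _ (mem_nbS.2 ⟨hcL, d, hd, hdc⟩)
        · exact Finset.mem_union_left _ (hc d hd c (hmem₀.2 ⟨hcE, hcL⟩) hdc)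
      · obtain ⟨hdL, e, he, hed⟩ := mem_nbS.1 hd
        rw [huniq hdL c hcE e (hE₀E (hD he)) hdc hed.symm]
        exact Finset.mem_union_left _ he
  have hnbL : ∀ v ∈ E₀, nb G E v = nb G E₀ v + nb G L v := by
    intro v _
    rw [hE₀, ← nb_union (Finset.sdiff_disjoint (s := L) (t := E)),
      Finset.sdiff_union_of_subset hLE]
  have hnbL1 : ∀ v ∈ E₀, nb G L v ≤ 1 := by
    intro v hv
    by_contra hlt
    obtain ⟨a, ha, b, hb, hab⟩ := Finset.one_lt_card.1 (show 1 < (nbs G L v).card by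
      change 1 < nb G L v; omega)
    obtain ⟨ha, hva⟩ := mem_nbs.1 ha
    obtain ⟨hb, hvb⟩ := mem_nbs.1 hb
    exact hsame a ha b hb hab v (hE₀E hv) hva.symm hvb.symm
  have h2E₀ : ∀ v ∈ E₀, 2 ≤ nb G E v := fun v hv => by
    by_contra hlt
    exact (hmem₀.1 hv).2 (hmemL.2 ⟨hE₀E hv, by omega⟩)
  have hbd₀ : ∀ D ⊆ E₀, D.Nonempty → (∀ d ∈ D, ∀ s ∈ S, ¬G.Adj d s) →
      (∀ d ∈ D, ∀ u ∈ L, ¬G.Adj d u) → 2 ≤ (bd G E₀ D).card := by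
    intro D hD hne hDS hDL
    refine (hE.two_le_bd hA (hD.trans hE₀E) hne fun d hd f hf => ?_).trans
      (Finset.card_le_card fun x hx => ?_)
    · exact (Finset.mem_union.1 hf).elim (hDS d hd f) (hTE d (hE₀E (hD hd)) f)
    · obtain ⟨⟨hxE, hxD⟩, d, hd, hdx⟩ := mem_bd.1 hx
      exact mem_bd.2 ⟨⟨hmem₀.2 ⟨hxE, fun hxL => hDL d hd x hxL hdx⟩, hxD⟩, d, hd, hdx⟩
  have hd₀ : Disjoint E₀ (S ∪ T ∪ L) :=
    Finset.disjoint_union_right.2 ⟨hd.mono_left hE₀E, Finset.sdiff_disjoint⟩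
  obtain ⟨w₀, hw₀, huw₀⟩ := hsupp₀ hu₀
  by_cases hS₀ : (nbS G E₀ S).Nonempty
  · refine AP.close (m := 2) (n := k - 1) (E := E₀) (F := S ∪ T ∪ L) (P := L) (Q := S) ?_ ?_ hd₀
      ?_ (by omega) (by omega) (by omega)
    · refine two_paths E₀ _ _ x₀ (nbS_subset _ _ _) (nbS_subset _ _ _)
        (Conn.of_connected ⟨w₀, mem_nbS.2 ⟨hw₀, u₀, hu₀, huw₀⟩⟩ hS₀ (nbS_subset _ _ _)
          (nbS_subset _ _ _) hconn₀ ?_) (fun v hv _ => ?_)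
        ⟨w₀, hw₀, fun e => hSE h.hx (e ▸ hE₀E hw₀)⟩
      · intro D hD hne hDL hDS
        refine hbd₀ D hD hne (fun d hd s hs hds => ?_) (fun d hd s hs hds => ?_)
        · exact hDS ⟨d, hd, mem_nbS.2 ⟨hD hd, s, hs, hds.symm⟩⟩
        · exact hDL ⟨d, hd, mem_nbS.2 ⟨hD hd, s, hs, hds.symm⟩⟩
      · have h1 := hnbL v hv
        have h2 := nb_le_ind (hnbL1 v hv)
        have h3 : ind (∃ u ∈ L, G.Adj u v) ≤ ind (v ∈ nbS G E₀ L) :=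
          ind_mono fun ⟨u, hu, huv⟩ => mem_nbS.2 ⟨hv, u, hu, huv⟩
        have h4 := h2E₀ v hv
        have h5 := hdeg v (hE₀E hv)
        by_cases h0 : nb G S v = 0
        · omega
        obtain ⟨s, hs, hvs⟩ := nb_pos.1 (Nat.pos_of_ne_zero h0)
        rw [ind_pos (p := v ∈ nbS G E₀ S) (mem_nbS.2 ⟨hv, s, hs, hvs.symm⟩)]
        omega
    · refine ⟨3, 2, .inr rfl, fun i hi p hp q hq => ?_⟩
      have := hleaf hp q hq (i + 1) (by omega) (by omega)
      rw [show 3 + i * 2 = 2 * (i + 1) + 1 by omega]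
      refine this.mono fun x hx => ?_
      rcases Finset.mem_insert.1 hx with rfl | hx
      exacts [Finset.mem_union_right _ hp, Finset.mem_union_left _ hx]
    · exact Finset.disjoint_left.2 fun x hx hx' => hSE hx' (hLE hx)
  have hS₀' : ∀ d ∈ E₀, ∀ s ∈ S, ¬G.Adj d s := fun d hd s hs hds =>
    hS₀ (nbS_nonempty.2 ⟨d, hd, s, hs, hds⟩)
  have hL2 : (nbS G E₀ (L.erase u₀)).Nonempty := by
    by_contra hL2
    have := hA.two E₀ ⟨w₀, hw₀⟩ ⟨x₀, fun hx => hSE h.hx (hE₀E hx), fun hx => by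
      obtain ⟨-, d, hd, hdx⟩ := mem_bd.1 hx
      exact hS₀' d hd x₀ h.hx hdx⟩
    have h1 : bd G Finset.univ E₀ ⊆ {u₀} := fun x hx => by
      obtain ⟨⟨-, hx⟩, d, hd, hdx⟩ := mem_bd.1 hx
      rcases hE.closed d (hE₀E hd) x hdx with h | h
      · have hxL : x ∈ L := by
          by_contra hxL
          exact hx (hmem₀.2 ⟨h, hxL⟩)
        rw [Finset.mem_singleton]
        by_contra hxu
        exact hL2 (nbS_nonempty.2 ⟨d, hd, x, Finset.mem_erase.2 ⟨hxu, hxL⟩, hdx⟩)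
      · exact ((Finset.mem_union.1 h).elim (fun h => hS₀' d hd x h hdx)
          (fun h => hTE d (hE₀E hd) x h hdx)).elim
    have := Finset.card_le_card h1
    simp at this
    omega
  refine AP.close_one (m := 2) (n := k - 1) (E := E₀) (F := S ∪ T ∪ L) hu₀ ?_ ?_ hd₀
    (by omega) (by omega) (by omega)
  · refine two_paths E₀ _ _ x₀ (nbS_subset _ _ _) (nbS_subset _ _ _)
      (Conn.of_connected ⟨w₀, mem_nbS.2 ⟨hw₀, u₀, by simp, huw₀⟩⟩ hL2 (nbS_subset _ _ _)
        (nbS_subset _ _ _) hconn₀ ?_) (fun v hv _ => ?_)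
      ⟨w₀, hw₀, fun e => hSE h.hx (e ▸ hE₀E hw₀)⟩
    · intro D hD hne hDu hDL
      refine hbd₀ D hD hne (fun d hd => hS₀' d (hD hd)) (fun d hd s hs hds => ?_)
      by_cases hsu : s = u₀
      · exact hDu ⟨d, hd, mem_nbS.2 ⟨hD hd, s, by simp [hsu], hds.symm⟩⟩
      · exact hDL ⟨d, hd, mem_nbS.2 ⟨hD hd, s, Finset.mem_erase.2 ⟨hsu, hs⟩, hds.symm⟩⟩
    · have h1 := hnbL v hv
      have h2 := nb_le_ind (hnbL1 v hv)
      have h3 : ind (∃ u ∈ L, G.Adj u v) ≤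
          ind (v ∈ nbS G E₀ {u₀}) + ind (v ∈ nbS G E₀ (L.erase u₀)) := by
        by_cases h : ∃ u ∈ L, G.Adj u v
        · obtain ⟨u, hu, huv⟩ := h
          have := ind_le_one (∃ u ∈ L, G.Adj u v)
          by_cases huu : u = u₀
          · rw [ind_pos (p := v ∈ nbS G E₀ {u₀}) (mem_nbS.2 ⟨hv, u, by simp [huu], huv⟩)]; omega
          · rw [ind_pos (p := v ∈ nbS G E₀ (L.erase u₀))
              (mem_nbS.2 ⟨hv, u, Finset.mem_erase.2 ⟨huu, hu⟩, huv⟩)]; omega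
        · rw [ind_neg h]; omega
      have h5 := hdeg v (hE₀E hv)
      have h0 : nb G S v = 0 := nb_eq_zero.2 (hS₀' v hv)
      omega
  · refine ⟨4, 2, .inr rfl, fun i hi p hp q hq hpq => ?_⟩
    obtain ⟨s, hs, -, hqs⟩ := hnbr hq q
    have h1 := (hleaf hp s hs (i + 1) (by omega) (by omega)).snoc (w := q) (by
      rw [Finset.mem_insert, not_or]; exact ⟨hpq.symm, hEF (hLE hq)⟩) hqs.symm
    rw [show 4 + i * 2 = 2 * (i + 1) + 1 + 1 by omega]
    refine h1.mono fun x hx => ?_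
    simp only [Finset.mem_insert] at hx
    rcases hx with rfl | rfl | hx
    exacts [Finset.mem_union_right _ hq, Finset.mem_union_right _ hp, Finset.mem_union_left _ hx]

end

theorem Pth.ne_of_pos {A : Finset V} {u v : V} {n : ℕ} (h : Pth G A u v n) (hn : 1 ≤ n) :
    u ≠ v := by
  rintro rfl
  cases h with
  | nil => omega
  | cons _ _ h' => exact Finset.notMem_erase _ _ h'.end_mem

/-- Greedy paths. -/
theorem exists_greedy_pth {T : Finset V} {d : ℕ} (hd : ∀ v ∈ T, d ≤ nb G T v) {v : V} (hv : v ∈ T)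
    (l : ℕ) (hl : l ≤ d) : ∃ A ⊆ T, A.card = l + 1 ∧ ∃ q, Pth G A v q l := by
  induction l with
  | zero => exact ⟨{v}, by simpa using hv, by simp, v, .nil (by simp)⟩
  | succ l ih =>
    obtain ⟨A, hA, hcard, q, hq⟩ := ih (by omega)
    have h1 := hd q (hA hq.end_mem)
    have h2 : nb G A q ≤ l := by
      have : nbs G A q ⊆ A.erase q := fun x hx => by
        obtain ⟨hx, hqx⟩ := mem_nbs.1 hx
        exact Finset.mem_erase.2 ⟨hqx.ne', hx⟩
      have := Finset.card_le_card this
      rw [Finset.card_erase_of_mem hq.end_mem] at this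
      change nb G A q ≤ _ at this
      omega
    have h3 := nb_union (G := G) (Finset.disjoint_sdiff (s := A) (t := T)) q
    rw [Finset.union_sdiff_of_subset hA] at h3
    obtain ⟨w, hw, hqw⟩ := nb_pos.1 (show 0 < nb G (T \ A) q by omega)
    obtain ⟨hwT, hwA⟩ := Finset.mem_sdiff.1 hw
    refine ⟨insert w A, Finset.insert_subset hwT hA, ?_, w, hq.snoc hwA hqw⟩
    rw [Finset.card_insert_of_notMem hwA, hcard]

theorem AP.odd_even {k : ℕ} (h : ∀ l, 3 ≤ l → l ≤ k + 2 → HasCycleLen G l) :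
    AP (HasCycleLen G) k :=
  ⟨3, 1, .inl rfl, fun i hi => h _ (by omega) (by omega)⟩

theorem AP.even_cycles {k : ℕ} (h : ∀ j, 2 ≤ j → j ≤ k + 1 → HasCycleLen G (2 * j)) :
    AP (HasCycleLen G) k :=
  ⟨4, 2, .inr rfl, fun i hi => by
    have := h (i + 2) (by omega) (by omega); rwa [show 4 + i * 2 = 2 * (i + 2) by omega]⟩

theorem Cmpl.km {S T : Finset V} (h : Cmpl G S T) {x y : V} (hx : x ∈ S) (hy : y ∈ T)  :
    KM G S T x y :=
  ⟨hx, hy, h.disj, fun x hx y hy _ => h x hx y hy⟩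

theorem KM.cycle_odd {S T : Finset V} {x₀ y₀ b : V} (h : KM G S T x₀ y₀) (hb : b ∈ T)
    (hyb : G.Adj y₀ b) (hS : 2 ≤ S.card) {j : ℕ} (hj : 1 ≤ j) (hjS : j ≤ S.card)
    (hjT : j < T.card) : HasCycleLen G (2 * j + 1) := by
  exact (h.y_even hS hb hyb.ne' hj hjS hjT).cycle (by omega) hyb.symm

section

variable [Fintype V] {k : ℕ} {S T : Finset V} {x₀ y₀ : V}

theorem iso_top (hd : ∀ v, k ≤ nb G Finset.univ v) (hn : Fintype.card V = k + 1) :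
    Nonempty (G ≃g (⊤ : SimpleGraph (Fin (k + 1)))) := by
  refine ⟨⟨Fintype.equivFinOfCardEq hn, fun {u v} => ?_⟩⟩
  simp only [top_adj, ne_eq, EmbeddingLike.apply_eq_iff_eq]
  refine ⟨fun huv => ?_, fun h => h.ne⟩
  refine adj_of_nb_ge (A := Finset.univ.erase u) ?_ v (by simpa using Ne.symm huv)
  rw [Finset.card_erase_of_mem (Finset.mem_univ _), Finset.card_univ, hn]
  refine (hd u).trans (Finset.card_le_card fun x hx => ?_)
  obtain ⟨-, hx⟩ := mem_nbs.1 hx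
  exact mem_nbs.2 ⟨by simpa using hx.ne', hx⟩

theorem iso_completeBipartite (h : Cmpl G S T) (hU : ∀ v, v ∈ S ∨ v ∈ T) (hS : S.card = k)
    (hSi : ∀ u ∈ S, ∀ v ∈ S, ¬G.Adj u v) (hTi : ∀ u ∈ T, ∀ v ∈ T, ¬G.Adj u v) :
    Nonempty (G ≃g completeBipartiteGraph (Fin k) (Fin (Fintype.card V - k))) := by
  have hTS : ∀ {v}, v ∉ S ↔ v ∈ T :=
    fun {v} => ⟨(hU v).resolve_left, fun hv => Finset.disjoint_right.1 h.disj hv⟩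
  have h1 : Fintype.card {v // v ∈ S} = k := by simpa using hS
  have h2 : Fintype.card {v // v ∉ S} = Fintype.card V - k := by
    rw [Fintype.card_subtype_compl, h1]
  let e : V ≃ Fin k ⊕ Fin (Fintype.card V - k) := (Equiv.sumCompl (· ∈ S)).symm.trans
    (Equiv.sumCongr (Fintype.equivFinOfCardEq h1) (Fintype.equivFinOfCardEq h2))
  have hl : ∀ v ∈ S, (e v).isLeft = true ∧ (e v).isRight = false := fun v hv => by
    simp [e, Equiv.sumCompl_symm_apply_of_pos, hv]
  have hr : ∀ v, v ∉ S → (e v).isLeft = false ∧ (e v).isRight = true := fun v hv => by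
    simp [e, Equiv.sumCompl_symm_apply_of_neg, hv]
  refine ⟨⟨e, fun {u v} => ?_⟩⟩
  simp only [completeBipartiteGraph_adj]
  by_cases hu : u ∈ S <;> by_cases hv : v ∈ S
  · simp [hl u hu, hl v hv, hSi u hu v hv]
  · simp [hl u hu, hr v hv, h u hu v (hTS.1 hv)]
  · simp [hr u hu, hl v hv, (h v hv u (hTS.1 hu)).symm]
  · simp [hr u hu, hr v hv, hTi u (hTS.1 hu) v (hTS.1 hv)]

/-- The case in which the bipartite graph is spanning and its smaller side has `k` vertices. -/
theorem KM.spanning_eq (h : KM G S T x₀ y₀) (hk : 3 ≤ k) (hd : ∀ v, k ≤ nb G Finset.univ v)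
    (hU : ∀ v, v ∈ S ∨ v ∈ T) (hS : S.card = k) (hT : k ≤ T.card) :
    AP (HasCycleLen G) k ∨
      Nonempty (G ≃g completeBipartiteGraph (Fin k) (Fin (Fintype.card V - k))) := by
  have hev : ∀ j, 2 ≤ j → j ≤ k → HasCycleLen G (2 * j) := fun j hj hjk =>
    h.cycle_even (by omega) (by omega) hj (by omega) (by omega)
  have hfin : (∀ j, 1 ≤ j → j < k → HasCycleLen G (2 * j + 1)) → AP (HasCycleLen G) k := fun ho =>
    AP.odd_even fun l hl hlk => by
      obtain ⟨j, rfl | rfl⟩ := Nat.even_or_odd' l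
      · exact hev j (by omega) (by omega)
      · exact ho j (by omega) (by omega)
  have hu : S ∪ T = Finset.univ := by ext v; simp [hU v]
  by_cases hy : ∃ b ∈ T, G.Adj y₀ b
  · obtain ⟨b, hb, hyb⟩ := hy
    exact .inl (hfin fun j hj hjk => h.cycle_odd hb hyb (by omega) hj (by omega) (by omega))
  push Not at hy
  have hc : Cmpl G S T := fun a ha b hb => by
    by_cases hby : b = y₀
    · subst hby
      refine (adj_of_nb_ge (A := S) ?_ a ha).symm
      have := hd b
      rw [← hu, nb_union h.disj, nb_eq_zero.2 hy] at this
      omega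
    · exact h.adj a ha b hb fun h' => hby h'.2
  by_cases hTi : ∀ u ∈ T, ∀ v ∈ T, ¬G.Adj u v
  · by_cases hSi : ∀ u ∈ S, ∀ v ∈ S, ¬G.Adj u v
    · exact .inr (iso_completeBipartite hc hU hS hSi hTi)
    · push Not at hSi
      obtain ⟨u, hu, v, hv, huv⟩ := hSi
      refine .inl (hfin fun j hj hjk => ?_)
      exact (AdmissiblePaths.pth_even hc hu hv huv.ne hj (by omega) (by omega)).cycle (by omega)
        huv.symm
  · push Not at hTi
    obtain ⟨u, hu, v, hv, huv⟩ := hTi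
    exact .inl (hfin fun j hj hjk =>
      (hc.km h.hx hu).cycle_odd hv huv (by omega) hj (by omega) (by omega))

/-- The case in which the bipartite graph is spanning and its smaller side has fewer than `k`
vertices. -/
theorem KM.spanning_lt (h : KM G S T x₀ y₀) (hd : ∀ v, k ≤ nb G Finset.univ v)
    (hU : ∀ v, v ∈ S ∨ v ∈ T) (hS2 : 2 ≤ S.card) (hS : S.card < k) (hST : S.card ≤ T.card) :
    AP (HasCycleLen G) k ∨ Nonempty (G ≃g (⊤ : SimpleGraph (Fin (k + 1)))) := by
  have hu : S ∪ T = Finset.univ := by ext v; simp [hU v]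
  have hcard : Fintype.card V = S.card + T.card := by
    rw [← Finset.card_univ, ← hu, Finset.card_union_of_disjoint h.disj]
  have hdT : ∀ v ∈ T, k - S.card ≤ nb G T v := fun v _ => by
    have := hd v
    rw [← hu, nb_union h.disj] at this
    have := nb_le_card (G := G) S v
    omega
  have hn : k + 1 ≤ Fintype.card V := by
    have h1 := hd x₀
    have h2 : nb G Finset.univ x₀ ≤ (Finset.univ.erase x₀).card := Finset.card_le_card fun x hx => by
      obtain ⟨-, hx⟩ := mem_nbs.1 hx
      simpa using hx.ne'
    rw [Finset.card_erase_of_mem (Finset.mem_univ _), Finset.card_univ] at h2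
    omega
  by_cases hn1 : Fintype.card V = k + 1
  · exact .inr (iso_top hd hn1)
  refine .inl (AP.odd_even fun l hl hlk => ?_)
  by_cases hls : l ≤ 2 * S.card
  · obtain ⟨j, rfl | rfl⟩ := Nat.even_or_odd' l
    · exact h.cycle_even (by omega) (by omega) (by omega) (by omega) (by omega)
    · obtain ⟨b, hb, hyb⟩ := nb_pos.1 (show 0 < nb G T y₀ by have := hdT y₀ h.hy; omega)
      exact h.cycle_odd hb hyb (by omega) (by omega) (by omega) (by omega)
  · obtain ⟨A, hA, hAc, q, hq⟩ := exists_greedy_pth hdT h.hy (l - 2 * S.card) (by omega)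
    obtain ⟨a, ha, hax⟩ := Finset.exists_mem_ne (show 1 < S.card by omega) x₀
    obtain ⟨c, hc, hca⟩ := Finset.exists_mem_ne (show 1 < S.card by omega) a
    have hqy : q ≠ y₀ := (hq.ne_of_pos (by omega)).symm
    have hTA : (T \ A).card = T.card - A.card := Finset.card_sdiff_of_subset hA
    have hC : Cmpl G S (T \ A) := fun x hx y hy => by
      obtain ⟨hy, hyA⟩ := Finset.mem_sdiff.1 hy
      exact h.adj x hx y hy fun h' => hyA (h'.2 ▸ hq.start_mem)
    have h1 := AdmissiblePaths.pth_even hC hc ha hca (i := S.card - 1) (by omega) (by omega)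
      (by omega)
    have h2 := hq.cycle_concat h1 ?_ (h.adj c hc q (hA hq.end_mem) fun h' => hqy h'.2).symm
      (h.adj a ha y₀ h.hy fun h' => hax h'.1) (by omega)
    · rwa [show l - 2 * S.card + 2 * (S.card - 1) + 2 = l by omega] at h2
    · exact Finset.disjoint_union_right.2 ⟨(h.disj.mono_right hA).symm, Finset.disjoint_sdiff⟩

end

section

variable {A : Finset V} {u v w x y : V}

theorem pth_two (hu : u ∈ A) (hv : v ∈ A) (hw : w ∈ A) (h1 : G.Adj u v) (h2 : G.Adj v w)
    (huw : u ≠ w) : Pth G A u w 2 :=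
  .cons hu h1 (.adj h2 (Finset.mem_erase.2 ⟨h1.ne', hv⟩) (Finset.mem_erase.2 ⟨huw.symm, hw⟩))

theorem pth_three (hu : u ∈ A) (hv : v ∈ A) (hw : w ∈ A) (hx : x ∈ A) (h1 : G.Adj u v)
    (h2 : G.Adj v w) (h3 : G.Adj w x) (huw : u ≠ w) (hux : u ≠ x) (hvx : v ≠ x) :
    Pth G A u x 3 :=
  .cons hu h1 (pth_two (Finset.mem_erase.2 ⟨h1.ne', hv⟩) (Finset.mem_erase.2 ⟨huw.symm, hw⟩)
    (Finset.mem_erase.2 ⟨hux.symm, hx⟩) h2 h3 hvx)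

theorem pth_four (hu : u ∈ A) (hv : v ∈ A) (hw : w ∈ A) (hx : x ∈ A) (hy : y ∈ A) (h1 : G.Adj u v)
    (h2 : G.Adj v w) (h3 : G.Adj w x) (h4 : G.Adj x y) (huw : u ≠ w) (hux : u ≠ x) (huy : u ≠ y)
    (hvx : v ≠ x) (hvy : v ≠ y) (hwy : w ≠ y) : Pth G A u y 4 :=
  .cons hu h1 (pth_three (Finset.mem_erase.2 ⟨h1.ne', hv⟩) (Finset.mem_erase.2 ⟨huw.symm, hw⟩)
    (Finset.mem_erase.2 ⟨hux.symm, hx⟩) (Finset.mem_erase.2 ⟨huy.symm, hy⟩) h2 h3 h4 hvx hvy hwy)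

end

section

variable [Fintype V] {k r : ℕ} {E F S T : Finset V} {x₀ y₀ : V}

theorem Piece.exists_attach_ne (hA : Amb G k F r) (hE : Piece G F E) (f : V) :
    ∃ f' ∈ F, f' ≠ f ∧ (nbS G E {f'}).Nonempty := by
  by_cases h : ∃ f ∈ F, ∀ e ∈ E, ¬G.Adj e f
  · obtain ⟨f₁, h1, f₂, h2, h12, h3, h4⟩ := hE.two_attach hA h
    by_cases hf : f₁ = f
    · exact ⟨f₂, h2, fun h => h12 (hf.trans h.symm), h4⟩
    · exact ⟨f₁, h1, hf, h3⟩
  · push Not at h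
    obtain ⟨f', hf', hne⟩ := Finset.exists_mem_ne (show 1 < F.card by have := hA.hF; omega) f
    obtain ⟨e, he, hef⟩ := h f' hf'
    exact ⟨f', hf', hne, nbS_nonempty.2 ⟨e, he, f', by simp, hef⟩⟩

/-- A piece attached to the side `S` only, where `S` has `r` vertices. -/
theorem KM.case_left (h : KM G S T x₀ y₀) (hA : Amb G k (S ∪ T) r) (hrk : r ≤ k)
    (hS : S.card = r) (hT : r ≤ T.card) (hE : Piece G (S ∪ T) E) (hX : ¬(nbS G E T).Nonempty)
    (hboth : ∀ E', Piece G (S ∪ T) E' → (nbS G E' S).Nonempty → (nbS G E' T).Nonempty →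
      AP (HasCycleLen G) k) : AP (HasCycleLen G) k := by
  rcases hrk.lt_or_eq with hrk | rfl
  · exact h.case_small hA hrk hS hT hE hX hboth
  · exact h.case_tight hA hS hT hE hX

/-- The main reduction, given the paths needed in `S ∪ T`. -/
theorem KM.case_piece (h : KM G S T x₀ y₀) (hA : Amb G k (S ∪ T) r) (hrk : r ≤ k)
    (hS : S.card = r) (hT : r ≤ T.card) (hE : Piece G (S ∪ T) E)
    (hboth : ∀ E', Piece G (S ∪ T) E' → (nbS G E' S).Nonempty → (nbS G E' T).Nonempty →
      AP (HasCycleLen G) k)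
    (hL : r < T.card → ∀ p ∈ T, ∀ q ∈ T, p ≠ q → ∀ i, 1 ≤ i → i ≤ r →
      Pth G (S ∪ T) p q (2 * i)) : AP (HasCycleLen G) k := by
  by_cases hY : (nbS G E T).Nonempty
  · by_cases hX : (nbS G E S).Nonempty
    · exact hboth E hE hX hY
    · rcases hT.lt_or_eq with hT | hT
      · exact hE.case_one hA hrk hX ⟨_, h.hx⟩ hE.disj
          (AP.even r fun i hi1 hi p hp q hq hpq => hL hT p hp q hq hpq i hi1 hi)
      · have hc := Finset.union_comm S T
        exact h.symm.case_left (hc ▸ hA) hrk hT.symm hS.ge (hc ▸ hE) hX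
          fun E' hE' h1 h2 => hboth E' (hc ▸ hE') h2 h1
  · exact h.case_left hA hrk hS hT hE hY hboth

theorem KM.spanning (h : KM G S T x₀ y₀) (hk : 3 ≤ k) (hd : ∀ v, k ≤ nb G Finset.univ v)
    (hU : ∀ v, v ∈ S ∨ v ∈ T) (hS2 : 2 ≤ S.card) (hS : S.card ≤ k) (hST : S.card ≤ T.card) :
    AP (HasCycleLen G) k ∨ Nonempty (G ≃g (⊤ : SimpleGraph (Fin (k + 1)))) ∨
      Nonempty (G ≃g completeBipartiteGraph (Fin k) (Fin (Fintype.card V - k))) := by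
  rcases hS.lt_or_eq with hlt | heq
  · exact (h.spanning_lt hd hU hS2 hlt hST).imp_right .inl
  · exact (h.spanning_eq hk hd hU heq (by omega)).imp_right .inr

theorem spanning_or_piece (S T : Finset V) :
    (∀ v, v ∈ S ∨ v ∈ T) ∨ ∃ E, Piece G (S ∪ T) E := by
  by_cases hU : ∀ v, v ∈ S ∨ v ∈ T
  · exact .inl hU
  · push Not at hU
    obtain ⟨v, hv⟩ := hU
    obtain ⟨E, -, hE⟩ := exists_piece (G := G) (F := S ∪ T) (v := v) (by simpa using hv)
    exact .inr ⟨E, hE⟩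

theorem KM.three_le (h : KM G S T x₀ y₀) (hA : Amb G k (S ∪ T) S.card) (hS3 : 3 ≤ S.card)
    (hSk : S.card ≤ k) (hST : S.card ≤ T.card) :
    AP (HasCycleLen G) k ∨ Nonempty (G ≃g (⊤ : SimpleGraph (Fin (k + 1)))) ∨
      Nonempty (G ≃g completeBipartiteGraph (Fin k) (Fin (Fintype.card V - k))) := by
  rcases spanning_or_piece (G := G) S T with hU | ⟨E, hE⟩
  · exact h.spanning hA.hk hA.deg hU (by omega) hSk hST
  · exact .inl (h.case_piece hA hSk rfl hST hE
      (fun E' hE' h1 h2 => h.case_both hA hSk hS3 le_rfl hST hE' h1 h2)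
      fun hlt p hp q hq hpq i hi1 hi => h.pth_even hS3 hp hq hpq hi1 hi (by omega))

theorem Cmpl.two (h : Cmpl G S T) (hA : Amb G k (S ∪ T) 2) (hS : S.card = 2) (hT : 2 ≤ T.card) :
    AP (HasCycleLen G) k ∨ Nonempty (G ≃g (⊤ : SimpleGraph (Fin (k + 1)))) ∨
      Nonempty (G ≃g completeBipartiteGraph (Fin k) (Fin (Fintype.card V - k))) := by
  obtain ⟨x, hx⟩ := Finset.card_pos.1 (show 0 < S.card by omega)
  obtain ⟨y, hy⟩ := Finset.card_pos.1 (show 0 < T.card by omega)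
  have hk := hA.hk
  rcases spanning_or_piece (G := G) S T with hU | ⟨E, hE⟩
  · exact (h.km hx hy).spanning hA.hk hA.deg hU hS.ge (by omega) (by omega)
  · refine .inl ((h.km hx hy).case_piece hA (by omega) hS hT hE
      (fun E' hE' h1 h2 => h.case_both hA (by omega) hS.ge hT hE' h1 h2)
      fun hlt p hp q hq hpq i hi1 hi => ?_)
    have := AdmissiblePaths.pth_even h.symm hp hq hpq hi1 (by omega) (by omega)
    rwa [Finset.union_comm] at this

/-- A piece attached to the exceptional vertex `y₀`, which has a neighbour in `T`. -/
theorem KM.two_edge (h : KM G S T x₀ y₀) (hA : Amb G k (S ∪ T) 2) (hS : S.card = 2)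
    (hT : 3 ≤ T.card) {b : V} (hb : b ∈ T) (hyb : G.Adj y₀ b) (hE : Piece G (S ∪ T) E) :
    AP (HasCycleLen G) k := by
  have hk := hA.hk
  obtain ⟨a, ha, hax⟩ := Finset.exists_mem_ne (show 1 < S.card by omega) x₀
  have hSa : ∀ s ∈ S, s = x₀ ∨ s = a := by
    intro s hs
    by_contra hne
    push Not at hne
    have : ({x₀, a, s} : Finset V) ⊆ S := by
      intro z; simp only [Finset.mem_insert, Finset.mem_singleton]
      rintro (rfl | rfl | rfl) <;> [exact h.hx; exact ha; exact hs]
    have h3 := Finset.card_le_card this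
    rw [Finset.card_eq_three.2 ⟨x₀, a, s, hax.symm, hne.1.symm, hne.2.symm, rfl⟩] at h3
    omega
  have hya : G.Adj y₀ a := (h.adj a ha y₀ h.hy fun h' => hax h'.1).symm
  have hadj : ∀ s ∈ S, ∀ t ∈ T, t ≠ y₀ → G.Adj s t := fun s hs t ht hty =>
    h.adj s hs t ht fun h' => hty h'.2
  have hby := hyb.ne'
  have hx := h.hx
  have hy := h.hy
  have hxF : x₀ ∈ S ∪ T := Finset.mem_union_left _ hx
  have haF : a ∈ S ∪ T := Finset.mem_union_left _ ha
  have hyF : y₀ ∈ S ∪ T := Finset.mem_union_right _ hy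
  have hbF : b ∈ S ∪ T := Finset.mem_union_right _ hb
  have hxy := h.ne hx hy
  have hTE : 2 ≤ (T.erase y₀).card := by rw [Finset.card_erase_of_mem hy]; omega
  have hother : ∀ t : V, ∃ c ∈ T, c ≠ y₀ ∧ c ≠ t := fun t => exists_ne_ne hT y₀ t
  by_cases hEy : (nbS G E {y₀}).Nonempty
  · refine hE.cycles hA (by omega) (P := {y₀}) (Q := (S ∪ T).erase y₀) ?_ hEy ?_ (by simp)
      (AP.two (n := 2) (m := 4) ?_ ?_ (.inr rfl))
    · intro e _ f hf _
      simp only [Finset.mem_union, Finset.mem_singleton, Finset.mem_erase] at hf ⊢; tauto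
    · obtain ⟨f, hf, hfy, hfE⟩ := hE.exists_attach_ne hA y₀
      obtain ⟨d, hd, w, hw, hdw⟩ := nbS_nonempty.1 hfE
      rw [Finset.mem_singleton] at hw
      subst hw
      exact nbS_nonempty.2 ⟨d, hd, w, Finset.mem_erase.2 ⟨hfy, hf⟩, hdw⟩
    · intro p hp q hq
      rw [Finset.mem_singleton] at hp
      subst hp
      obtain ⟨hqp, hq⟩ := Finset.mem_erase.1 hq
      rcases Finset.mem_union.1 hq with hqS | hqT
      · exact pth_two hyF hbF hq hyb (hadj q hqS b hb hby).symm hqp.symm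
      · exact pth_two hyF haF hq hya (hadj a ha q hqT hqp) hqp.symm
    · intro p hp q hq
      rw [Finset.mem_singleton] at hp
      subst hp
      obtain ⟨hqp, hq⟩ := Finset.mem_erase.1 hq
      rcases Finset.mem_union.1 hq with hqS | hqT
      · obtain ⟨s, hs, hsq⟩ := Finset.exists_mem_ne (show 1 < S.card by omega) q
        obtain ⟨c, hc, hcp, hcb⟩ := hother b
        exact pth_four hyF hbF (Finset.mem_union_left _ hs) (Finset.mem_union_right _ hc) hq hyb
          (hadj s hs b hb hby).symm (hadj s hs c hc hcp) (hadj q hqS c hc hcp).symm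
          (h.ne hs hy).symm hcp.symm hqp.symm hcb.symm (h.ne hqS hb).symm hsq
      · obtain ⟨c, hc, hcp, hcq⟩ := hother q
        exact pth_four hyF haF (Finset.mem_union_right _ hc) hxF hq hya (hadj a ha c hc hcp)
          (hadj x₀ hx c hc hcp).symm (hadj x₀ hx q hqT hqp) hcp.symm hxy.symm hqp.symm hax
          (h.ne ha hqT) hcq
  have hEy' : ∀ e ∈ E, ¬G.Adj e y₀ := fun e he hey =>
    hEy (nbS_nonempty.2 ⟨e, he, y₀, by simp, hey⟩)
  have hsub : S ∪ T.erase y₀ ⊆ S ∪ T := h.sub_left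
  obtain ⟨f₁, h1, f₂, h2, h12, h3, h4⟩ := hE.two_attach hA ⟨y₀, hyF, hEy'⟩
  have hne : ∀ {f : V}, (nbS G E {f}).Nonempty → f ≠ y₀ := fun {f} hf hfy => hEy (hfy ▸ hf)
  have hlift : ∀ {f : V} {W : Finset V}, (nbS G E {f}).Nonempty → f ∈ W → (nbS G E W).Nonempty := by
    intro f W hf hfW
    obtain ⟨d, hd, w, hw, hdw⟩ := nbS_nonempty.1 hf
    rw [Finset.mem_singleton] at hw
    subst hw
    exact nbS_nonempty.2 ⟨d, hd, w, hfW, hdw⟩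
  by_cases hES : (nbS G E S).Nonempty
  · by_cases hET : (nbS G E (T.erase y₀)).Nonempty
    · refine hE.cycles hA (by omega) (P := S) (Q := T.erase y₀) ?_ hES hET
        (h.disj.mono_right (Finset.erase_subset _ _)) (AP.odd 2 fun i hi p hp q hq => ?_)
      · intro e he f hf hef
        have : f ≠ y₀ := by rintro rfl; exact hEy' e he hef
        simp only [Finset.mem_union, Finset.mem_erase] at hf ⊢; tauto
      · exact (AdmissiblePaths.pth_odd h.left hp hq (by omega) (by omega)).mono hsub
    · have hfS : ∀ {f : V}, f ∈ S ∪ T → (nbS G E {f}).Nonempty → f ∈ S := fun {f} hf hfE =>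
        (Finset.mem_union.1 hf).resolve_right fun hfT =>
          hET (hlift hfE (Finset.mem_erase.2 ⟨hne hfE, hfT⟩))
      have hxa : (nbS G E {x₀}).Nonempty ∧ (nbS G E {a}).Nonempty := by
        rcases hSa f₁ (hfS h1 h3) with rfl | rfl <;> rcases hSa f₂ (hfS h2 h4) with rfl | rfl <;>
          first | exact absurd rfl h12 | exact ⟨h3, h4⟩ | exact ⟨h4, h3⟩
      refine hE.cycles hA (by omega) (P := {x₀}) (Q := {a}) ?_ hxa.1 hxa.2 (by simpa using hax.symm)
        (AP.two (n := 2) (m := 3) ?_ ?_ (.inl rfl))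
      · intro e he f hf hef
        simpa using hSa f (hfS hf (nbS_nonempty.2 ⟨e, he, f, by simp, hef⟩))
      · intro p hp q hq
        rw [Finset.mem_singleton] at hp hq
        subst hp hq
        exact pth_two hxF hbF haF (hadj _ hx b hb hby) (hadj _ ha b hb hby).symm hax.symm
      · intro p hp q hq
        rw [Finset.mem_singleton] at hp hq
        subst hp hq
        exact pth_three hxF hbF hyF haF (hadj _ hx b hb hby) hyb.symm hya hxy hax.symm
          (h.ne ha hb).symm
  · have hfT : ∀ {f : V}, f ∈ S ∪ T → (nbS G E {f}).Nonempty → f ∈ T.erase y₀ := fun {f} hf hfE =>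
      Finset.mem_erase.2 ⟨hne hfE, (Finset.mem_union.1 hf).resolve_left fun hfS =>
        hES (hlift hfE hfS)⟩
    have hL : AP (fun n => ∀ p ∈ T.erase y₀, ∀ q ∈ T.erase y₀, p ≠ q → Pth G (S ∪ T) p q n) 2 := by
      by_cases hT4 : 4 ≤ T.card
      · refine AP.even 2 fun i hi1 hi p hp q hq hpq => ?_
        have := AdmissiblePaths.pth_even h.left.symm hp hq hpq hi1
          (by rw [Finset.card_erase_of_mem hy]; omega) (by omega)
        rw [Finset.union_comm] at this
        exact this.mono hsub
      · have hmid : ∀ p ∈ T.erase y₀, ∀ q ∈ T.erase y₀, p ≠ q → p = b ∨ q = b := by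
          intro p hp q hq hpq
          by_contra hne
          push Not at hne
          have : ({b, p, q} : Finset V) ⊆ T.erase y₀ := by
            intro z; simp only [Finset.mem_insert, Finset.mem_singleton]
            rintro (rfl | rfl | rfl) <;> [exact Finset.mem_erase.2 ⟨hby, hb⟩; exact hp; exact hq]
          have h3 := Finset.card_le_card this
          rw [Finset.card_eq_three.2 ⟨b, p, q, hne.1.symm, hne.2.symm, hpq, rfl⟩,
            Finset.card_erase_of_mem hy] at h3
          omega
        have hthree : ∀ q ∈ T.erase y₀, b ≠ q → Pth G (S ∪ T) b q 3 := by
          intro q hq hbq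
          obtain ⟨hqy, hq⟩ := Finset.mem_erase.1 hq
          exact pth_three hbF hyF haF (Finset.mem_union_right _ hq) hyb.symm hya (hadj a ha q hq hqy)
            (h.ne ha hb).symm hbq hqy.symm
        refine AP.two (n := 2) (m := 3) ?_ ?_ (.inl rfl)
        · intro p hp q hq hpq
          obtain ⟨hpy, hp⟩ := Finset.mem_erase.1 hp
          obtain ⟨hqy, hq⟩ := Finset.mem_erase.1 hq
          exact pth_two (Finset.mem_union_right _ hp) haF (Finset.mem_union_right _ hq)
            (hadj a ha p hp hpy).symm (hadj a ha q hq hqy) hpq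
        · intro p hp q hq hpq
          rcases hmid p hp q hq hpq with rfl | rfl
          · exact hthree q hq hpq
          · exact (hthree p hp hpq.symm).symm
    refine hE.cycles hA (by omega) (P := {f₁}) (Q := (T.erase y₀).erase f₁) ?_ h3
      (hlift h4 (Finset.mem_erase.2 ⟨h12.symm, hfT h2 h4⟩)) (by simp) (hL.mono ?_)
    · intro e he f hf hef
      have := hfT hf (nbS_nonempty.2 ⟨e, he, f, by simp, hef⟩)
      by_cases hff : f = f₁
      · simp [hff]
      · exact Finset.mem_union_right _ (Finset.mem_erase.2 ⟨hff, this⟩)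
    · intro n hn p hp q hq
      rw [Finset.mem_singleton] at hp
      subst hp
      exact hn p (hfT h1 h3) q (Finset.mem_of_mem_erase hq) (Finset.ne_of_mem_erase hq).symm

theorem KM.two (h : KM G S T x₀ y₀) (hA : Amb G k (S ∪ T) 2) (hS : S.card = 2) (hT : 3 ≤ T.card) :
    AP (HasCycleLen G) k ∨ Nonempty (G ≃g (⊤ : SimpleGraph (Fin (k + 1)))) ∨
      Nonempty (G ≃g completeBipartiteGraph (Fin k) (Fin (Fintype.card V - k))) := by
  have hk := hA.hk
  by_cases hxy : G.Adj x₀ y₀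
  · refine Cmpl.two (fun a ha b hb => ?_) hA hS (by omega)
    by_cases hab : a = x₀ ∧ b = y₀
    · rw [hab.1, hab.2]; exact hxy
    · exact h.adj a ha b hb hab
  by_cases hy : ∃ b ∈ T, G.Adj y₀ b
  · obtain ⟨b, hb, hyb⟩ := hy
    rcases spanning_or_piece (G := G) S T with hU | ⟨E, hE⟩
    · exact h.spanning hk hA.deg hU hS.ge (by omega) (by omega)
    · exact .inl (h.two_edge hA hS hT hb hyb hE)
  push Not at hy
  have hc : (T.erase y₀).card = T.card - 1 := Finset.card_erase_of_mem h.hy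
  refine h.left.two ⟨hk, le_rfl, ?_, hA.two, hA.deg, fun v hv => ?_⟩ hS (by omega)
  · rw [Finset.card_union_of_disjoint (h.disj.mono_right (Finset.erase_subset _ _))]; omega
  · by_cases hvy : v = y₀
    · subst hvy
      have h1 : nb G (S ∪ T.erase v) v ≤ (S.erase x₀).card := Finset.card_le_card fun x hx => by
        obtain ⟨hx, hvx⟩ := mem_nbs.1 hx
        rcases Finset.mem_union.1 hx with hx | hx
        · exact Finset.mem_erase.2 ⟨by rintro rfl; exact hxy hvx.symm, hx⟩
        · exact absurd hvx (hy x (Finset.mem_of_mem_erase hx))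
      rw [Finset.card_erase_of_mem h.hx] at h1
      omega
    · have h1 := hA.out v (by
        simp only [Finset.mem_union, Finset.mem_erase] at hv ⊢; tauto)
      have h2 := nb_mono (G := G) h.sub_left v
      omega

theorem KM.main (h : KM G S T x₀ y₀) (hA : Amb G k (S ∪ T) S.card) (hST : S.card ≤ T.card)
    (hc : Cmpl G S T ∨ 3 ≤ T.card) :
    AP (HasCycleLen G) k ∨ Nonempty (G ≃g (⊤ : SimpleGraph (Fin (k + 1)))) ∨
      Nonempty (G ≃g completeBipartiteGraph (Fin k) (Fin (Fintype.card V - k))) := by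
  have hk := hA.hk
  have hr := hA.hr
  by_cases hSk : k < S.card
  · exact .inl (AP.even_cycles fun j hj hjk =>
      h.cycle_even (by omega) (by omega) hj (by omega) (by omega))
  by_cases hS3 : 3 ≤ S.card
  · exact h.three_le hA hS3 (by omega) hST
  have hS2 : S.card = 2 := by omega
  rw [hS2] at hA
  exact hc.elim (fun hc => hc.two hA hS2 (by omega)) fun hT => h.two hA hS2 hT

theorem KConnected.two_le_bd (h2 : KConnected G 2) {D : Finset V} (hD : D.Nonempty)
    (hv : ∃ v, v ∉ D ∧ v ∉ bd G Finset.univ D) : 2 ≤ (bd G Finset.univ D).card := by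
  by_contra hlt
  obtain ⟨v, hvD, hvB⟩ := hv
  obtain ⟨d, hd⟩ := hD
  have hdB : d ∉ bd G Finset.univ D := fun h => (mem_bd.1 h).1.2 hd
  obtain ⟨w⟩ := (h2.2 (bd G Finset.univ D) (by omega)).preconnected ⟨d, by simpa using hdB⟩
    ⟨v, by simpa using hvB⟩
  have key : ∀ {a b : ↥((↑(bd G Finset.univ D) : Set V)ᶜ)},
      (G.induce ((↑(bd G Finset.univ D) : Set V)ᶜ)).Walk a b → a.1 ∈ D → b.1 ∈ D := by
    intro a b w
    induction w with
    | nil => exact id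
    | @cons a c b hac _ ih =>
      intro ha
      refine ih ?_
      by_contra hcD
      exact c.2 (Finset.mem_coe.2 (mem_bd.2 ⟨⟨Finset.mem_univ _, hcD⟩, a.1, ha, hac⟩))
  exact hvD (key w hd)

theorem KM.main_of_connected [DecidableRel G.Adj] (h : KM G S T x₀ y₀) (hk : 3 ≤ k)
    (h2 : KConnected G 2) (hδ : ∀ v, k ≤ G.degree v) (hS : 2 ≤ S.card) (hST : S.card ≤ T.card)
    (hc : Cmpl G S T ∨ 3 ≤ T.card)
    (hout : ∀ v, v ∉ S → v ∉ T → ((S ∪ T).filter (fun u => G.Adj v u)).card ≤ S.card - 1) :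
    AP (HasCycleLen G) k ∨ Nonempty (G ≃g (⊤ : SimpleGraph (Fin (k + 1)))) ∨
      Nonempty (G ≃g completeBipartiteGraph (Fin k) (Fin (Fintype.card V - k))) := by
  refine h.main ⟨hk, hS, ?_, fun D => KConnected.two_le_bd h2, fun v => ?_, fun v hv => ?_⟩ hST hc
  · rw [Finset.card_union_of_disjoint h.disj]; omega
  · have : nbs G Finset.univ v = G.neighborFinset v := by ext; simp
    rw [nb, this]
    exact hδ v
  · have : nbs G (S ∪ T) v = (S ∪ T).filter (fun u => G.Adj v u) := by ext; simp
    rw [nb, this]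
    simp only [Finset.mem_union, not_or] at hv
    have := hout v hv.1 hv.2
    omega

end

end AdmissiblePaths

theorem stmt12 {V : Type*} [Fintype V] [DecidableEq V] (G : SimpleGraph V)
    [DecidableRel G.Adj] (k : ℕ) (hk : 3 ≤ k)
    (h2 : KConnected G 2) (hδ : ∀ v : V, k ≤ G.degree v)
    (S T : Finset V) (hST : Disjoint S T)
    (hF : (2 ≤ min S.card T.card ∧ ∀ x ∈ S, ∀ y ∈ T, G.Adj x y) ∨
          (2 ≤ min S.card T.card ∧ 3 ≤ max S.card T.card ∧
            ∃ x₀ ∈ S, ∃ y₀ ∈ T,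
              ∀ x ∈ S, ∀ y ∈ T, ¬(x = x₀ ∧ y = y₀) → G.Adj x y))
    (hout : ∀ v : V, v ∉ S → v ∉ T →
        ((S ∪ T).filter (fun u => G.Adj v u)).card ≤ min S.card T.card - 1) :
    HasAdmissibleCycles G k ∨
      Nonempty (G ≃g (⊤ : SimpleGraph (Fin (k + 1)))) ∨
      Nonempty (G ≃g completeBipartiteGraph (Fin k) (Fin (Fintype.card V - k))) := by
  have hmin : 2 ≤ min S.card T.card := hF.elim And.left And.left
  obtain ⟨x₀, y₀, h, hc⟩ : ∃ x₀ y₀, AdmissiblePaths.KM G S T x₀ y₀ ∧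
      (AdmissiblePaths.Cmpl G S T ∨ 3 ≤ max S.card T.card) := by
    rcases hF with ⟨-, h⟩ | ⟨-, hmax, x₀, hx, y₀, hy, h⟩
    · obtain ⟨x, hx⟩ := Finset.card_pos.1 (show 0 < S.card by omega)
      obtain ⟨y, hy⟩ := Finset.card_pos.1 (show 0 < T.card by omega)
      exact ⟨x, y, AdmissiblePaths.Cmpl.km h hx hy, .inl h⟩
    · exact ⟨x₀, y₀, ⟨hx, hy, hST, h⟩, .inr hmax⟩
  rcases le_total S.card T.card with hle | hle
  · rw [min_eq_left hle] at hmin hout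
    rw [max_eq_right hle] at hc
    exact h.main_of_connected hk h2 hδ hmin hle hc hout
  · rw [min_eq_right hle] at hmin hout
    rw [max_eq_left hle] at hc
    refine h.symm.main_of_connected hk h2 hδ hmin hle (hc.imp_left fun h => h.symm)
      fun v hT hS => ?_
    rw [Finset.union_comm]
    exact hout v hS hT
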